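/- Let k ∈ ℤ with k ∉ {0, 2} and let f = x² + kx − 1 ∈ ℤ[x]. Then for every a₀ ∈ ℤ, the natural density of the set P(f, a₀) of prime divisors of the orbit of a₀ under f exists and equals 0. -/

import Mathlib

open Polynomial Filter

/-- The `n`-th iterate of a polynomial, with `f^0 = X`. -/
noncomputable def polyIter (f : Polynomial ℤ) : ℕ → Polynomial ℤ
  | 0 => X
  | n + 1 => f.comp (polyIter f n)

open scoped Classical in
/-- The number of elements of `S` that are at most `x`. -/
noncomputable def primeCount (S : Set ℕ) (x : ℕ) : ℕ :=
  ((Finset.range (x + 1)).filter (fun p => p ∈ S)).card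

/-- A set `S` of primes has natural density zero:
`lim_{x → ∞} #{p ∈ S : p ≤ x} / #{p prime : p ≤ x}` exists and equals `0`. -/
def HasPrimeDensityZero (S : Set ℕ) : Prop :=
  Tendsto (fun x : ℕ => (primeCount S x : ℝ) / (primeCount {p | p.Prime} x : ℝ))
    atTop (nhds 0)

/-- `P(f, a₀)`: the set of primes dividing some nonzero term of the orbit of `a₀` under `f`. -/
def orbitPrimes (f : Polynomial ℤ) (a₀ : ℤ) : Set ℕ :=
  {p | p.Prime ∧ ∃ n : ℕ, (fun x => Polynomial.eval x f)^[n] a₀ ≠ 0 ∧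
    (p : ℤ) ∣ (fun x => Polynomial.eval x f)^[n] a₀}

section
open MeasureTheory Finset

namespace PD

/-- summatory function -/
noncomputable def Sm (w : ℕ → ℝ) (y : ℝ) : ℝ := ∑ n ∈ Icc 0 ⌊y⌋₊, w n

lemma abel_pow {w : ℕ → ℝ} (hw0 : w 0 = 0) (hw : ∀ n, 0 ≤ w n) {C θ : ℝ} (hC : 0 ≤ C)
    (hθ : 0 < θ) (hθ1 : θ < 1) (h : ∀ y : ℝ, 1 ≤ y → Sm w y ≤ C * y) {x : ℝ} (hx : 1 ≤ x) :
    ∑ n ∈ Icc 0 ⌊x⌋₊, w n * (x / n) ^ θ ≤ C * (1 + 1 / (1 - θ)) * x := by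
  have hx0 : 0 < x := by linarith
  have hd : ∀ t ∈ Set.Icc 1 x, HasDerivAt (fun t : ℝ => t ^ (-θ)) (-θ * t ^ (-θ - 1)) t := by
    intro t ht
    exact Real.hasDerivAt_rpow_const (Or.inl (by linarith [ht.1]))
  have hint0 : ContinuousOn (fun t : ℝ => -θ * t ^ (-θ - 1)) (Set.Icc 1 x) := by
    refine ContinuousOn.mul continuousOn_const (ContinuousOn.rpow_const continuousOn_id ?_)
    intro t ht; left; linarith [ht.1]
  have hinteg : IntegrableOn (deriv (fun t : ℝ => t ^ (-θ))) (Set.Icc 1 x) := by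
    refine (hint0.integrableOn_Icc).congr_fun (fun t ht => ((hd t ht).deriv).symm) measurableSet_Icc
  have key := sum_mul_eq_sub_integral_mul₀ (𝕜 := ℝ) w (f := fun t : ℝ => t ^ (-θ)) hw0 x
    (fun t ht => (hd t ht).differentiableAt) hinteg
  have hI : -∫ t in Set.Ioc 1 x, deriv (fun t : ℝ => t ^ (-θ)) t * ∑ k ∈ Icc 0 ⌊t⌋₊, w k
      ≤ C * (1 / (1 - θ)) * x ^ (1 - θ) := by
    rw [← integral_neg]
    have : ∫ t in Set.Ioc 1 x, -(deriv (fun t : ℝ => t ^ (-θ)) t * ∑ k ∈ Icc 0 ⌊t⌋₊, w k)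
        ≤ ∫ t in Set.Ioc 1 x, C * t ^ (-θ) := by
      refine setIntegral_mono_on ?_ ?_ measurableSet_Ioc ?_
      · refine (((integrableOn_mul_sum_Icc (𝕜 := ℝ) w (m := 0) zero_le_one hinteg).mono_set
          Set.Ioc_subset_Icc_self).neg)
      · refine (ContinuousOn.integrableOn_Icc ?_).mono_set Set.Ioc_subset_Icc_self
        refine ContinuousOn.mul continuousOn_const (ContinuousOn.rpow_const continuousOn_id ?_)
        intro t ht; left; linarith [ht.1]
      · intro t ht
        have ht' : t ∈ Set.Icc 1 x := Set.Ioc_subset_Icc_self ht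
        have ht0 : 0 < t := by linarith [ht'.1]
        rw [(hd t ht').deriv]
        have h1 := h t ht'.1
        have h2 : t ^ (-θ) = t ^ (-θ - 1) * t := by
          rw [← Real.rpow_add_one ht0.ne']; ring_nf
        have h3 : 0 ≤ t ^ (-θ - 1) := by positivity
        have h4 : 0 ≤ Sm w t := sum_nonneg fun _ _ => hw _
        unfold Sm at h1 h4
        rw [h2]
        calc -(-θ * t ^ (-θ - 1) * ∑ k ∈ Icc 0 ⌊t⌋₊, w k)
            = θ * (t ^ (-θ - 1) * ∑ k ∈ Icc 0 ⌊t⌋₊, w k) := by ring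
          _ ≤ 1 * (t ^ (-θ - 1) * (C * t)) := by gcongr
          _ = _ := by ring
    refine this.trans ?_
    rw [← intervalIntegral.integral_of_le hx, intervalIntegral.integral_const_mul,
      integral_rpow (Or.inl (by linarith))]
    have : (1:ℝ) ^ (-θ + 1) = 1 := Real.one_rpow _
    rw [this, mul_assoc]
    have e : -θ + 1 = 1 - θ := by ring
    rw [e]
    gcongr
    rw [one_div, inv_mul_eq_div]
    have : 0 < 1 - θ := by linarith
    gcongr
    linarith
  have e1 : ∑ n ∈ Icc 0 ⌊x⌋₊, w n * (x / n) ^ θ = x ^ θ * ∑ k ∈ Icc 0 ⌊x⌋₊, (k : ℝ) ^ (-θ) * w k := by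
    rw [mul_sum]
    refine sum_congr rfl fun n _ => ?_
    rw [Real.div_rpow hx0.le (Nat.cast_nonneg _), Real.rpow_neg (Nat.cast_nonneg _)]
    ring
  rw [e1, key]
  have h1 := h x hx
  unfold Sm at h1
  have e2 : x ^ θ * x ^ (1 - θ) = x := by rw [← Real.rpow_add hx0]; simp
  have e3 : x ^ θ * x ^ (-θ) = 1 := by rw [← Real.rpow_add hx0]; simp
  calc x ^ θ * ((fun t : ℝ => t ^ (-θ)) x * ∑ k ∈ Icc 0 ⌊x⌋₊, w k - ∫ t in Set.Ioc 1 x, deriv (fun t : ℝ => t ^ (-θ)) t * ∑ k ∈ Icc 0 ⌊t⌋₊, w k)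
      ≤ x ^ θ * (x ^ (-θ) * (C * x) + C * (1 / (1 - θ)) * x ^ (1 - θ)) := by
        rw [sub_eq_add_neg]
        simp only []
        gcongr
    _ = (x ^ θ * x ^ (-θ)) * (C * x) + C * (1 / (1 - θ)) * (x ^ θ * x ^ (1 - θ)) := by ring
    _ = _ := by rw [e2, e3]; ring

lemma Sm_meas (w : ℕ → ℝ) : Measurable (Sm w) := by
  unfold Sm
  exact (measurable_from_nat (f := fun N : ℕ => ∑ n ∈ Icc 0 N, w n)).comp Nat.measurable_floor

lemma abel_G {w : ℕ → ℝ} (hw0 : w 0 = 0) {c C δ : ℝ} (hc : 0 < c) (hC : 0 ≤ C)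
    (hδ : 0 < δ) (hδ1 : δ < 1) (h : ∀ y : ℝ, 1 ≤ y → |Sm w y - c * y| ≤ C * y ^ (1 - δ)) :
    ∃ κ K : ℝ, 0 ≤ K ∧ ∀ x : ℝ, 1 ≤ x →
    |∑ n ∈ Icc 0 ⌊x⌋₊, w n * (Real.log n - x / n - κ)| ≤ K * (1 + Real.log x) * x ^ (1 - δ) := by
  set E : ℝ → ℝ := fun y => Sm w y - c * y with hE
  have hEm : Measurable E := (Sm_meas w).sub (measurable_const.mul measurable_id)
  have hbd : ∀ t : ℝ, 1 ≤ t → |E t / t ^ 2| ≤ C * t ^ (-1 - δ) := by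
    intro t ht
    have ht0 : 0 < t := by linarith
    rw [abs_div, abs_of_pos (by positivity : 0 < t ^ 2), div_le_iff₀ (by positivity)]
    have : t ^ (-1 - δ) * t ^ 2 = t ^ (1 - δ) := by
      rw [← Real.rpow_natCast, ← Real.rpow_add ht0]; norm_num; ring_nf
    rw [mul_assoc, this]; exact h t ht
  have hinteg : IntegrableOn (fun t => E t / t ^ 2) (Set.Ioi 1) := by
    refine Integrable.mono' (g := fun t => C * t ^ (-1 - δ)) ?_ ?_ ?_
    · exact ((integrableOn_Ioi_rpow_of_lt (by linarith) zero_lt_one).const_mul C)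
    · exact (hEm.div (measurable_id.pow_const 2)).aestronglyMeasurable
    · refine (ae_restrict_iff' measurableSet_Ioi).2 (Filter.Eventually.of_forall fun t ht => ?_)
      rw [Real.norm_eq_abs]; exact hbd t (le_of_lt ht)
  set I := ∫ t in Set.Ioi 1, E t / t ^ 2 with hI
  set κ := -2 - I / c with hκ
  refine ⟨κ, c + (2 + |κ|) * C + C / (1 - δ) + C / δ, by
    have : 0 < 1 - δ := by linarith
    positivity, fun x hx => ?_⟩
  have hx0 : 0 < x := by linarith
  have hd : ∀ t ∈ Set.Icc 1 x, HasDerivAt (fun t : ℝ => Real.log t - x / t - κ) (1 / t + x / t ^ 2) t := by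
    intro t ht
    have ht0 : t ≠ 0 := by linarith [ht.1]
    have h1 := (Real.hasDerivAt_log ht0).sub ((hasDerivAt_const t x).div (hasDerivAt_id t) ht0)
    have h2 : HasDerivAt (fun t : ℝ => Real.log t - x / t - κ) (t⁻¹ - ((0 * t - x * 1) / t ^ 2)) t := h1.sub_const κ
    convert h2 using 1
    field_simp; ring
  have hcont : ContinuousOn (fun t : ℝ => 1 / t + x / t ^ 2) (Set.Icc 1 x) := by
    have hne : ∀ t ∈ Set.Icc 1 x, t ≠ 0 := fun t ht => by linarith [ht.1]
    refine ContinuousOn.add (continuousOn_const.div continuousOn_id hne)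
      (continuousOn_const.div (continuousOn_id.pow 2) fun t ht => pow_ne_zero 2 (hne t ht))
  have hinteg' : IntegrableOn (deriv (fun t : ℝ => Real.log t - x / t - κ)) (Set.Icc 1 x) :=
    (hcont.integrableOn_Icc).congr_fun (fun t ht => ((hd t ht).deriv).symm) measurableSet_Icc
  have key := sum_mul_eq_sub_integral_mul₀ (𝕜 := ℝ) w (f := fun t : ℝ => Real.log t - x / t - κ) hw0 x
    (fun t ht => (hd t ht).differentiableAt) hinteg'
  have hE1 : IntegrableOn (fun t => E t / t ^ 2) (Set.Ioc 1 x) := hinteg.mono_set Set.Ioc_subset_Ioi_self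
  have hbd2 : ∀ t : ℝ, 1 ≤ t → |E t / t| ≤ C * t ^ (- δ) := by
    intro t ht
    have ht0 : 0 < t := by linarith
    rw [abs_div, abs_of_pos ht0, div_le_iff₀ (by positivity)]
    have : t ^ (- δ) * t = t ^ (1 - δ) := by
      rw [← Real.rpow_add_one ht0.ne']; ring_nf
    rw [mul_assoc, this]; exact h t ht
  have hcI : IntegrableOn (fun t : ℝ => C * t ^ (-δ)) (Set.Ioc 1 x) := by
    refine (ContinuousOn.integrableOn_Icc ?_).mono_set Set.Ioc_subset_Icc_self
    refine ContinuousOn.mul continuousOn_const (ContinuousOn.rpow_const continuousOn_id ?_)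
    intro t ht; left; linarith [ht.1]
  have hE2 : IntegrableOn (fun t => E t / t) (Set.Ioc 1 x) := by
    refine Integrable.mono' (g := fun t => C * t ^ (- δ)) hcI ?_ ?_
    · exact (hEm.div measurable_id).aestronglyMeasurable
    · refine (ae_restrict_iff' measurableSet_Ioc).2 (Filter.Eventually.of_forall fun t ht => ?_)
      rw [Real.norm_eq_abs]; exact hbd2 t (le_of_lt ht.1)
  have hsplit : ∫ t in Set.Ioc 1 x, deriv (fun t : ℝ => Real.log t - x / t - κ) t * ∑ k ∈ Icc 0 ⌊t⌋₊, w k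
      = (∫ t in Set.Ioc 1 x, E t / t) + x * (∫ t in Set.Ioc 1 x, E t / t ^ 2)
        + (c * (x - 1) + c * x * Real.log x) := by
    have e1 : ∫ t in Set.Ioc 1 x, deriv (fun t : ℝ => Real.log t - x / t - κ) t * ∑ k ∈ Icc 0 ⌊t⌋₊, w k
      = ∫ t in Set.Ioc 1 x, ((E t / t + x * (E t / t ^ 2)) + (c + c * x * t⁻¹)) := by
      refine setIntegral_congr_fun measurableSet_Ioc fun t ht => ?_
      have ht0 : t ≠ 0 := by linarith [ht.1]
      rw [(hd t (Set.Ioc_subset_Icc_self ht)).deriv]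
      have : ∑ k ∈ Icc 0 ⌊t⌋₊, w k = E t + c * t := by simp [hE, Sm]
      rw [this]; field_simp
    have i3 : IntegrableOn (fun t : ℝ => c * x * t⁻¹) (Set.Ioc 1 x) := by
      refine (ContinuousOn.integrableOn_Icc ?_).mono_set Set.Ioc_subset_Icc_self
      exact continuousOn_const.mul (continuousOn_id.inv₀ fun t ht => (by linarith [ht.1] : t ≠ 0))
    have i4 : IntegrableOn (fun t : ℝ => c) (Set.Ioc 1 x) := by
      simp
    have i5 : IntegrableOn (fun t : ℝ => E t / t + x * (E t / t ^ 2)) (Set.Ioc 1 x) := hE2.add (hE1.const_mul x)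
    have i6 : IntegrableOn (fun t : ℝ => c + c * x * t⁻¹) (Set.Ioc 1 x) := i4.add i3
    rw [e1, integral_add i5 i6, integral_add hE2 (hE1.const_mul x),
      integral_add i4 i3, integral_const_mul, integral_const_mul]
    congr 2
    · simp [hx]; ring
    · rw [← intervalIntegral.integral_of_le hx, integral_inv_of_pos zero_lt_one hx0]; simp
  have htail : ∫ t in Set.Ioc 1 x, E t / t ^ 2 = I - ∫ t in Set.Ioi x, E t / t ^ 2 := by
    have : I = (∫ t in Set.Ioc 1 x, E t / t ^ 2) + ∫ t in Set.Ioi x, E t / t ^ 2 := by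
      rw [hI, ← Set.Ioc_union_Ioi_eq_Ioi hx]
      exact setIntegral_union (Set.Ioc_disjoint_Ioi le_rfl) measurableSet_Ioi hE1
        (hinteg.mono_set (Set.Ioi_subset_Ioi hx))
    linarith
  have b1 : |∫ t in Set.Ioc 1 x, E t / t| ≤ C / (1 - δ) * x ^ (1 - δ) := by
    have : |∫ t in Set.Ioc 1 x, E t / t| ≤ ∫ t in Set.Ioc 1 x, C * t ^ (-δ) := by
      rw [← Real.norm_eq_abs]
      refine norm_integral_le_of_norm_le hcI ?_
      refine (ae_restrict_iff' measurableSet_Ioc).2 (Filter.Eventually.of_forall fun t ht => ?_)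
      rw [Real.norm_eq_abs]; exact hbd2 t (le_of_lt ht.1)
    refine this.trans ?_
    rw [← intervalIntegral.integral_of_le hx, intervalIntegral.integral_const_mul,
      integral_rpow (Or.inl (by linarith))]
    have h1 : (1:ℝ) ^ (-δ + 1) = 1 := Real.one_rpow _
    have e : -δ + 1 = 1 - δ := by ring
    rw [h1, e, div_mul_eq_mul_div, mul_div_assoc]
    have : 0 < 1 - δ := by linarith
    gcongr
    linarith
  have b2 : |∫ t in Set.Ioi x, E t / t ^ 2| ≤ C / δ * x ^ (-δ) := by
    have hg : IntegrableOn (fun t : ℝ => C * t ^ (-1 - δ)) (Set.Ioi x) :=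
      ((integrableOn_Ioi_rpow_of_lt (by linarith) hx0).const_mul C)
    have : |∫ t in Set.Ioi x, E t / t ^ 2| ≤ ∫ t in Set.Ioi x, C * t ^ (-1 - δ) := by
      rw [← Real.norm_eq_abs]
      refine norm_integral_le_of_norm_le hg ?_
      refine (ae_restrict_iff' measurableSet_Ioi).2 (Filter.Eventually.of_forall fun t ht => ?_)
      rw [Real.norm_eq_abs]; exact hbd t (hx.trans (le_of_lt ht))
    refine this.trans ?_
    rw [integral_const_mul, integral_Ioi_rpow_of_lt (by linarith) hx0]
    have e : -1 - δ + 1 = -δ := by ring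
    rw [e, neg_div_neg_eq]
    exact le_of_eq (by ring)
  have b3 := h x hx
  have eSm : ∑ k ∈ Icc 0 ⌊x⌋₊, w k = E x + c * x := by simp [hE, Sm]
  have e0 : ∑ n ∈ Icc 0 ⌊x⌋₊, w n * (Real.log n - x / n - κ) =
      c + (Real.log x - 1 - κ) * E x - (∫ t in Set.Ioc 1 x, E t / t)
        + x * ∫ t in Set.Ioi x, E t / t ^ 2 := by
    have : ∑ n ∈ Icc 0 ⌊x⌋₊, w n * (Real.log n - x / n - κ) =
       ∑ n ∈ Icc 0 ⌊x⌋₊, (Real.log n - x / n - κ) * w n := sum_congr rfl fun _ _ => mul_comm _ _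
    rw [this, key, hsplit, htail, eSm, div_self hx0.ne']
    have : κ * c = -2 * c - I := by rw [hκ]; field_simp
    linear_combination (-x) * this
  have hlog : 0 ≤ Real.log x := Real.log_nonneg hx
  have hxp : 1 ≤ x ^ (1 - δ) := Real.one_le_rpow hx (by linarith)
  have hxx : x * x ^ (-δ) = x ^ (1 - δ) := by
    rw [sub_eq_add_neg, Real.rpow_add hx0, Real.rpow_one]
  have t2 : |(Real.log x - 1 - κ) * E x| ≤ (2 + |κ|) * (1 + Real.log x) * (C * x ^ (1 - δ)) := by
    rw [abs_mul]
    have : |Real.log x - 1 - κ| ≤ (2 + |κ|) * (1 + Real.log x) := by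
      have := neg_abs_le κ; have h2 := le_abs_self κ
      have := mul_nonneg (abs_nonneg κ) hlog
      rw [abs_le]; constructor <;> nlinarith
    gcongr
  have t4 : |x * ∫ t in Set.Ioi x, E t / t ^ 2| ≤ C / δ * x ^ (1 - δ) := by
    rw [abs_mul, abs_of_pos hx0, ← hxx]
    calc x * |∫ t in Set.Ioi x, E t / t ^ 2| ≤ x * (C / δ * x ^ (-δ)) := by gcongr
      _ = _ := by ring
  rw [e0]
  set Y := x ^ (1 - δ)
  set l := Real.log x
  have hδ' : 0 < 1 - δ := by linarith
  have q1 : 0 ≤ C / (1 - δ) * Y := by positivity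
  have q2 : 0 ≤ C / δ * Y := by positivity
  have q3 := mul_nonneg q1 hlog
  have q4 := mul_nonneg q2 hlog
  have q5 : 0 ≤ c * l * Y := by positivity
  calc _ ≤ c + |(l - 1 - κ) * E x| + |∫ t in Set.Ioc 1 x, E t / t|
        + |x * ∫ t in Set.Ioi x, E t / t ^ 2| := by
        refine (abs_add_le _ _).trans ?_
        gcongr
        refine (abs_sub _ _).trans ?_
        gcongr
        refine (abs_add_le _ _).trans ?_
        gcongr
        exact (abs_of_pos hc).le
    _ ≤ c * Y + (2 + |κ|) * (1 + l) * (C * Y) + C / (1 - δ) * Y + C / δ * Y := by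
        gcongr
        exact le_mul_of_one_le_right hc.le hxp
    _ ≤ _ := by nlinarith

end PD
end

section
open MeasureTheory Finset

namespace PD
open ArithmeticFunction

lemma hyp_sum (N : ℕ) (h : ℕ → ℕ → ℝ) :
    ∑ d ∈ Ioc 0 N, ∑ m ∈ Ioc 0 (N / d), h d m =
      ∑ n ∈ Ioc 0 N, ∑ p ∈ n.divisorsAntidiagonal, h p.1 p.2 := by
  rw [sum_sigma', sum_sigma']
  refine sum_bij' (fun x _ => ⟨x.1 * x.2, (x.1, x.2)⟩) (fun y _ => ⟨y.2.1, y.2.2⟩) ?_ ?_ ?_ ?_ ?_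
  · rintro ⟨d, m⟩ hx
    simp only [mem_sigma, mem_Ioc, Nat.mem_divisorsAntidiagonal] at hx ⊢
    obtain ⟨⟨h1, h2⟩, h3, h4⟩ := hx
    have := (Nat.le_div_iff_mul_le h1).1 h4
    have : 0 < d * m := Nat.mul_pos h1 h3
    refine ⟨⟨this, by rw [mul_comm]; assumption⟩, trivial, this.ne'⟩
  · rintro ⟨n, d, m⟩ hx
    simp only [mem_sigma, mem_Ioc, Nat.mem_divisorsAntidiagonal] at hx ⊢
    obtain ⟨⟨h1, h2⟩, h3, h4⟩ := hx
    subst h3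
    have hd : 0 < d := Nat.pos_of_ne_zero (by rintro rfl; simp at h4)
    have hm : 0 < m := Nat.pos_of_ne_zero (by rintro rfl; simp at h4)
    refine ⟨⟨hd, le_trans (Nat.le_mul_of_pos_right _ hm) h2⟩, hm, ?_⟩
    rw [Nat.le_div_iff_mul_le hd, mul_comm]; exact h2
  · rintro ⟨d, m⟩ hx; rfl
  · rintro ⟨n, d, m⟩ hx
    simp only [mem_sigma, Nat.mem_divisorsAntidiagonal] at hx
    obtain ⟨_, h3, h4⟩ := hx
    subst h3; rfl
  · rintro ⟨d, m⟩ hx; rfl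

lemma Sm_eq (w : ArithmeticFunction ℝ) (y : ℝ) : Sm w y = ∑ n ∈ Ioc 0 ⌊y⌋₊, w n := by
  unfold Sm
  rw [← Finset.Ioc_insert_left (Nat.zero_le _), sum_insert (by simp)]; simp

lemma deriv_conv (f g : ArithmeticFunction ℝ) :
    (f * g).pmul log = (f.pmul log) * g + f * (g.pmul log) := by
  ext n
  simp only [pmul_apply, mul_apply, ArithmeticFunction.add_apply]
  rw [sum_mul, ← sum_add_distrib]
  refine sum_congr rfl fun p hp => ?_
  rw [Nat.mem_divisorsAntidiagonal] at hp
  have h1 : p.1 ≠ 0 := by rintro h; rw [h] at hp; simp at hp; omega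
  have h2 : p.2 ≠ 0 := by rintro h; rw [h] at hp; simp at hp; omega
  rw [← hp.1]
  simp only [log_apply]
  rw [Nat.cast_mul, Real.log_mul (by exact_mod_cast h1) (by exact_mod_cast h2)]
  ring

variable {a L : ArithmeticFunction ℝ}

lemma L_one (ha1 : a 1 = 1) (hL : a * L = a.pmul log) : L 1 = 0 := by
  have := congrArg (fun f => f 1) hL
  simpa [ha1] using this

lemma inv_eq {b : ArithmeticFunction ℝ} (ha : a * b = 1) (hL : a * L = a.pmul log) : b * (a.pmul log) = L := by
  rw [← hL, ← mul_assoc, mul_comm b a, ha, one_mul]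

lemma inv_bound (ha1 : a 1 = 1) (ha0 : ∀ n, 0 ≤ a n) (hL0 : ∀ n, 0 ≤ L n)
    (hL : a * L = a.pmul log) {b : ArithmeticFunction ℝ} (hb : a * b = 1) :
    ∀ n, |b n| ≤ a n := by
  have h0 := deriv_conv a b
  rw [hb] at h0
  have h1 : (1 : ArithmeticFunction ℝ).pmul log = 0 := by
    ext n
    simp only [pmul_apply, one_apply, log_apply]
    split_ifs with h <;> simp [h]
  rw [h1, ← hL] at h0
  have h2 : b.pmul log = - (L * b) := by
    have : b * (0 : ArithmeticFunction ℝ) = b * (a * L * b + a * b.pmul log) := by rw [h0]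
    rw [mul_zero, mul_add, ← mul_assoc, ← mul_assoc, ← mul_assoc, mul_comm b a, hb, one_mul, one_mul] at this
    exact eq_neg_of_add_eq_zero_right this.symm
  rw [mul_comm L b] at h2
  have hb1 : b 1 = 1 := by
    have := congrArg (fun f => f 1) hb
    simpa [ha1] using this
  intro n
  induction n using Nat.strong_induction_on with
  | _ n ih =>
    rcases Nat.lt_or_ge n 2 with hn | hn
    · interval_cases n
      · simp
      · simp [hb1, ha1]
    have hlog : 0 < Real.log n := Real.log_pos (by exact_mod_cast hn)
    have e1 := congrArg (fun f => f n) h2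
    have e2 := congrArg (fun f => f n) hL
    simp only [pmul_apply, log_apply, ArithmeticFunction.neg_apply, mul_apply] at e1 e2
    rw [← mul_le_mul_iff_left₀ hlog, ← e2]
    have : |b n| * Real.log n = |b n * Real.log n| := by rw [abs_mul, abs_of_pos hlog]
    rw [this, e1, abs_neg]
    refine (abs_sum_le_sum_abs _ _).trans ?_
    refine sum_le_sum fun p hp => ?_
    rw [Nat.mem_divisorsAntidiagonal] at hp
    rw [abs_mul, abs_of_nonneg (hL0 _)]
    by_cases h : p.2 = 1
    · rw [h, L_one ha1 hL]; simp
    · have h2 : p.2 ≠ 0 := by rintro h; rw [h] at hp; simp at hp; omega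
      have h1 : p.1 ≠ 0 := by rintro h; rw [h] at hp; simp at hp; omega
      refine mul_le_mul_of_nonneg_right (ih _ ?_) (hL0 _)
      rw [← hp.1]
      exact lt_mul_of_one_lt_right (by omega) (by omega)

lemma selberg_id (ha1 : a 1 = 1) (hL : a * L = a.pmul log) {b : ArithmeticFunction ℝ} (hb : a * b = 1)
    (F : ℝ → ℝ) (N : ℕ) (hN : 0 < N) :
    ∑ d ∈ Ioc 0 N, b d * Real.log ((N : ℝ) / d) * ∑ m ∈ Ioc 0 (N / d), a m * F ((N : ℝ) / d / m)
    = F N * Real.log N + ∑ n ∈ Ioc 0 N, L n * F ((N : ℝ) / n) := by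
  have hN' : (N : ℝ) ≠ 0 := by exact_mod_cast hN.ne'
  have h1 := inv_eq hb hL
  simp only [mul_sum]
  rw [hyp_sum N (fun d m => b d * Real.log ((N : ℝ) / d) * (a m * F ((N : ℝ) / d / m)))]
  have : ∀ n ∈ Ioc 0 N, ∑ p ∈ n.divisorsAntidiagonal, b p.1 * Real.log ((N : ℝ) / p.1) * (a p.2 * F ((N : ℝ) / p.1 / p.2)) = (F ((N : ℝ) / n) * Real.log ((N : ℝ) / n)) * (1 : ArithmeticFunction ℝ) n + L n * F ((N : ℝ) / n) := by
    intro n hn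
    rw [← h1, ← hb, mul_comm a b]
    simp only [mul_apply, pmul_apply, log_apply]
    rw [mul_sum, sum_mul, ← sum_add_distrib]
    refine sum_congr rfl fun p hp => ?_
    rw [Nat.mem_divisorsAntidiagonal] at hp
    have h1 : (p.1 : ℝ) ≠ 0 := by rintro h; rw [Nat.cast_eq_zero.1 h] at hp; simp at hp; omega
    have h2 : (p.2 : ℝ) ≠ 0 := by rintro h; rw [Nat.cast_eq_zero.1 h] at hp; simp at hp; omega
    rw [← hp.1, Nat.cast_mul, div_div, Real.log_div hN' h1, Real.log_div hN' (mul_ne_zero h1 h2), Real.log_mul h1 h2]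
    ring
  rw [sum_congr rfl this, sum_add_distrib]
  congr 1
  rw [sum_eq_single 1]
  · simp
  · intro n _ hn; simp [one_apply_ne hn]
  · intro h; simp at h; omega

theorem selberg_upper (ha1 : a 1 = 1) (ha0 : ∀ n, 0 ≤ a n) (hL0 : ∀ n, 0 ≤ L n)
    (hL : a * L = a.pmul log) {c C δ C' : ℝ} (hc : 0 < c) (hC : 0 ≤ C)
    (hδ : 0 < δ) (hδ1 : δ < 1) (h : ∀ y : ℝ, 1 ≤ y → |Sm a y - c * y| ≤ C * y ^ (1 - δ))
    (hC' : 0 ≤ C') (hψ : ∀ y : ℝ, 1 ≤ y → Sm L y ≤ C' * y) :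
    ∃ K : ℝ, ∀ N : ℕ, 1 ≤ N → Sm L N * Real.log N ≤ 2 * N * Real.log N + K * N := by
  obtain ⟨b, hb⟩ : ∃ b : ArithmeticFunction ℝ, a * b = 1 := by
    have : IsUnit a := isUnit_iff_isUnit_apply_one.2 (by rw [ha1]; exact isUnit_one)
    exact this.exists_right_inv
  have hbb := inv_bound ha1 ha0 hL0 hL hb
  obtain ⟨κ, K, hK, hG⟩ := abel_G (w := a) (by simp) hc hC hδ hδ1 h
  -- crude bound for a
  have hA : ∀ y : ℝ, 1 ≤ y → Sm a y ≤ (c + C) * y := by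
    intro y hy
    have h1 := (abs_le.1 (h y hy)).2
    have h2 : y ^ (1 - δ) ≤ y ^ (1 : ℝ) := Real.rpow_le_rpow_of_exponent_le hy (by linarith)
    rw [Real.rpow_one] at h2
    nlinarith
  have hGlog : ∀ y : ℝ, 1 ≤ y → K * (1 + Real.log y) * y ^ (1 - δ) * Real.log y ≤
      K * (1 + 4 / δ) * (4 / δ) * y ^ (1 - δ / 2) := by
    intro y hy
    have hy0 : 0 < y := by linarith
    have hl0 := Real.log_nonneg hy
    have hl := Real.log_le_rpow_div (x := y) (ε := δ / 4) hy0.le (by linarith)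
    have h1 : 1 ≤ y ^ (δ / 4) := Real.one_le_rpow hy (by linarith)
    have h2 : y ^ (1 - δ / 2) = y ^ (δ / 4) * y ^ (1 - δ) * y ^ (δ / 4) := by
      rw [← Real.rpow_add hy0, ← Real.rpow_add hy0]; ring_nf
    rw [h2]
    have hl' : Real.log y ≤ 4 / δ * y ^ (δ / 4) := by
      refine hl.trans (le_of_eq ?_); field_simp
    calc K * (1 + Real.log y) * y ^ (1 - δ) * Real.log y
        ≤ K * (y ^ (δ / 4) + 4 / δ * y ^ (δ / 4)) * y ^ (1 - δ) * (4 / δ * y ^ (δ / 4)) := by gcongr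
      _ = _ := by ring
  set K1 := K * (1 + 4 / δ) * (4 / δ) with hK1
  have hK1' : 0 ≤ K1 := by positivity
  set K2 := K1 * ((c + C) * (1 + 1 / (1 - (1 - δ / 2)))) with hK2
  set K3 := C * (C' * (1 + 1 / (1 - (1 - δ)))) with hK3
  refine ⟨K2 + |κ| + |κ| * C' + (C / δ + K3) / c, fun N hN => ?_⟩
  have hN1 : (1 : ℝ) ≤ N := by exact_mod_cast hN
  have hN0 : (0 : ℝ) < N := by linarith
  have hlN : 0 ≤ Real.log N := Real.log_nonneg hN1
  set F : ℝ → ℝ := fun y => Sm L y - y - κ with hF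
  have hid := selberg_id ha1 hL hb F N hN
  have hfl : ∀ d : ℕ, ⌊(N : ℝ) / d⌋₊ = N / d := fun d => by
    rw [Nat.floor_div_natCast, Nat.floor_natCast]
  -- sum a(m) Sm L (n/m)
  have hconv : ∀ n : ℕ, ∑ m ∈ Ioc 0 n, a m * Sm L ((n : ℝ) / m) = ∑ m ∈ Ioc 0 n, a m * Real.log m := by
    intro n
    have := sum_Ioc_mul_eq_sum_sum a L n
    rw [hL] at this
    simp only [pmul_apply, log_apply] at this
    rw [this]
    refine sum_congr rfl fun m _ => ?_
    rw [Sm_eq, Nat.floor_div_natCast, Nat.floor_natCast]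
  have hconv' : ∀ d ∈ Ioc 0 N, ∑ m ∈ Ioc 0 (N / d), a m * F ((N : ℝ) / d / m) =
      ∑ m ∈ Icc 0 ⌊(N : ℝ) / d⌋₊, a m * (Real.log m - ((N : ℝ) / d) / m - κ) := by
    intro d hd
    rw [← Finset.Ioc_insert_left (Nat.zero_le _), sum_insert (by simp), hfl]
    have e : ∑ m ∈ Ioc 0 (N / d), a m * Sm L ((N : ℝ) / d / m) = ∑ m ∈ Ioc 0 (N / d), a m * Real.log m := by
      rw [← hconv]
      refine sum_congr rfl fun m _ => ?_
      congr 1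
      rw [Sm_eq, Sm_eq, Nat.floor_div_natCast, hfl, Nat.floor_div_natCast, Nat.floor_natCast]
    simp [hF, mul_sub, sum_sub_distrib, e]
  have hLHS : ∑ d ∈ Ioc 0 N, b d * Real.log ((N : ℝ) / d) * ∑ m ∈ Ioc 0 (N / d), a m * F ((N : ℝ) / d / m)
      ≤ K2 * N := by
    have h1 : ∀ d ∈ Ioc 0 N, b d * Real.log ((N : ℝ) / d) * ∑ m ∈ Ioc 0 (N / d), a m * F ((N : ℝ) / d / m)
        ≤ K1 * (a d * ((N : ℝ) / d) ^ (1 - δ / 2)) := by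
      intro d hd
      rw [hconv' d hd]
      rw [mem_Ioc] at hd
      have hd0 : (0 : ℝ) < d := by exact_mod_cast hd.1
      have hy : 1 ≤ (N : ℝ) / d := by rw [le_div_iff₀ hd0, one_mul]; exact_mod_cast hd.2
      have h2 := hG _ hy
      have h3 := hGlog _ hy
      have hl0 := Real.log_nonneg hy
      refine (le_abs_self _).trans ?_
      rw [abs_mul, abs_mul, abs_of_nonneg hl0]
      calc _ ≤ a d * Real.log ((N : ℝ) / d) * (K * (1 + Real.log ((N : ℝ) / d)) * ((N : ℝ) / d) ^ (1 - δ)) := by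
            gcongr
            · exact mul_nonneg (ha0 _) hl0
            · exact hbb d
        _ = a d * (K * (1 + Real.log ((N : ℝ) / d)) * ((N : ℝ) / d) ^ (1 - δ) * Real.log ((N : ℝ) / d)) := by ring
        _ ≤ a d * (K1 * ((N : ℝ) / d) ^ (1 - δ / 2)) := mul_le_mul_of_nonneg_left h3 (ha0 _)
        _ = _ := by ring
    refine (sum_le_sum h1).trans ?_
    rw [← mul_sum, hK2, mul_assoc K1]
    refine mul_le_mul_of_nonneg_left ?_ hK1'
    have := abel_pow (w := a) (by simp) ha0 (C := c + C) (by linarith) (θ := 1 - δ / 2) (by linarith) (by linarith) hA hN1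
    rw [Nat.floor_natCast, ← Finset.Ioc_insert_left (Nat.zero_le _), sum_insert (by simp)] at this
    simpa using this
  -- Mertens upper bound
  have hM : (N : ℝ) * ∑ n ∈ Ioc 0 N, L n / n ≤ N * Real.log N + (C / δ + K3) / c * N := by
    have e1 := sum_Ioc_mul_eq_sum_sum L a N
    rw [mul_comm, hL] at e1
    simp only [pmul_apply, log_apply] at e1
    have up : ∑ n ∈ Ioc 0 N, a n * Real.log n ≤ c * N * Real.log N + C / δ * N := by
      have s1 : ∑ n ∈ Ioc 0 N, a n * Real.log n ≤ Sm a N * Real.log N := by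
        rw [Sm_eq, Nat.floor_natCast, sum_mul]
        refine sum_le_sum fun n hn => mul_le_mul_of_nonneg_left ?_ (ha0 _)
        rw [mem_Ioc] at hn
        exact Real.log_le_log (by exact_mod_cast hn.1) (by exact_mod_cast hn.2)
      have s2 := (abs_le.1 (h N hN1)).2
      have s3 := Real.log_le_rpow_div (x := N) (ε := δ) hN0.le hδ
      have s4 : (N : ℝ) ^ (1 - δ) * (N : ℝ) ^ δ = N := by rw [← Real.rpow_add hN0]; simp
      calc _ ≤ Sm a N * Real.log N := s1
        _ ≤ (c * N + C * (N : ℝ) ^ (1 - δ)) * Real.log N := by gcongr; linarith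
        _ = c * N * Real.log N + C * (N : ℝ) ^ (1 - δ) * Real.log N := by ring
        _ ≤ c * N * Real.log N + C * (N : ℝ) ^ (1 - δ) * ((N : ℝ) ^ δ / δ) := by gcongr
        _ = c * N * Real.log N + C / δ * ((N : ℝ) ^ (1 - δ) * (N : ℝ) ^ δ) := by ring
        _ = _ := by rw [s4]
    have lo : c * (N * ∑ n ∈ Ioc 0 N, L n / n) - K3 * N ≤ ∑ n ∈ Ioc 0 N, L n * ∑ m ∈ Ioc 0 (N / n), a m := by
      have s1 : ∀ n ∈ Ioc 0 N, c * (N * (L n / n)) - C * (L n * ((N : ℝ) / n) ^ (1 - δ)) ≤ L n * ∑ m ∈ Ioc 0 (N / n), a m := by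
        intro n hn
        rw [mem_Ioc] at hn
        have hd0 : (0 : ℝ) < n := by exact_mod_cast hn.1
        have hy : 1 ≤ (N : ℝ) / n := by rw [le_div_iff₀ hd0, one_mul]; exact_mod_cast hn.2
        have s2 := (abs_le.1 (h _ hy)).1
        rw [Sm_eq, hfl] at s2
        have : c * (N * (L n / n)) - C * (L n * ((N : ℝ) / n) ^ (1 - δ)) = L n * (c * ((N : ℝ) / n) - C * ((N : ℝ) / n) ^ (1 - δ)) := by ring
        rw [this]
        exact mul_le_mul_of_nonneg_left (by linarith) (hL0 _)
      refine le_trans ?_ (sum_le_sum s1)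
      rw [sum_sub_distrib, ← mul_sum, ← mul_sum, ← mul_sum]
      refine sub_le_sub_left ?_ _
      rw [hK3, mul_assoc]
      refine mul_le_mul_of_nonneg_left ?_ hC
      have := abel_pow (w := L) (by simp) hL0 (C := C') hC' (θ := 1 - δ) (by linarith) (by linarith) hψ hN1
      rw [Nat.floor_natCast, ← Finset.Ioc_insert_left (Nat.zero_le _), sum_insert (by simp)] at this
      simpa using this
    rw [e1] at up
    have : c * ((N : ℝ) * ∑ n ∈ Ioc 0 N, L n / n) ≤ c * (N * Real.log N + (C / δ + K3) / c * N) := by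
      have : c * (N * Real.log N + (C / δ + K3) / c * N) = c * N * Real.log N + C / δ * N + K3 * N := by
        field_simp
        ring
      linarith
    exact le_of_mul_le_mul_left this hc
  -- final
  rw [hid] at hLHS
  have hlow : -(∑ n ∈ Ioc 0 N, L n * F ((N : ℝ) / n)) ≤ N * ∑ n ∈ Ioc 0 N, L n / n + |κ| * (C' * N) := by
    have s1 : -(∑ n ∈ Ioc 0 N, L n * F ((N : ℝ) / n)) ≤ ∑ n ∈ Ioc 0 N, (N * (L n / n) + |κ| * L n) := by
      rw [← sum_neg_distrib]
      refine sum_le_sum fun n _ => ?_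
      have : 0 ≤ Sm L ((N : ℝ) / n) := sum_nonneg fun _ _ => hL0 _
      have h2 := le_abs_self κ
      have : -F ((N : ℝ) / n) ≤ N / n + |κ| := by simp only [hF]; linarith
      calc -(L n * F ((N : ℝ) / n)) = L n * (-F ((N : ℝ) / n)) := by ring
        _ ≤ L n * (N / n + |κ|) := mul_le_mul_of_nonneg_left this (hL0 _)
        _ = _ := by ring
    refine s1.trans ?_
    rw [sum_add_distrib, ← mul_sum, ← mul_sum]
    have := hψ N hN1
    rw [Sm_eq, Nat.floor_natCast] at this
    gcongr
  have hlogN : Real.log N ≤ N := (Real.log_le_sub_one_of_pos hN0).trans (by linarith)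
  have hk : κ * Real.log N ≤ |κ| * N := by
    calc κ * Real.log N ≤ |κ| * Real.log N := by gcongr; exact le_abs_self κ
      _ ≤ _ := by gcongr
  have : F N * Real.log N = Sm L N * Real.log N - N * Real.log N - κ * Real.log N := by
    simp only [hF]; ring
  nlinarith

end PD
end

section
open MeasureTheory

namespace PD
open scoped Pointwise

/-- `ε`-boundary of a set -/
def bdry {V : Type*} [NormedAddCommGroup V] (A : Set V) (ε : ℝ) : Set V :=
  {y | ∃ z, ‖z - y‖ ≤ ε ∧ ((y ∈ A ∧ z ∉ A) ∨ (y ∉ A ∧ z ∈ A))}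

lemma lattice_count {V : Type*} [NormedAddCommGroup V] [NormedSpace ℝ V] [FiniteDimensional ℝ V]
    [MeasurableSpace V] [BorelSpace V] (μ : Measure V) [μ.IsAddHaarMeasure]
    {ι : Type*} [Finite ι] (b : Module.Basis ι ℝ V) (A : Set V) (hAb : Bornology.IsBounded A)
    (hAm : MeasurableSet A) {C₀ δ : ℝ}
    (hB : ∀ ε : ℝ, 0 < ε → ε ≤ 1 → μ (bdry A ε) ≤ ENNReal.ofReal (C₀ * ε ^ δ)) (hC₀ : 0 ≤ C₀) :
    ∃ C ρ : ℝ, 0 ≤ C ∧ 0 < ρ ∧ ∀ t : ℝ, ρ ≤ t →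
      |(Nat.card ↑((t • A) ∩ (Submodule.span ℤ (Set.range b) : Set V)) : ℝ) * μ.real (ZSpan.fundamentalDomain b)
        - t ^ (Module.finrank ℝ V) * μ.real A| ≤ C * t ^ ((Module.finrank ℝ V : ℝ) - δ) := by
  have := Fintype.ofFinite ι
  set Q := ZSpan.fundamentalDomain b with hQ
  set ρ : ℝ := 1 + ∑ i, ‖b i‖ with hρ
  have hρ1 : 1 ≤ ρ := by
    have : 0 ≤ ∑ i, ‖b i‖ := Finset.sum_nonneg fun _ _ => norm_nonneg _
    linarith
  have hρ0 : 0 < ρ := by linarith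
  refine ⟨C₀ * ρ ^ δ, ρ, by positivity, hρ0, fun t ht => ?_⟩
  have ht0 : 0 < t := by linarith
  set Λ := Submodule.span ℤ (Set.range b) with hΛ
  have htAb : Bornology.IsBounded (t • A) := hAb.smul₀ t
  have htAm : MeasurableSet (t • A) := hAm.const_smul₀ t
  have hfin : ((t • A) ∩ (Λ : Set V)).Finite := ZSpan.setFinite_inter b htAb
  set U : Set V := {y | (ZSpan.floor b y : V) ∈ t • A} with hU
  have hUeq : U = ⋃ v ∈ hfin.toFinset, (fun x => v + x) '' Q := by
    ext y
    simp only [hU, Set.mem_setOf_eq, Set.mem_iUnion, Set.Finite.mem_toFinset, Set.mem_inter_iff,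
      SetLike.mem_coe, Set.mem_image, exists_prop]
    constructor
    · intro h
      exact ⟨_, ⟨h, (ZSpan.floor b y).2⟩, ZSpan.fract b y, ZSpan.fract_mem_fundamentalDomain b y,
        by rw [ZSpan.fract_apply]; abel⟩
    · rintro ⟨v, ⟨h1, h2⟩, x, hx, rfl⟩
      have h3 := ZSpan.fract_zSpan_add b x h2
      rw [ZSpan.fract_eq_self.2 hx, ZSpan.fract_apply] at h3
      have : (ZSpan.floor b (v + x) : V) = v := by
        have : (v + x) - (v + x - ZSpan.floor b (v + x)) = v + x - x := by rw [h3]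
        simpa using this
      rw [this]; exact h1
  have hQm : MeasurableSet Q := ZSpan.fundamentalDomain_measurableSet b
  have himm : ∀ v : V, MeasurableSet ((fun x => v + x) '' Q) := fun v =>
    (MeasurableEquiv.measurableSet_image (MeasurableEquiv.addLeft v)).2 hQm
  have hUm : MeasurableSet U := by
    rw [hUeq]; exact Finset.measurableSet_biUnion _ fun v _ => himm v
  have hUμ : μ U = hfin.toFinset.card * μ Q := by
    rw [hUeq, measure_biUnion_finset]
    · have : ∀ v : V, μ ((fun x => v + x) '' Q) = μ Q := fun v => by
        simp
      simp [this]
    · intro v hv w hw hvw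
      simp only [Set.Finite.coe_toFinset, Set.mem_inter_iff, SetLike.mem_coe] at hv hw
      rw [Function.onFun, Set.disjoint_left]
      rintro _ ⟨x, hx, rfl⟩ ⟨x', hx', h⟩
      simp only at h
      have h1 := ZSpan.fract_zSpan_add b x hv.2
      have h2 := ZSpan.fract_zSpan_add b x' hw.2
      rw [ZSpan.fract_eq_self.2 hx] at h1
      rw [ZSpan.fract_eq_self.2 hx', h, h1] at h2
      rw [h2] at h
      exact hvw (add_right_cancel h).symm
    · exact fun v _ => himm v
  have hQfin : μ Q ≠ ⊤ := (ZSpan.fundamentalDomain_isBounded b).measure_lt_top.ne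
  have hUfin : μ U ≠ ⊤ := by rw [hUμ]; exact ENNReal.mul_ne_top (by simp) hQfin
  have htAfin : μ (t • A) ≠ ⊤ := htAb.measure_lt_top.ne
  have hsub : symmDiff U (t • A) ⊆ t • bdry A (ρ / t) := by
    intro y hy
    rw [Set.mem_smul_set_iff_inv_smul_mem₀ ht0.ne']
    refine ⟨t⁻¹ • (ZSpan.floor b y : V), ?_, ?_⟩
    · rw [← smul_sub, norm_smul, norm_inv, Real.norm_eq_abs, abs_of_pos ht0, inv_mul_eq_div]
      gcongr
      rw [← norm_neg, neg_sub, ← ZSpan.fract_apply]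
      exact (ZSpan.norm_fract_le b y).trans (by linarith)
    · rw [← Set.mem_smul_set_iff_inv_smul_mem₀ ht0.ne', ← Set.mem_smul_set_iff_inv_smul_mem₀ ht0.ne']
      rcases hy with ⟨h1, h2⟩ | ⟨h1, h2⟩
      · exact Or.inr ⟨h2, h1⟩
      · exact Or.inl ⟨h1, h2⟩
  have hcard : Nat.card ↑((t • A) ∩ (Λ : Set V)) = hfin.toFinset.card := by
    rw [Nat.card_coe_set_eq, Set.ncard_eq_toFinset_card _ hfin]
  have h1 : |μ.real U - μ.real (t • A)| ≤ μ.real (symmDiff U (t • A)) :=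
    abs_measureReal_sub_le_measureReal_symmDiff' hUm.nullMeasurableSet htAm.nullMeasurableSet hUfin htAfin
  have h2 : μ.real U = (Nat.card ↑((t • A) ∩ (Λ : Set V)) : ℝ) * μ.real Q := by
    rw [measureReal_def, hUμ, ENNReal.toReal_mul, hcard]; simp [measureReal_def]
  have h3 : μ.real (t • A) = t ^ (Module.finrank ℝ V) * μ.real A := by
    rw [measureReal_def, Measure.addHaar_smul, ENNReal.toReal_mul, ENNReal.toReal_ofReal (abs_nonneg _),
      abs_of_pos (by positivity)]; rfl
  rw [h2, h3] at h1
  refine h1.trans ?_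
  have h4 : μ (symmDiff U (t • A)) ≤ ENNReal.ofReal (t ^ (Module.finrank ℝ V) * (C₀ * (ρ / t) ^ δ)) := by
    refine (measure_mono hsub).trans ?_
    rw [Measure.addHaar_smul, abs_of_pos (by positivity), ENNReal.ofReal_mul (by positivity)]
    gcongr
    exact hB _ (by positivity) (by rw [div_le_one ht0]; exact ht)
  refine (ENNReal.toReal_le_of_le_ofReal (by positivity) h4).trans (le_of_eq ?_)
  rw [Real.div_rpow hρ0.le ht0.le, Real.rpow_sub ht0, Real.rpow_natCast]
  ring

end PD
end

section
open MeasureTheory NumberField NumberField.mixedEmbedding NumberField.mixedEmbedding.fundamentalCone NumberField.InfinitePlace NumberField.Units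
open NumberField.Units.dirichletUnitTheorem

namespace PD
variable (K : Type*) [Field K] [NumberField K]

open scoped Classical in
lemma setLIntegral_pi_exp (t : InfinitePlace K → Set ℝ) (n : ℕ) :
    ∫⁻ (x : realSpace K) in Set.univ.pi t, .ofReal (Real.exp (x w₀ * n)) =
      (∫⁻ u in t w₀, .ofReal (Real.exp (u * n))) * ∏ w ∈ Finset.univ.erase w₀, volume (t w) := by
  rw [volume_pi, Measure.restrict_pi_pi, lintegral_eq_lmarginal_univ 0,
    lmarginal_erase' _ (by fun_prop) (Finset.mem_univ w₀)]
  simp_rw [Function.update_self, lmarginal, lintegral_const, Measure.pi_univ,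
    Measure.restrict_apply_univ]
  congr 1
  exact Finset.prod_coe_sort (Finset.univ.erase w₀) (fun w => volume (t w))

open scoped Classical in
lemma volume_slab (t : InfinitePlace K → Set ℝ) (ht : ∀ w, MeasurableSet (t w)) :
    volume (normAtAllPlaces ⁻¹' (expMapBasis '' (Set.univ.pi t)) : Set (mixedSpace K)) =
     2 ^ nrRealPlaces K * .ofReal (2 * Real.pi) ^ nrComplexPlaces K * ((2 : ENNReal)⁻¹ ^ nrComplexPlaces K * ENNReal.ofReal (regulator K) * (Module.finrank ℚ K) * ((∫⁻ u in t w₀, .ofReal (Real.exp (u * (Module.finrank ℚ K)))) * ∏ w ∈ Finset.univ.erase w₀, volume (t w))) := by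
  have hs : MeasurableSet (Set.univ.pi t) := MeasurableSet.univ_pi ht
  have h₂ : MeasurableSet (normAtAllPlaces ⁻¹' (expMapBasis '' (Set.univ.pi t)) : Set (mixedSpace K)) := by
    refine MeasurableSet.preimage ?_ (continuous_normAtAllPlaces K).measurable
    exact MeasurableSet.image_of_continuousOn_injOn hs (continuous_expMapBasis K).continuousOn
      (injective_expMapBasis K).injOn
  rw [volume_eq_two_pow_mul_two_pi_pow_mul_integral Set.preimage_image_preimage h₂,
    normAtAllPlaces_image_preimage_expMapBasis, setLIntegral_expMapBasis_image hs (by fun_prop)]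
  simp_rw [ENNReal.inv_mul_cancel_right
    (Finset.prod_ne_zero_iff.mpr fun _ _ ↦ ENNReal.ofReal_ne_zero_iff.mpr (expMapBasis_pos _ _))
    (ENNReal.prod_ne_top fun _ _ ↦ ENNReal.ofReal_ne_top)]
  rw [setLIntegral_pi_exp]

open scoped Classical in
/-- slab sets -/
noncomputable def slab (w1 : InfinitePlace K) (c η : ℝ) : InfinitePlace K → Set ℝ := fun w =>
  if w = w1 then (if w = w₀ then Set.Icc (c - η) (c + η) ∩ Set.Iic 1 else Set.Icc (c - η) (c + η)) else if w = w₀ then Set.Iic 1 else Set.Icc (-1) 2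

lemma slab_meas (w1 : InfinitePlace K) (c η : ℝ) (w) : MeasurableSet (slab K w1 c η w) := by
  unfold slab
  split_ifs
  · exact measurableSet_Icc.inter measurableSet_Iic
  · exact measurableSet_Icc
  · exact measurableSet_Iic
  · exact measurableSet_Icc

lemma int_bound (d : ℕ) (hd : 0 < d) : ∃ B : ℝ, 0 ≤ B ∧ (∫⁻ u in Set.Iic (1:ℝ), .ofReal (Real.exp (u * d)) ≤ ENNReal.ofReal B) ∧
   ∀ c η : ℝ, 0 ≤ η → ∫⁻ u in Set.Icc (c - η) (c + η) ∩ Set.Iic 1, .ofReal (Real.exp (u * d)) ≤ ENNReal.ofReal (B * η) := by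
  have hd' : (0:ℝ) < d := by exact_mod_cast hd
  have h1 : ∫⁻ u in Set.Iic (1:ℝ), .ofReal (Real.exp (u * d)) = ENNReal.ofReal (∫ u in Set.Iic (1:ℝ), Real.exp (d * u)) := by
    rw [ofReal_integral_eq_lintegral_ofReal (integrableOn_exp_mul_Iic hd' _)]
    · simp_rw [mul_comm]
    · filter_upwards with _ using Real.exp_nonneg _
  refine ⟨max (∫ u in Set.Iic (1:ℝ), Real.exp (d * u)) (2 * Real.exp d), by positivity, ?_, fun c η hη => ?_⟩
  · rw [h1]; exact ENNReal.ofReal_le_ofReal (le_max_left _ _)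
  · calc ∫⁻ u in Set.Icc (c - η) (c + η) ∩ Set.Iic 1, .ofReal (Real.exp (u * d))
        ≤ ∫⁻ u in Set.Icc (c - η) (c + η) ∩ Set.Iic 1, ENNReal.ofReal (Real.exp d) := by
          refine setLIntegral_mono' (measurableSet_Icc.inter measurableSet_Iic) fun u hu => ?_
          apply ENNReal.ofReal_le_ofReal
          apply Real.exp_le_exp.2
          have : u ≤ 1 := hu.2
          nlinarith
      _ ≤ ENNReal.ofReal (Real.exp d) * volume (Set.Icc (c - η) (c + η)) := by
          rw [setLIntegral_const]
          gcongr
          exact Set.inter_subset_left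
      _ ≤ _ := by
          rw [Real.volume_Icc, ← ENNReal.ofReal_mul (Real.exp_nonneg _)]
          apply ENNReal.ofReal_le_ofReal
          have := le_max_right (∫ u in Set.Iic (1:ℝ), Real.exp (d * u)) (2 * Real.exp d)
          nlinarith

open scoped Classical in
lemma volume_slab_le : ∃ B : ℝ, 0 ≤ B ∧ ∀ w1 c η, 0 ≤ η →
    volume (normAtAllPlaces ⁻¹' (expMapBasis '' (Set.univ.pi (slab K w1 c η))) : Set (mixedSpace K)) ≤ ENNReal.ofReal (B * η) := by
  obtain ⟨B, hB0, hB1, hB2⟩ := int_bound (Module.finrank ℚ K) Module.finrank_pos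
  set F : ENNReal := 2 ^ nrRealPlaces K * .ofReal (2 * Real.pi) ^ nrComplexPlaces K * ((2 : ENNReal)⁻¹ ^ nrComplexPlaces K * ENNReal.ofReal (regulator K) * (Module.finrank ℚ K)) with hF
  have hFtop : F ≠ ⊤ := by
    rw [hF]
    have : (2:ENNReal)⁻¹ ≠ ⊤ := by simp
    finiteness
  have key : ∀ w1 c η, 0 ≤ η → (∫⁻ u in slab K w1 c η w₀, .ofReal (Real.exp (u * (Module.finrank ℚ K)))) * ∏ w ∈ Finset.univ.erase w₀, volume (slab K w1 c η w) ≤ ENNReal.ofReal ((B * (3 * 2) ^ (Finset.univ.erase (w₀ : InfinitePlace K)).card) * η) := by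
    intro w1 c η hη
    by_cases hw : w1 = w₀
    · have e1 : ∏ w ∈ Finset.univ.erase w₀, volume (slab K w1 c η w) ≤ ∏ w ∈ Finset.univ.erase (w₀ : InfinitePlace K), ENNReal.ofReal (3 * 2) := by
        refine Finset.prod_le_prod' fun w hw' => ?_
        have hne := Finset.ne_of_mem_erase hw'
        simp only [slab, hw, hne, if_false, Real.volume_Icc]
        apply ENNReal.ofReal_le_ofReal; norm_num
      rw [Finset.prod_const, ← ENNReal.ofReal_pow (by norm_num)] at e1
      have e2 : (∫⁻ u in slab K w1 c η w₀, .ofReal (Real.exp (u * (Module.finrank ℚ K)))) ≤ ENNReal.ofReal (B * η) := by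
        simpa [slab, hw] using hB2 c η hη
      refine (mul_le_mul' e2 e1).trans ?_
      rw [← ENNReal.ofReal_mul (by positivity)]
      apply ENNReal.ofReal_le_ofReal
      apply le_of_eq; ring
    · have hmem : w1 ∈ Finset.univ.erase w₀ := by simp [hw]
      rw [← Finset.mul_prod_erase _ _ hmem]
      have e1 : ∏ w ∈ (Finset.univ.erase w₀).erase w1, volume (slab K w1 c η w) ≤ ∏ w ∈ (Finset.univ.erase (w₀ : InfinitePlace K)).erase w1, ENNReal.ofReal (3 * 2) := by
        refine Finset.prod_le_prod' fun w hw' => ?_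
        have hne := Finset.ne_of_mem_erase hw'
        have hne2 := Finset.ne_of_mem_erase (Finset.mem_of_mem_erase hw')
        simp only [slab, hne, hne2, if_false, Real.volume_Icc]
        apply ENNReal.ofReal_le_ofReal; norm_num
      rw [Finset.prod_const, ← ENNReal.ofReal_pow (by norm_num)] at e1
      have e2 : (∫⁻ u in slab K w1 c η w₀, .ofReal (Real.exp (u * (Module.finrank ℚ K)))) ≤ ENNReal.ofReal B := by
        simpa [slab, Ne.symm hw] using hB1
      have e3 : volume (slab K w1 c η w1) ≤ ENNReal.ofReal (6 * η) := by
        simp only [slab, hw, if_false, if_true, Real.volume_Icc]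
        apply ENNReal.ofReal_le_ofReal; linarith
      refine (mul_le_mul' e2 (mul_le_mul' e3 e1)).trans ?_
      rw [← ENNReal.ofReal_mul (by positivity), ← ENNReal.ofReal_mul (by positivity)]
      apply ENNReal.ofReal_le_ofReal
      rw [← Finset.card_erase_add_one hmem, pow_succ]
      apply le_of_eq; ring
  refine ⟨F.toReal * (B * (3 * 2) ^ (Finset.univ.erase (w₀ : InfinitePlace K)).card), by positivity, fun w1 c η hη => ?_⟩
  rw [volume_slab K _ (slab_meas K w1 c η), mul_assoc F.toReal, ENNReal.ofReal_mul ENNReal.toReal_nonneg, ENNReal.ofReal_toReal hFtop, ← mul_assoc]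
  rw [← mul_assoc] at hF
  rw [← mul_assoc, ← mul_assoc, ← mul_assoc] at *
  rw [hF, mul_assoc]
  have := key w1 c η hη
  simp only [mul_assoc] at this ⊢
  gcongr
end PD
end

section
open MeasureTheory NumberField NumberField.mixedEmbedding NumberField.mixedEmbedding.fundamentalCone NumberField.InfinitePlace NumberField.Units
open NumberField.Units.dirichletUnitTheorem

namespace PD
variable (K : Type*) [Field K] [NumberField K]

open scoped Classical in
lemma normAtPlace_le_norm (x : mixedSpace K) (w : InfinitePlace K) : normAtPlace w x ≤ ‖x‖ := by
  rw [norm_eq_sup'_normAtPlace]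
  exact Finset.le_sup' (fun w => normAtPlace w x) (Finset.mem_univ w)

open scoped Classical in
lemma norm_le_of_normAtPlace (x : mixedSpace K) (r : ℝ) (h : ∀ w : InfinitePlace K, normAtPlace w x ≤ r) : ‖x‖ ≤ r := by
  rw [norm_eq_sup'_normAtPlace]
  exact Finset.sup'_le _ _ fun w _ => h w

open scoped Classical in
lemma normAtPlace_sub_le (x y : mixedSpace K) (w : InfinitePlace K) :
    |normAtPlace w x - normAtPlace w y| ≤ ‖x - y‖ := by
  have h1 := normAtPlace_add_le w (x - y) y
  have h2 := normAtPlace_add_le w (y - x) x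
  have h3 := normAtPlace_le_norm K (x - y) w
  have h4 := normAtPlace_le_norm K (y - x) w
  rw [norm_sub_rev] at h4
  rw [sub_add_cancel] at h1 h2
  rw [abs_le]; constructor <;> linarith

/-- comparability of coordinates -/
lemma exists_bounds : ∃ m M : ℝ, 0 < m ∧ 0 < M ∧ ∀ x ∈ paramSet K, ∀ w : InfinitePlace K,
    m * Real.exp (x w₀) ≤ expMapBasis x w ∧ expMapBasis x w ≤ M * Real.exp (x w₀) := by
  classical
  set Q : Set (realSpace K) := Set.univ.pi fun w ↦ if w = w₀ then {0} else Set.Icc 0 1 with hQ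
  have hQc : IsCompact Q := by
    refine isCompact_univ_pi fun w ↦ ?_
    split_ifs
    · exact isCompact_singleton
    · exact isCompact_Icc
  have hl : ∀ w : InfinitePlace K, Continuous fun x : realSpace K => (expMapBasis x w) := fun w =>
    (continuous_apply w).comp (continuous_expMapBasis K)
  have hQne : Q.Nonempty := Set.univ_pi_nonempty_iff.mpr (fun w => by split_ifs; exacts [⟨0, rfl⟩, ⟨0, by simp⟩])
  have hb : ∀ w : InfinitePlace K, ∃ m M : ℝ, 0 < m ∧ 0 < M ∧ ∀ x ∈ Q, m ≤ expMapBasis x w ∧ expMapBasis x w ≤ M := by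
    intro w
    obtain ⟨x1, h1, h1'⟩ := hQc.exists_isMinOn hQne (hl w).continuousOn
    obtain ⟨x2, h2, h2'⟩ := hQc.exists_isMaxOn hQne (hl w).continuousOn
    exact ⟨_, _, expMapBasis_pos x1 w, expMapBasis_pos x2 w, fun x hx => ⟨h1' hx, h2' hx⟩⟩
  choose m M hm hM hmM using hb
  refine ⟨Finset.univ.inf' Finset.univ_nonempty m, Finset.univ.sup' Finset.univ_nonempty M, ?_, ?_, ?_⟩
  · rw [Finset.lt_inf'_iff]; exact fun w _ => hm w
  · rw [Finset.lt_sup'_iff]; exact ⟨w₀, Finset.mem_univ _, hM w₀⟩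
  · intro x hx w
    rw [expMapBasis_apply'' x]
    have hq : (fun i ↦ if i = w₀ then 0 else x i) ∈ Q := by
      rw [hQ, Set.mem_univ_pi]
      intro i
      by_cases hi : i = w₀
      · simp [hi]
      · have := hx i (Set.mem_univ _)
        simp only [hi, if_false] at this ⊢
        exact ⟨this.1, this.2.le⟩
    have := hmM w _ hq
    have h1 : Finset.univ.inf' Finset.univ_nonempty m ≤ m w := Finset.inf'_le _ (Finset.mem_univ w)
    have h2 : M w ≤ Finset.univ.sup' Finset.univ_nonempty M := Finset.le_sup' _ (Finset.mem_univ w)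
    simp only [Pi.smul_apply, smul_eq_mul]
    have he := Real.exp_pos (x w₀)
    constructor
    · rw [mul_comm]; gcongr; exact h1.trans this.1
    · rw [mul_comm]; gcongr; exact this.2.trans h2

lemma log_diff {a b e : ℝ} (ha : 0 < a) (hb : 0 < b) (r : ℝ) (hr : 0 < r) (h1 : r ≤ a) (h2 : r ≤ b) (h : |a - b| ≤ e) :
    |Real.log a - Real.log b| ≤ e / r := by
  have key : ∀ a b : ℝ, 0 < a → 0 < b → r ≤ b → |a - b| ≤ e → Real.log a - Real.log b ≤ e / r := by
    intro a b ha hb h2 h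
    rw [← Real.log_div ha.ne' hb.ne']
    have := Real.log_le_sub_one_of_pos (div_pos ha hb)
    have e1 : a / b - 1 = (a - b) / b := by field_simp
    rw [e1] at this
    refine this.trans ?_
    have he : 0 ≤ e := (abs_nonneg _).trans h
    calc (a - b) / b ≤ e / b := by gcongr; exact (le_abs_self _).trans h
      _ ≤ e / r := by gcongr
  rw [abs_le]
  have k1 := key a b ha hb h2 h
  have k2 := key b a hb ha h1 (by rwa [abs_sub_comm])
  constructor <;> linarith

open scoped Classical in
lemma bdry_subset : ∃ C ε₀ : ℝ, 0 < C ∧ 0 < ε₀ ∧ ∀ ε, 0 < ε → ε ≤ ε₀ →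
    bdry (normLeOne K) ε ⊆ Metric.closedBall 0 (C * √ε) ∪
      ⋃ w1 : InfinitePlace K, (normAtAllPlaces ⁻¹' (expMapBasis '' (Set.univ.pi (slab K w1 0 (C * √ε))))) ∪ (normAtAllPlaces ⁻¹' (expMapBasis '' (Set.univ.pi (slab K w1 1 (C * √ε))))) := by
  obtain ⟨m, M, hm, hM, hmM⟩ := exists_bounds K
  set T : realSpace K →L[ℝ] realSpace K := (completeBasis K).equivFunL.toContinuousLinearMap with hT
  set C : ℝ := M + 1 + ‖T‖ * (2 * (2 / m)) with hC
  have hCpos : 0 < C := by positivity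
  refine ⟨C, min 1 (min ((m/2)^2) ((1/C)^2)), hCpos, by positivity, fun ε hε hεle => ?_⟩
  have hε1 : ε ≤ 1 := hεle.trans (min_le_left _ _)
  set s := √ε with hs
  have hs0 : 0 < s := Real.sqrt_pos.2 hε
  have hss : s * s = ε := Real.mul_self_sqrt hε.le
  have hs1 : s ≤ 1 := by rw [hs]; exact Real.sqrt_le_one.2 hε1
  have hsm : s ≤ m / 2 := by
    rw [hs]; apply Real.sqrt_le_iff.2; exact ⟨by positivity, hεle.trans ((min_le_right _ _).trans (min_le_left _ _))⟩
  have hsC : C * s ≤ 1 := by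
    have : s ≤ 1 / C := by
      rw [hs]; apply Real.sqrt_le_iff.2; exact ⟨by positivity, hεle.trans ((min_le_right _ _).trans (min_le_right _ _))⟩
    calc C * s ≤ C * (1 / C) := by gcongr
      _ = 1 := by field_simp
  -- key claim
  have key : ∀ a o : mixedSpace K, a ∈ normLeOne K → o ∉ normLeOne K → ‖a - o‖ ≤ ε →
      (‖a‖ ≤ M * s) ∨ ∃ x x' : realSpace K, ∃ w1, ∃ c, (c = 0 ∨ c = 1) ∧ normAtAllPlaces a = expMapBasis x ∧ normAtAllPlaces o = expMapBasis x' ∧ x ∈ Set.univ.pi (slab K w1 c (C * s)) ∧ x' ∈ Set.univ.pi (slab K w1 c (C * s)) := by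
    intro a o ha ho hao
    rw [normLeOne_eq_preimage] at ha ho
    obtain ⟨x, hx, hxa⟩ := ha
    rcases le_or_gt (Real.exp (x w₀)) s with hE | hE
    · left
      refine norm_le_of_normAtPlace K _ _ fun w => ?_
      have := (hmM x hx w).2
      rw [hxa, normAtAllPlaces_apply] at this
      refine this.trans ?_
      gcongr
    · right
      have haw : ∀ w : InfinitePlace K, m * s ≤ normAtPlace w a := by
        intro w
        have := (hmM x hx w).1
        rw [hxa, normAtAllPlaces_apply] at this
        refine le_trans ?_ this
        gcongr
      have hdw : ∀ w : InfinitePlace K, |normAtPlace w a - normAtPlace w o| ≤ ε := fun w =>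
        (normAtPlace_sub_le K a o w).trans hao
      have hms : 0 < m * s := by positivity
      have how : ∀ w : InfinitePlace K, m * s / 2 ≤ normAtPlace w o := by
        intro w
        have h1 := (abs_le.1 (hdw w)).2
        have h2 := haw w
        have : ε ≤ m * s / 2 := by rw [← hss]; nlinarith
        linarith
      have hlog : ∀ w : InfinitePlace K, |Real.log (normAtPlace w a) - Real.log (normAtPlace w o)| ≤ (2 / m) * s := by
        intro w
        have := log_diff (by linarith [haw w]) (by linarith [how w]) (m * s / 2) (by positivity)
          (by linarith [haw w]) (how w) (hdw w)
        refine this.trans (le_of_eq ?_)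
        rw [← hss]; field_simp
      have hopos : normAtAllPlaces o ∈ (expMap (K := K)).target := by
        rw [expMap_target, Set.mem_univ_pi]
        intro w
        have := how w
        rw [Set.mem_Ioi, normAtAllPlaces_apply]
        linarith
      set x' : realSpace K := T (expMap.symm (normAtAllPlaces o)) with hx'
      have hxo : expMapBasis x' = normAtAllPlaces o := by
        rw [expMapBasis_apply]
        have : (completeBasis K).equivFun.symm x' = expMap.symm (normAtAllPlaces o) :=
          (completeBasis K).equivFun.symm_apply_apply _
        rw [this]
        exact expMap.right_inv hopos
      have hxT : x = T (expMap.symm (normAtAllPlaces a)) := by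
        rw [← hxa, expMapBasis_apply]
        rw [expMap.left_inv (by rw [expMap_source]; trivial)]
        exact ((completeBasis K).equivFun.apply_symm_apply _).symm
      have hxx' : ∀ w, |x w - x' w| ≤ C * s := by
        intro w
        have h1 : ‖x - x'‖ ≤ ‖T‖ * ‖expMap.symm (normAtAllPlaces a) - expMap.symm (normAtAllPlaces o)‖ := by
          rw [hx', hxT, ← map_sub]
          exact T.le_opNorm _
        have h2 : ‖expMap.symm (normAtAllPlaces a) - expMap.symm (normAtAllPlaces o)‖ ≤ 2 * (2 / m * s) := by
          rw [pi_norm_le_iff_of_nonneg (by positivity)]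
          intro w
          rw [Pi.sub_apply, expMap_symm_apply, expMap_symm_apply, ← mul_sub, norm_mul, normAtAllPlaces_apply, normAtAllPlaces_apply]
          have hmult : ‖(w.mult : ℝ)‖ ≤ 2 := by
            unfold mult; split_ifs <;> norm_num
          exact mul_le_mul hmult (hlog w) (norm_nonneg _) (by norm_num)
        have h3 := norm_le_pi_norm (x - x') w
        rw [Pi.sub_apply, Real.norm_eq_abs] at h3
        calc _ ≤ ‖T‖ * (2 * (2 / m * s)) := h3.trans (h1.trans (by gcongr))
          _ ≤ C * s := by rw [hC]; nlinarith [mul_pos hM hs0]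
      have hx'p : x' ∉ paramSet K := by
        intro h; exact ho ⟨x', h, hxo⟩
      have hxw : ∀ w, x w ≤ 1 ∧ (w ≠ w₀ → 0 ≤ x w) := by
        intro w
        have := hx w (Set.mem_univ _)
        by_cases hw : w = w₀
        · simp only [hw, if_true, Set.mem_Iic] at this
          rw [hw]
          exact ⟨by linarith, by simp⟩
        · simp only [hw, if_false] at this
          exact ⟨this.2.le, fun _ => this.1⟩
      have hCs : 0 < C * s := by positivity
      have hx'1 : x' w₀ ≤ 1 := by
        have := hx w₀ (Set.mem_univ _)
        simp only [if_true, Set.mem_Iic] at this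
        have := (abs_le.1 (hxx' w₀)).1
        linarith
      have fin : ∀ w1 c, |x w1 - c| ≤ C * s → |x' w1 - c| ≤ C * s →
          x ∈ Set.univ.pi (slab K w1 c (C * s)) ∧ x' ∈ Set.univ.pi (slab K w1 c (C * s)) := by
        intro w1 c h1 h2
        rw [abs_le] at h1 h2
        rw [Set.mem_univ_pi, Set.mem_univ_pi]
        rw [← forall_and]
        intro w
        have hw := abs_le.1 (hxx' w)
        obtain ⟨hw1, hw2⟩ := hxw w
        unfold slab
        split_ifs with e1 e2 e3
        · subst e2; subst e1
          exact ⟨⟨⟨by linarith, by linarith⟩, hw1⟩, ⟨⟨by linarith, by linarith⟩, hx'1⟩⟩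
        · subst e1
          exact ⟨⟨by linarith, by linarith⟩, ⟨by linarith, by linarith⟩⟩
        · subst e3
          exact ⟨hw1, hx'1⟩
        · have := hw2 e3
          exact ⟨⟨by linarith, by linarith⟩, ⟨by linarith, by linarith⟩⟩
      rw [paramSet, Set.mem_univ_pi] at hx'p
      push Not at hx'p
      obtain ⟨w1, hw1⟩ := hx'p
      have hh := abs_le.1 (hxx' w1)
      have hxw1 := hx w1 (Set.mem_univ _)
      by_cases hw : w1 = w₀
      · simp only [hw, if_true, Set.mem_Iic, not_le] at hw1 hxw1
        subst hw
        exact ⟨x, x', _, 0, Or.inl rfl, hxa.symm, hxo.symm, fin _ 0 (abs_le.2 ⟨by linarith, by linarith⟩) (abs_le.2 ⟨by linarith, by linarith⟩)⟩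
      · simp only [hw, if_false, Set.mem_Ico, not_and_or, not_le, not_lt] at hw1 hxw1
        rcases hw1 with h | h
        · exact ⟨x, x', _, 0, Or.inl rfl, hxa.symm, hxo.symm, fin w1 0 (abs_le.2 ⟨by linarith, by linarith⟩) (abs_le.2 ⟨by linarith, by linarith⟩)⟩
        · exact ⟨x, x', _, 1, Or.inr rfl, hxa.symm, hxo.symm, fin w1 1 (abs_le.2 ⟨by linarith, by linarith⟩) (abs_le.2 ⟨by linarith, by linarith⟩)⟩
  have hMC : M * s + ε ≤ C * s := by
    rw [← hss, hC]
    have : 0 ≤ ‖T‖ * (2 * (2 / m)) := by positivity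
    nlinarith
  have memslab : ∀ (y : mixedSpace K) (x : realSpace K) w1 c, (c = 0 ∨ c = 1) → normAtAllPlaces y = expMapBasis x → x ∈ Set.univ.pi (slab K w1 c (C * s)) → y ∈ (⋃ w1 : InfinitePlace K, (normAtAllPlaces ⁻¹' (expMapBasis '' (Set.univ.pi (slab K w1 0 (C * s))))) ∪ (normAtAllPlaces ⁻¹' (expMapBasis '' (Set.univ.pi (slab K w1 1 (C * s))))) : Set (mixedSpace K)) := by
    intro y x w1 c hc hyx hx
    rw [Set.mem_iUnion]
    refine ⟨w1, ?_⟩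
    rcases hc with rfl | rfl
    · left; exact ⟨x, hx, hyx.symm⟩
    · right; exact ⟨x, hx, hyx.symm⟩
  rintro y ⟨z, hzy, ⟨hy, hz⟩ | ⟨hy, hz⟩⟩
  · rcases key y z hy hz (by rwa [norm_sub_rev]) with h | ⟨x, x', w1, c, hc, h1, h2, h3, h4⟩
    · left
      rw [mem_closedBall_zero_iff]; linarith
    · right; exact memslab y x w1 c hc h1 h3
  · rcases key z y hz hy hzy with h | ⟨x, x', w1, c, hc, h1, h2, h3, h4⟩
    · left
      rw [mem_closedBall_zero_iff]
      have := norm_sub_norm_le y z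
      rw [norm_sub_rev] at this
      linarith
    · right; exact memslab y x' w1 c hc h2 h4

open scoped Classical in
lemma volume_bdry : ∃ C : ℝ, 0 ≤ C ∧ ∀ ε, 0 < ε → ε ≤ 1 → volume (bdry (normLeOne K) ε) ≤ ENNReal.ofReal (C * ε ^ (1/2 : ℝ)) := by
  obtain ⟨C, ε₀, hC, hε₀, hsub⟩ := bdry_subset K
  obtain ⟨B, hB, hslab⟩ := volume_slab_le K
  obtain ⟨R, hR⟩ := (isBounded_normLeOne K).subset_closedBall 0
  -- ball volume
  set d := Module.finrank ℝ (mixedSpace K) with hd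
  have hd0 : 0 < d := by rw [hd, mixedEmbedding.finrank]; exact Module.finrank_pos
  set β := (volume (Metric.closedBall (0 : mixedSpace K) 1)).toReal with hβ
  have hball : ∀ r : ℝ, 0 ≤ r → volume (Metric.closedBall (0 : mixedSpace K) r) = ENNReal.ofReal (r ^ d * β) := by
    intro r hr
    rw [Measure.addHaar_closedBall' _ _ hr, ENNReal.ofReal_mul (by positivity), hβ, ENNReal.ofReal_toReal (measure_closedBall_lt_top).ne]
  have hβ0 : 0 ≤ β := ENNReal.toReal_nonneg
  set n := Fintype.card (InfinitePlace K) with hn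
  set C1 := C ^ d * β + n * (2 * (B * C)) with hC1
  set C2 := (|R| + 1) ^ d * β / ε₀ ^ (1/2 : ℝ) with hC2
  have hC1' : 0 ≤ C1 := by positivity
  have hC2' : 0 ≤ C2 := by positivity
  refine ⟨C1 + C2, by positivity, fun ε hε hε1 => ?_⟩
  rcases le_or_gt ε ε₀ with h | h
  · set s := √ε with hs
    have hs' : ε ^ (1/2 : ℝ) = s := by rw [hs, Real.sqrt_eq_rpow]
    have hs0 : 0 ≤ s := Real.sqrt_nonneg _
    have hs1 : s ≤ 1 := Real.sqrt_le_one.2 hε1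
    refine (measure_mono (hsub ε hε h)).trans ((measure_union_le _ _).trans ?_)
    have h1 : volume (Metric.closedBall (0 : mixedSpace K) (C * s)) ≤ ENNReal.ofReal (C ^ d * β * s) := by
      rw [hball _ (by positivity)]
      apply ENNReal.ofReal_le_ofReal
      rw [mul_pow]
      have : s ^ d ≤ s := pow_le_of_le_one hs0 hs1 hd0.ne'
      have h0 : 0 ≤ C ^ d * β := by positivity
      nlinarith
    have h2 : volume (⋃ w1 : InfinitePlace K, (normAtAllPlaces ⁻¹' (expMapBasis '' (Set.univ.pi (slab K w1 0 (C * s))))) ∪ (normAtAllPlaces ⁻¹' (expMapBasis '' (Set.univ.pi (slab K w1 1 (C * s))))) : Set (mixedSpace K)) ≤ ENNReal.ofReal (n * (2 * (B * C)) * s) := by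
      refine (measure_iUnion_fintype_le _ _).trans ?_
      have : ∀ w1 : InfinitePlace K, volume ((normAtAllPlaces ⁻¹' (expMapBasis '' (Set.univ.pi (slab K w1 0 (C * s))))) ∪ (normAtAllPlaces ⁻¹' (expMapBasis '' (Set.univ.pi (slab K w1 1 (C * s))))) : Set (mixedSpace K)) ≤ ENNReal.ofReal (2 * (B * C) * s) := by
        intro w1
        refine (measure_union_le _ _).trans ((add_le_add (hslab w1 0 (C * s) (by positivity)) (hslab w1 1 (C * s) (by positivity))).trans ?_)
        rw [← ENNReal.ofReal_add (by positivity) (by positivity)]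
        apply ENNReal.ofReal_le_ofReal; apply le_of_eq; ring
      refine (Finset.sum_le_sum fun w1 _ => this w1).trans ?_
      rw [Finset.sum_const, nsmul_eq_mul, Finset.card_univ, ← ENNReal.ofReal_natCast, ← ENNReal.ofReal_mul (by positivity)]
      apply ENNReal.ofReal_le_ofReal; apply le_of_eq; ring
    refine (add_le_add h1 h2).trans ?_
    rw [← ENNReal.ofReal_add (by positivity) (by positivity), hs']
    apply ENNReal.ofReal_le_ofReal
    nlinarith
  · have hsub2 : bdry (normLeOne K) ε ⊆ Metric.closedBall 0 (|R| + 1) := by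
      rintro y ⟨z, hzy, ⟨hy, hz⟩ | ⟨hy, hz⟩⟩
      · have := hR hy
        rw [mem_closedBall_zero_iff] at this ⊢
        linarith [le_abs_self R]
      · have := hR hz
        rw [mem_closedBall_zero_iff] at this ⊢
        have h2 := norm_sub_norm_le y z
        rw [norm_sub_rev] at h2
        linarith [le_abs_self R]
    refine (measure_mono hsub2).trans ?_
    rw [hball _ (by positivity)]
    apply ENNReal.ofReal_le_ofReal
    have h3 : ε₀ ^ (1/2 : ℝ) ≤ ε ^ (1/2 : ℝ) := by gcongr
    have h4 : 0 < ε₀ ^ (1/2 : ℝ) := by positivity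
    have h5 : (|R| + 1) ^ d * β = C2 * ε₀ ^ (1/2 : ℝ) := by rw [hC2]; field_simp
    rw [h5]
    have : C2 * ε₀ ^ (1/2 : ℝ) ≤ C2 * ε ^ (1/2 : ℝ) := by gcongr
    nlinarith
end PD
end

section
open MeasureTheory NumberField NumberField.mixedEmbedding NumberField.mixedEmbedding.fundamentalCone NumberField.InfinitePlace NumberField.Units
open Ideal Submodule
open scoped nonZeroDivisors

namespace PD
open scoped Pointwise
variable (K : Type*) [Field K] [NumberField K]

lemma card_class_eq {C : ClassGroup (𝓞 K)} {J : (Ideal (𝓞 K))⁰} {s : ℝ} (hJ : ClassGroup.mk0 J = C⁻¹) :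
    Nat.card {I : (Ideal (𝓞 K))⁰ // absNorm (I : Ideal (𝓞 K)) ≤ s ∧ ClassGroup.mk0 I = C}
      = Nat.card {I : (Ideal (𝓞 K))⁰ // (J : Ideal (𝓞 K)) ∣ I ∧ IsPrincipal (I : Ideal (𝓞 K)) ∧
        absNorm (I : Ideal (𝓞 K)) ≤ s * absNorm (J : Ideal (𝓞 K))} := by
  simp_rw [← nonZeroDivisors_dvd_iff_dvd_coe]
  refine Nat.card_congr ?_
  refine ((Equiv.dvd J).subtypeEquiv fun I ↦ ?_).trans
    (Equiv.subtypeSubtypeEquivSubtypeInter (fun I : (Ideal (𝓞 K))⁰ ↦ J ∣ I) _)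
  rw [← ClassGroup.mk0_eq_one_iff (SetLike.coe_mem _)]
  simp_rw [Equiv.dvd_apply, Submonoid.coe_mul, ← Submonoid.mul_def, _root_.map_mul, hJ,
    inv_mul_eq_one, Nat.cast_mul, mul_comm s, eq_comm, and_comm, and_congr_left_iff]
  exact fun _ ↦
    (mul_le_mul_iff_of_pos_left (Nat.cast_pos.mpr (absNorm_pos_of_nonZeroDivisors J))).symm

open scoped Classical in
lemma card_idealSet (J : (Ideal (𝓞 K))⁰) {s : ℝ} (hs : 0 < s) :
    Nat.card {a : idealSet K J // mixedEmbedding.norm (a : mixedSpace K) ≤ s} =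
    Nat.card ↑(((s ^ ((Module.finrank ℚ K : ℝ)⁻¹)) • normLeOne K) ∩ (Submodule.span ℤ (Set.range (fractionalIdealLatticeBasis K (FractionalIdeal.mk0 K J))) : Set (mixedSpace K))) := by
  rw [span_idealLatticeBasis]
  refine Nat.card_congr ((Equiv.subtypeSubtypeEquivSubtypeInter _ (mixedEmbedding.norm · ≤ s)).trans (Equiv.subtypeEquivProp ?_))
  ext x
  set t := s ^ ((Module.finrank ℚ K : ℝ)⁻¹) with ht
  have ht0 : 0 < t := by positivity
  have htd : t ^ (Module.finrank ℚ K) = s := Real.rpow_inv_natCast_pow hs.le Module.finrank_pos.ne'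
  change (x ∈ idealSet K J ∧ mixedEmbedding.norm x ≤ s) ↔ x ∈ t • normLeOne K ∩ _
  rw [Set.mem_inter_iff, Set.mem_smul_set_iff_inv_smul_mem₀ ht0.ne', mem_normLeOne,
    smul_mem_iff_mem (inv_ne_zero ht0.ne'), mixedEmbedding.norm_smul, abs_of_pos (inv_pos.2 ht0), inv_pow, htd, idealSet, Set.mem_inter_iff, inv_mul_le_iff₀ hs, mul_one]
  tauto

lemma class_count (C : ClassGroup (𝓞 K)) : ∃ c B s₀ : ℝ, 0 < c ∧ 0 ≤ B ∧ 1 ≤ s₀ ∧ ∀ s, s₀ ≤ s →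
    |(Nat.card {I : (Ideal (𝓞 K))⁰ // absNorm (I : Ideal (𝓞 K)) ≤ s ∧ ClassGroup.mk0 I = C} : ℝ) - c * s| ≤ B * s ^ (1 - 1 / (2 * (Module.finrank ℚ K : ℝ))) := by
  classical
  obtain ⟨J, hJ⟩ := ClassGroup.mk0_surjective C⁻¹
  obtain ⟨C₀, hC₀, hb⟩ := volume_bdry K
  set b := fractionalIdealLatticeBasis K (FractionalIdeal.mk0 K J) with hbdef
  obtain ⟨B, ρ, hB, hρ, hcount⟩ := lattice_count volume b (normLeOne K) (isBounded_normLeOne K)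
    (measurableSet_normLeOne K) hb hC₀
  set μQ := volume.real (ZSpan.fundamentalDomain b) with hμQ
  set μA := volume.real (normLeOne K) with hμA
  have hμQ0 : 0 < μQ := by
    rw [hμQ, measureReal_def]
    exact ENNReal.toReal_pos (ZSpan.measure_fundamentalDomain_ne_zero b) (ZSpan.fundamentalDomain_isBounded b).measure_lt_top.ne
  have hμA0 : 0 < μA := by
    rw [hμA, measureReal_def, volume_normLeOne]
    have := regulator_pos K
    apply ENNReal.toReal_pos
    · simp [this, NNReal.pi_ne_zero]
    · finiteness
  set d := Module.finrank ℚ K with hd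
  have hd0 : 0 < d := Module.finrank_pos
  have hd' : (0:ℝ) < d := by exact_mod_cast hd0
  have hfr : Module.finrank ℝ (mixedSpace K) = d := mixedEmbedding.finrank K
  rw [hfr] at hcount
  set nJ : ℝ := ((absNorm (J : Ideal (𝓞 K)) : ℕ) : ℝ) with hnJ
  have hnJ0 : 1 ≤ nJ := by rw [hnJ]; exact_mod_cast absNorm_pos_of_nonZeroDivisors J
  have hτ : (0:ℝ) < torsionOrder K := by exact_mod_cast torsionOrder_pos K
  refine ⟨μA * nJ / (μQ * torsionOrder K), B * nJ ^ (1 - 1 / (2 * (d : ℝ))) / (μQ * torsionOrder K), max 1 (ρ ^ d), by positivity, by positivity, le_max_left _ _, fun s hs => ?_⟩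
  have hs1 : 1 ≤ s := (le_max_left _ _).trans hs
  have hs0 : 0 < s := by linarith
  have hsn : 0 < s * nJ := by positivity
  set t := (s * nJ) ^ ((d : ℝ)⁻¹) with ht
  have htd : t ^ d = s * nJ := Real.rpow_inv_natCast_pow hsn.le hd0.ne'
  have ht0 : 0 < t := by positivity
  have htρ : ρ ≤ t := by
    apply le_of_pow_le_pow_left₀ hd0.ne' ht0.le
    rw [htd]
    have : ρ ^ d ≤ s := (le_max_right _ _).trans hs
    nlinarith
  have h1 := hcount t htρ
  rw [← card_idealSet K J hsn, ← card_isPrincipal_dvd_norm_le, ← card_class_eq K hJ, htd] at h1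
  have e : t ^ ((d:ℝ) - 1/2) = s ^ (1 - 1 / (2 * (d : ℝ))) * nJ ^ (1 - 1 / (2 * (d : ℝ))) := by
    rw [ht, ← Real.rpow_mul hsn.le, ← Real.mul_rpow hs0.le (by linarith)]
    congr 1; field_simp; try ring
  rw [e] at h1
  set N := (Nat.card {I : (Ideal (𝓞 K))⁰ // absNorm (I : Ideal (𝓞 K)) ≤ s ∧ ClassGroup.mk0 I = C}) with hN
  have hpos : 0 < μQ * torsionOrder K := by positivity
  have e2 : (N : ℝ) - μA * nJ / (μQ * torsionOrder K) * s = (((N * torsionOrder K : ℕ) : ℝ) * μQ - s * nJ * μA) / (μQ * torsionOrder K) := by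
    push_cast; field_simp
  rw [e2, abs_div, abs_of_pos hpos, div_le_iff₀ hpos]
  refine h1.trans (le_of_eq ?_)
  field_simp

/-- number of nonzero ideals of norm at most `s` -/
noncomputable def idealCount (s : ℝ) : ℕ := Nat.card {I : (Ideal (𝓞 K))⁰ // absNorm (I : Ideal (𝓞 K)) ≤ s}

lemma finite_ideals {s : ℝ} (hs : 0 ≤ s) : Finite {I : (Ideal (𝓞 K))⁰ // (absNorm (I : Ideal (𝓞 K)) : ℝ) ≤ s} := by
  simp_rw [← Nat.le_floor_iff hs]
  exact finite_setOfPred_absNorm_le₀ ⌊s⌋₊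

lemma idealCount_eq {s : ℝ} (hs : 0 ≤ s) : idealCount K s = ∑ C : ClassGroup (𝓞 K), Nat.card {I : (Ideal (𝓞 K))⁰ // absNorm (I : Ideal (𝓞 K)) ≤ s ∧ ClassGroup.mk0 I = C} := by
  classical
  have : Fintype {I : (Ideal (𝓞 K))⁰ // absNorm (I : Ideal (𝓞 K)) ≤ s} := @Fintype.ofFinite _ (finite_ideals K hs)
  let e := fun C : ClassGroup (𝓞 K) ↦ Equiv.subtypeSubtypeEquivSubtypeInter
      (fun I : (Ideal (𝓞 K))⁰ ↦ absNorm I.1 ≤ s) (fun I ↦ ClassGroup.mk0 I = C)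
  simp_rw [idealCount, ← Nat.card_congr (e _), Nat.card_eq_fintype_card, Fintype.subtype_card]
  rw [Fintype.card, Finset.card_eq_sum_card_fiberwise (f := fun I ↦ ClassGroup.mk0 I.1)
      (t := Finset.univ) (fun _ _ ↦ Finset.mem_univ _)]

theorem ideal_count : ∃ c B δ : ℝ, 0 < c ∧ 0 ≤ B ∧ 0 < δ ∧ δ < 1 ∧ ∀ s : ℝ, 1 ≤ s →
    |(idealCount K s : ℝ) - c * s| ≤ B * s ^ (1 - δ) := by
  choose c B s₀ hc hB hs₀ hcount using class_count K
  set δ := 1 / (2 * (Module.finrank ℚ K : ℝ)) with hδ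
  have hd0 : (1:ℝ) ≤ Module.finrank ℚ K := by exact_mod_cast (Module.finrank_pos : 0 < Module.finrank ℚ K)
  have hδ0 : 0 < δ := by positivity
  have hδ1 : δ < 1 := by rw [hδ, div_lt_one (by positivity)]; linarith
  set S := ∑ C, s₀ C with hS
  have hs₀S : ∀ C, s₀ C ≤ S := fun C => Finset.single_le_sum (f := s₀) (fun i _ => by linarith [hs₀ i]) (Finset.mem_univ C)
  have hS1 : 1 ≤ S := (hs₀ 1).trans (hs₀S 1)
  have hcpos : 0 < ∑ C, c C := Finset.sum_pos (fun C _ => hc C) ⟨1, Finset.mem_univ _⟩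
  have hBpos : 0 ≤ ∑ C, B C := Finset.sum_nonneg fun C _ => hB C
  refine ⟨∑ C, c C, ∑ C, B C + (idealCount K S + (∑ C, c C) * S), δ, hcpos, by positivity, hδ0, hδ1, fun s hs => ?_⟩
  rcases le_or_gt S s with h | h
  · rw [idealCount_eq K (by linarith)]
    push_cast
    rw [Finset.sum_mul, ← Finset.sum_sub_distrib]
    refine (Finset.abs_sum_le_sum_abs _ _).trans ?_
    refine (Finset.sum_le_sum fun C _ => hcount C s ((hs₀S C).trans h)).trans ?_
    rw [← Finset.sum_mul]
    gcongr
    have : 0 ≤ idealCount K S + (∑ C, c C) * S := by positivity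
    linarith
  · have hmono : idealCount K s ≤ idealCount K S := by
      have := finite_ideals K (s := S) (by linarith)
      exact Nat.card_le_card_of_injective (fun I : {I : (Ideal (𝓞 K))⁰ // (absNorm (I : Ideal (𝓞 K)) : ℝ) ≤ s} => (⟨I.1, I.2.trans h.le⟩ : {I : (Ideal (𝓞 K))⁰ // (absNorm (I : Ideal (𝓞 K)) : ℝ) ≤ S})) (fun a b hab => by
        ext1; simpa using hab)
    have hm' : (idealCount K s : ℝ) ≤ idealCount K S := by exact_mod_cast hmono
    have h1 : 1 ≤ s ^ (1 - δ) := Real.one_le_rpow hs (by linarith)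
    have h2 : |(idealCount K s : ℝ) - (∑ C, c C) * s| ≤ idealCount K S + (∑ C, c C) * S := by
      rw [abs_le]
      have : (∑ C, c C) * s ≤ (∑ C, c C) * S := by gcongr
      have h3 : 0 ≤ (∑ C, c C) * s := by positivity
      have h4 : (0:ℝ) ≤ idealCount K s := by positivity
      constructor <;> linarith
    have h5 : 0 ≤ idealCount K S + (∑ C, c C) * S := by positivity
    refine h2.trans ?_
    nlinarith
end PD
end

section
open NumberField Ideal
open scoped nonZeroDivisors

namespace PD
variable (K : Type*) [Field K] [NumberField K]

/-- finset of ideals with given norm (empty for norm zero). -/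
noncomputable def idN (n : ℕ) : Finset (Ideal (𝓞 K)) :=
  if n = 0 then ∅ else (finite_setOfPred_absNorm_eq (S := 𝓞 K) n).toFinset

lemma mem_idN {n : ℕ} {I : Ideal (𝓞 K)} : I ∈ idN K n ↔ n ≠ 0 ∧ absNorm I = n := by
  unfold idN
  split_ifs with h <;> simp [h]

/-- pairs of a prime ideal and an exponent whose power has given norm -/
noncomputable def idT (v : ℕ) : Finset (Ideal (𝓞 K) × ℕ) := by
  classical
  exact (((Finset.Icc 1 v).biUnion (idN K)) ×ˢ (Finset.Icc 1 v)).filter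
    (fun q => Prime q.1 ∧ absNorm q.1 ^ q.2 = v)

lemma one_lt_norm {P : Ideal (𝓞 K)} (hP : Prime P) : 1 < absNorm P := by
  have h0 : absNorm P ≠ 0 := by
    rw [Ne, absNorm_eq_zero_iff]; exact hP.ne_zero
  have h1 : absNorm P ≠ 1 := by
    rw [Ne, absNorm_eq_one_iff, ← Ideal.isUnit_iff]; exact hP.not_isUnit
  omega

lemma mem_idT {v : ℕ} {q : Ideal (𝓞 K) × ℕ} : q ∈ idT K v ↔ Prime q.1 ∧ 1 ≤ q.2 ∧ absNorm q.1 ^ q.2 = v := by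
  classical
  unfold idT
  simp only [Finset.mem_filter, Finset.mem_product, Finset.mem_biUnion, mem_idN, Finset.mem_Icc]
  constructor
  · rintro ⟨⟨_, h1, _⟩, h2, h3⟩
    exact ⟨h2, h1, h3⟩
  · rintro ⟨h2, h1, h3⟩
    have := one_lt_norm K h2
    have h4 : absNorm q.1 ≤ v := by rw [← h3]; exact Nat.le_self_pow (by omega) _
    have h5 : q.2 < v := by rw [← h3]; exact Nat.lt_pow_self this
    exact ⟨⟨⟨absNorm q.1, ⟨by omega, h4⟩, by omega, rfl⟩, h1, h5.le⟩, h2, h3⟩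

/-- number of ideals of norm `n` -/
noncomputable def aK : ArithmeticFunction ℝ := ⟨fun n => (idN K n).card, by simp [idN]⟩

/-- von Mangoldt function of the number field -/
noncomputable def LK : ArithmeticFunction ℝ := ⟨fun v => ∑ q ∈ idT K v, Real.log (absNorm q.1), by
  apply Finset.sum_eq_zero
  intro q hq
  rw [mem_idT] at hq
  have := one_lt_norm K hq.1
  have h := hq.2.2
  rw [pow_eq_zero_iff (by omega)] at h
  omega⟩

lemma aK_apply (n : ℕ) : aK K n = (idN K n).card := rfl
lemma LK_apply (n : ℕ) : LK K n = ∑ q ∈ idT K n, Real.log (absNorm q.1) := rfl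

lemma aK_one : aK K 1 = 1 := by
  rw [aK_apply]
  have : idN K 1 = {⊤} := by
    ext I; simp [mem_idN, absNorm_eq_one_iff]
  simp [this]

lemma LK_nonneg (n : ℕ) : 0 ≤ LK K n := by
  rw [LK_apply]
  exact Finset.sum_nonneg fun q _ => Real.log_natCast_nonneg _

lemma log_norm {I : Ideal (𝓞 K)} (hI : I ≠ 0) [DecidableEq (Ideal (𝓞 K))] :
    Real.log (absNorm I) = ∑ P ∈ (UniqueFactorizationMonoid.normalizedFactors I).toFinset,
      ∑ j ∈ Finset.Icc 1 ((UniqueFactorizationMonoid.normalizedFactors I).count P), Real.log (absNorm P) := by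
  have h1 : (UniqueFactorizationMonoid.normalizedFactors I).prod = I := by
    have := UniqueFactorizationMonoid.prod_normalizedFactors hI
    rwa [associated_iff_eq] at this
  conv_lhs => rw [← h1]
  rw [Finset.prod_multiset_count, map_prod, Nat.cast_prod, Real.log_prod]
  · refine Finset.sum_congr rfl fun P hP => ?_
    rw [map_pow, Finset.sum_const, Nat.card_Icc, nsmul_eq_mul]
    simp
  · intro P hP
    have := one_lt_norm K (UniqueFactorizationMonoid.prime_of_normalized_factor P (Multiset.mem_toFinset.1 hP))
    rw [map_pow]; positivity

lemma le_count_nf [DecidableEq (Ideal (𝓞 K))] {P I : Ideal (𝓞 K)} (hP : Irreducible P) (hI : I ≠ 0) {j : ℕ} :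
    j ≤ (UniqueFactorizationMonoid.normalizedFactors I).count P ↔ P ^ j ∣ I := by
  rw [Multiset.le_count_iff_replicate_le, ← normalize_eq P,
    ← UniqueFactorizationMonoid.le_emultiplicity_iff_replicate_le_normalizedFactors hP hI,
    pow_dvd_iff_le_emultiplicity, normalize_eq]

lemma aK_mul_LK : aK K * LK K = (aK K).pmul ArithmeticFunction.log := by
  classical
  ext n
  rcases eq_or_ne n 0 with rfl | hn
  · simp
  rw [ArithmeticFunction.mul_apply, ArithmeticFunction.pmul_apply, ArithmeticFunction.log_apply, aK_apply]
  have e1 : ((idN K n).card : ℝ) * Real.log n = ∑ I ∈ idN K n, ∑ P ∈ (UniqueFactorizationMonoid.normalizedFactors I).toFinset,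
      ∑ j ∈ Finset.Icc 1 ((UniqueFactorizationMonoid.normalizedFactors I).count P), Real.log (absNorm P) := by
    rw [← nsmul_eq_mul, ← Finset.sum_const]
    refine Finset.sum_congr rfl fun I hI => ?_
    rw [mem_idN] at hI
    rw [← log_norm K, hI.2]
    rintro rfl
    simp at hI
    exact hI.1 hI.2.symm
  rw [e1]
  have e2 : ∀ x : ℕ × ℕ, aK K x.1 * LK K x.2 = ∑ m ∈ idN K x.1, ∑ q ∈ idT K x.2, Real.log (absNorm q.1) := by
    intro x
    rw [aK_apply, LK_apply, Finset.sum_const, nsmul_eq_mul]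
  simp_rw [e2]
  rw [Finset.sum_congr rfl (fun x _ => (Finset.sum_product' (idN K (Prod.fst x)) (idT K x.2) (fun _ q => Real.log (absNorm q.1))).symm)]
  rw [Finset.sum_sigma']
  rw [Finset.sum_congr rfl (fun I _ => Finset.sum_sigma' (UniqueFactorizationMonoid.normalizedFactors I).toFinset (fun P => Finset.Icc 1 ((UniqueFactorizationMonoid.normalizedFactors I).count P)) (fun P _ => Real.log (absNorm P)))]
  rw [Finset.sum_sigma']
  have hne : ∀ I ∈ idN K n, I ≠ 0 := by
    rintro I hI rfl
    rw [mem_idN] at hI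
    simp at hI
    exact hI.1 hI.2.symm
  refine Finset.sum_bij (fun x _ => ⟨x.2.1 * x.2.2.1 ^ x.2.2.2, ⟨x.2.2.1, x.2.2.2⟩⟩) ?_ ?_ ?_ ?_
  · rintro ⟨⟨u, v⟩, m, P, j⟩ hx
    simp only [Finset.mem_sigma, Nat.mem_divisorsAntidiagonal, Finset.mem_product, mem_idN, mem_idT] at hx
    obtain ⟨⟨huv, _⟩, ⟨hu, hm⟩, hP, hj, hv⟩ := hx
    have hmem : m * P ^ j ∈ idN K n := by
      rw [mem_idN, map_mul, map_pow, hm, hv]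
      exact ⟨hn, huv⟩
    have h0 := hne _ hmem
    have hcount : j ≤ (UniqueFactorizationMonoid.normalizedFactors (m * P ^ j)).count P := by
      rw [le_count_nf K hP.irreducible h0] 
      · exact dvd_mul_left _ _
    simp only [Finset.mem_sigma, Finset.mem_Icc, Multiset.mem_toFinset]
    refine ⟨hmem, ?_, hj, hcount⟩
    rw [← Multiset.count_pos]; omega
  · rintro ⟨⟨u, v⟩, m, P, j⟩ hx ⟨⟨u', v'⟩, m', P', j'⟩ hx' h
    simp only [Finset.mem_sigma, Nat.mem_divisorsAntidiagonal, Finset.mem_product, mem_idN, mem_idT] at hx hx'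
    simp only [Sigma.mk.injEq, heq_eq_eq] at h
    obtain ⟨h1, h2⟩ := h
    obtain ⟨rfl, rfl⟩ : P = P' ∧ j = j' := by
      simpa using h2
    have hP0 : P ^ j ≠ 0 := pow_ne_zero _ hx.2.2.1.ne_zero
    have : m = m' := mul_right_cancel₀ hP0 h1
    subst this
    obtain ⟨_, ⟨_, rfl⟩, _, _, rfl⟩ := hx
    obtain ⟨_, ⟨_, rfl⟩, _, _, rfl⟩ := hx'
    rfl
  · rintro ⟨I, P, j⟩ hx
    simp only [Finset.mem_sigma, Finset.mem_Icc, Multiset.mem_toFinset] at hx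
    obtain ⟨hI, hP, hj, hjc⟩ := hx
    have hPp := UniqueFactorizationMonoid.prime_of_normalized_factor P hP
    rw [le_count_nf K hPp.irreducible (hne I hI)] at hjc
    obtain ⟨m, rfl⟩ := hjc
    have hI' := (mem_idN K).1 hI
    rw [map_mul, map_pow] at hI'
    refine ⟨⟨⟨absNorm m, absNorm P ^ j⟩, m, P, j⟩, ?_, ?_⟩
    · simp only [Finset.mem_sigma, Nat.mem_divisorsAntidiagonal, Finset.mem_product, mem_idN, mem_idT]
      refine ⟨⟨by rw [mul_comm]; exact hI'.2, hn⟩, ⟨?_, trivial⟩, hPp, hj, trivial⟩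
      intro h
      rw [h, mul_zero] at hI'
      exact hn hI'.2.symm
    · simp [mul_comm]
  · rintro ⟨⟨u, v⟩, m, P, j⟩ hx
    rfl

lemma idT_prime {v : ℕ} {q : Ideal (𝓞 K) × ℕ} (hq : q ∈ idT K v) :
    v.minFac.Prime ∧ IsPrimePow v ∧ q.1 ∣ Ideal.span {(v.minFac : 𝓞 K)} := by
  rw [mem_idT] at hq
  obtain ⟨hP, hj, hv⟩ := hq
  have hPp : q.1.IsPrime := Ideal.isPrime_of_prime hP
  have hnz : NeZero q.1 := ⟨hP.ne_zero⟩
  have hp := Nat.absNorm_under_prime q.1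
  set p := absNorm (Ideal.under ℤ q.1) with hpdef
  have hmem : (p : 𝓞 K) ∈ q.1 := by exact_mod_cast Int.absNorm_under_mem q.1
  have hdvd : q.1 ∣ Ideal.span {(p : 𝓞 K)} := by
    rw [Ideal.dvd_span_singleton]; exact hmem
  have hN : absNorm q.1 ∣ p ^ Module.finrank ℤ (𝓞 K) := by
    have := absNorm_dvd_absNorm_of_le (Ideal.le_of_dvd hdvd)
    rw [absNorm_span_singleton] at this
    have e : (p : 𝓞 K) = algebraMap ℤ (𝓞 K) p := by simp
    rw [e, Algebra.norm_algebraMap_of_basis (Module.Free.chooseBasis ℤ (𝓞 K))] at this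
    rw [Module.finrank_eq_card_chooseBasisIndex]
    simpa [Int.natAbs_pow] using this
  obtain ⟨i, _, hi⟩ := (Nat.dvd_prime_pow hp).1 hN
  have h1 := one_lt_norm K hP
  have hi0 : i ≠ 0 := by rintro rfl; rw [pow_zero] at hi; omega
  have hv' : v = p ^ (i * q.2) := by rw [← hv, hi, pow_mul]
  have hij : i * q.2 ≠ 0 := by positivity
  have hmf : v.minFac = p := by rw [hv', hp.pow_minFac hij]
  rw [hmf]
  exact ⟨hp, ⟨p, i * q.2, hp.prime, by omega, hv'.symm⟩, hdvd⟩

lemma norm_span_nat (p : ℕ) : absNorm (Ideal.span {(p : 𝓞 K)}) = p ^ Module.finrank ℤ (𝓞 K) := by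
  rw [absNorm_span_singleton]
  have e : (p : 𝓞 K) = algebraMap ℤ (𝓞 K) p := by simp
  rw [e, Algebra.norm_algebraMap_of_basis (Module.Free.chooseBasis ℤ (𝓞 K))]
  rw [Module.finrank_eq_card_chooseBasisIndex]
  simp [Int.natAbs_pow]

lemma LK_le (v : ℕ) : LK K v ≤ Module.finrank ℤ (𝓞 K) * ArithmeticFunction.vonMangoldt v := by
  classical
  rw [LK_apply]
  rcases (idT K v).eq_empty_or_nonempty with h | ⟨q, hq⟩
  · rw [h, Finset.sum_empty]
    have := ArithmeticFunction.vonMangoldt_nonneg (n := v)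
    positivity
  obtain ⟨hp, hpp, _⟩ := idT_prime K hq
  rw [ArithmeticFunction.vonMangoldt_apply, if_pos hpp]
  set p := v.minFac
  have hinj : Set.InjOn Prod.fst (idT K v : Set (Ideal (𝓞 K) × ℕ)) := by
    rintro ⟨P, j⟩ h1 ⟨P', j'⟩ h2 (rfl : P = P')
    rw [Finset.mem_coe, mem_idT] at h1 h2
    have := one_lt_norm K h1.1
    have h3 : absNorm P ^ j = absNorm P ^ j' := h1.2.2.trans h2.2.2.symm
    rw [Nat.pow_right_injective this h3]
  have hsum : ∑ q ∈ idT K v, Real.log (absNorm q.1) = ∑ P ∈ (idT K v).image Prod.fst, Real.log (absNorm P) := by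
    rw [Finset.sum_image hinj]
  rw [hsum, ← Real.log_prod, ← Nat.cast_prod, ← map_prod, ← Real.log_pow]
  · apply Real.log_le_log
    · have : (∏ P ∈ (idT K v).image Prod.fst, P) ≠ 0 := by
        rw [Finset.prod_ne_zero_iff]
        intro P hP
        obtain ⟨q, hq, rfl⟩ := Finset.mem_image.1 hP
        exact ((mem_idT K).1 hq).1.ne_zero
      have h2 : absNorm (∏ P ∈ (idT K v).image Prod.fst, P) ≠ 0 := by
        rwa [Ne, absNorm_eq_zero_iff]
      positivity
    · have hd : (∏ P ∈ (idT K v).image Prod.fst, P) ∣ Ideal.span {(p : 𝓞 K)} := by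
        apply Finset.prod_primes_dvd
        · intro P hP
          obtain ⟨q, hq, rfl⟩ := Finset.mem_image.1 hP
          exact ((mem_idT K).1 hq).1
        · intro P hP
          obtain ⟨q, hq, rfl⟩ := Finset.mem_image.1 hP
          exact (idT_prime K hq).2.2
      have h3 := absNorm_dvd_absNorm_of_le (Ideal.le_of_dvd hd)
      rw [norm_span_nat] at h3
      have := Nat.le_of_dvd (pow_pos hp.pos _) h3
      exact_mod_cast this
  · intro P hP
    obtain ⟨q, hq, rfl⟩ := Finset.mem_image.1 hP
    have := one_lt_norm K ((mem_idT K).1 hq).1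
    positivity

lemma aK_log_le {p : ℕ} (hp : p.Prime) : aK K p * Real.log p ≤ LK K p := by
  classical
  rw [aK_apply, LK_apply, ← nsmul_eq_mul, ← Finset.sum_const]
  have hinj : Set.InjOn (fun I : Ideal (𝓞 K) => (I, 1)) (idN K p : Set (Ideal (𝓞 K))) := by
    intro a _ b _ h; simpa using h
  have : ∑ I ∈ idN K p, Real.log p = ∑ q ∈ (idN K p).image (fun I => (I, 1)), Real.log (absNorm q.1) := by
    rw [Finset.sum_image hinj]
    refine Finset.sum_congr rfl fun I hI => ?_
    rw [((mem_idN K).1 hI).2]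
  rw [this]
  refine Finset.sum_le_sum_of_subset_of_nonneg ?_ fun q _ _ => Real.log_natCast_nonneg _
  intro q hq
  obtain ⟨I, hI, rfl⟩ := Finset.mem_image.1 hq
  rw [mem_idN] at hI
  rw [mem_idT]
  refine ⟨?_, le_rfl, by simpa using hI.2⟩
  have h1 : absNorm I ≠ 0 := by rw [hI.2]; exact hp.ne_zero
  have h2 : (I : Ideal (𝓞 K)) ≠ ⊥ := by rintro rfl; simp at h1
  exact Ideal.prime_of_isPrime h2 (isPrime_of_irreducible_absNorm (by rw [hI.2]; exact hp.prime.irreducible))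

lemma Sm_aK (y : ℝ) (hy : 1 ≤ y) : Sm (aK K) y = idealCount K y := by
  classical
  rw [Sm_eq]
  simp_rw [aK_apply]
  rw [← Nat.cast_sum, ← Finset.card_biUnion]
  · congr 1
    rw [idealCount, ← Nat.card_eq_finsetCard]
    refine Nat.card_congr ⟨fun I => ⟨⟨I.1, mem_nonZeroDivisors_of_ne_zero ?_⟩, ?_⟩, fun I => ⟨I.1.1, ?_⟩, fun _ => rfl, fun _ => rfl⟩
    · rintro h
      have := I.2
      rw [h] at this
      simp [mem_idN] at this
    · have := I.2
      simp only [Finset.mem_biUnion, mem_idN, Finset.mem_Ioc] at this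
      obtain ⟨a, ⟨h1, h2⟩, h3, h4⟩ := this
      rw [← Nat.le_floor_iff (by linarith)]
      change absNorm I.1 ≤ _
      omega
    · have h1 := I.2
      have h0 := absNorm_pos_of_nonZeroDivisors I.1
      rw [← Nat.le_floor_iff (by linarith)] at h1
      simp only [Finset.mem_biUnion, mem_idN, Finset.mem_Ioc]
      exact ⟨_, ⟨h0, h1⟩, h0.ne', rfl⟩
  · intro a _ b _ hab
    rw [Function.onFun, Finset.disjoint_left]
    intro I h1 h2
    rw [mem_idN] at h1 h2
    exact hab (h1.2.symm.trans h2.2)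

theorem LK_upper : ∃ B : ℝ, ∀ N : ℕ, 1 ≤ N → Sm (LK K) N * Real.log N ≤ 2 * N * Real.log N + B * N := by
  obtain ⟨c, C, δ, hc, hC, hδ, hδ1, h⟩ := ideal_count K
  set d : ℝ := ((Module.finrank ℤ (𝓞 K) : ℕ) : ℝ)
  refine selberg_upper (C' := d * (Real.log 4 + 4)) (aK_one K) (fun n => by rw [aK_apply]; positivity) (LK_nonneg K) (aK_mul_LK K) hc hC hδ hδ1 (fun y hy => by rw [Sm_aK K y hy]; exact h y hy) (by have := Real.log_nonneg (show (1:ℝ) ≤ 4 by norm_num); positivity) ?_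
  intro y hy
  have h1 := Chebyshev.psi_le_const_mul_self (x := y) (by linarith)
  rw [Sm_eq]
  calc ∑ n ∈ Finset.Ioc 0 ⌊y⌋₊, LK K n ≤ ∑ n ∈ Finset.Ioc 0 ⌊y⌋₊, d * ArithmeticFunction.vonMangoldt n := Finset.sum_le_sum fun n _ => LK_le K n
    _ = d * Chebyshev.psi y := by rw [← Finset.mul_sum]; rfl
    _ ≤ d * ((Real.log 4 + 4) * y) := by gcongr
    _ = _ := by ring
end PD
end

section
open NumberField Ideal
open scoped nonZeroDivisors
open ArithmeticFunction hiding log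

namespace PD
variable (K : Type*) [Field K] [NumberField K]

lemma aK_nonneg (n : ℕ) : 0 ≤ aK K n := by rw [aK_apply]; positivity

lemma aK_prime_le {p : ℕ} (hp : p.Prime) : aK K p ≤ Module.finrank ℤ (𝓞 K) := by
  have h1 := aK_log_le K hp
  have h2 := LK_le K p
  rw [ArithmeticFunction.vonMangoldt_apply_prime hp] at h2
  have : 0 < Real.log p := Real.log_pos (by exact_mod_cast hp.one_lt)
  exact le_of_mul_le_mul_right (h1.trans h2) this

/-- The number of degree one primes of norm at most `N` is at most `7 N / log N`. -/
theorem sum_aK_primes : ∃ N₀ : ℕ, ∀ N : ℕ, N₀ ≤ N →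
    ∑ p ∈ (Finset.range (N + 1)).filter Nat.Prime, aK K p ≤ 7 * N / Real.log N := by
  obtain ⟨B, hB⟩ := LK_upper K
  set d : ℝ := ((Module.finrank ℤ (𝓞 K) : ℕ) : ℝ) with hd
  have hd0 : 0 ≤ d := by positivity
  have hlo : ∀ᶠ x : ℝ in Filter.atTop, Real.log x ≤ (1 / (2 * d + 1)) * x ^ (1/2 : ℝ) := by
    have := (isLittleO_log_rpow_atTop (r := 1/2) (by norm_num)).bound (c := 1 / (2 * d + 1)) (by positivity)
    filter_upwards [this, Filter.eventually_ge_atTop 1] with x hx h1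
    rw [Real.norm_eq_abs, Real.norm_eq_abs, abs_of_nonneg (Real.log_nonneg h1), abs_of_nonneg (by positivity)] at hx
    exact hx
  have hBl : ∀ᶠ x : ℝ in Filter.atTop, B ≤ Real.log x := Real.tendsto_log_atTop.eventually_ge_atTop B
  have hall := tendsto_natCast_atTop_atTop.eventually (hlo.and hBl)
  obtain ⟨N₀, hN₀⟩ := Filter.eventually_atTop.1 hall
  refine ⟨max N₀ 2, fun N hN => ?_⟩
  obtain ⟨h1, h2⟩ := hN₀ N (le_trans (le_max_left _ _) hN)
  have hN2 : 2 ≤ N := le_trans (le_max_right _ _) hN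
  have hNr : (2 : ℝ) ≤ N := by exact_mod_cast hN2
  have hlog : 0 < Real.log N := Real.log_pos (by linarith)
  have hL := hB N (by omega)
  have hL3 : Sm (LK K) N ≤ 3 * N := by
    have : Sm (LK K) N * Real.log N ≤ (3 * N) * Real.log N := by nlinarith
    exact le_of_mul_le_mul_right this hlog
  rw [← Finset.sum_filter_add_sum_filter_not _ (fun p => p * p ≤ N)]
  have hA : ∑ p ∈ ((Finset.range (N + 1)).filter Nat.Prime).filter (fun p => p * p ≤ N), aK K p ≤ N / Real.log N := by
    have s1 : ∑ p ∈ ((Finset.range (N + 1)).filter Nat.Prime).filter (fun p => p * p ≤ N), aK K p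
        ≤ ∑ p ∈ Finset.range (Nat.sqrt N + 1), d := by
      refine le_trans (Finset.sum_le_sum (g := fun _ => d) ?_) ?_
      · intro p hp
        simp only [Finset.mem_filter] at hp
        exact aK_prime_le K hp.1.2
      · apply Finset.sum_le_sum_of_subset_of_nonneg
        · intro p hp
          simp only [Finset.mem_filter] at hp
          rw [Finset.mem_range, Nat.lt_succ_iff, Nat.le_sqrt]
          exact hp.2
        · intros; exact hd0
    rw [Finset.sum_const, Finset.card_range, nsmul_eq_mul] at s1
    refine s1.trans ?_
    rw [le_div_iff₀ hlog]
    have hs : ((Nat.sqrt N : ℕ) : ℝ) ≤ √(N:ℝ) := Real.nat_sqrt_le_real_sqrt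
    have hs1 : 1 ≤ √(N:ℝ) := by rw [Real.one_le_sqrt]; linarith
    rw [← Real.sqrt_eq_rpow] at h1
    have hss : √(N:ℝ) * √(N:ℝ) = N := Real.mul_self_sqrt (by positivity)
    have h3 : (2 * d + 1) * Real.log N ≤ √(N:ℝ) := by
      rw [one_div, inv_mul_eq_div, le_div_iff₀ (by positivity)] at h1
      linarith
    push_cast
    calc ((Nat.sqrt N : ℝ) + 1) * d * Real.log N ≤ (√(N:ℝ) + √(N:ℝ)) * d * Real.log N := by
          gcongr
      _ ≤ √(N:ℝ) * ((2 * d + 1) * Real.log N) := by nlinarith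
      _ ≤ √(N:ℝ) * √(N:ℝ) := by gcongr
      _ = N := hss
  have hC : ∑ p ∈ ((Finset.range (N + 1)).filter Nat.Prime).filter (fun p => ¬ p * p ≤ N), aK K p ≤ 6 * N / Real.log N := by
    rw [le_div_iff₀ hlog, Finset.sum_mul]
    calc _ ≤ ∑ p ∈ ((Finset.range (N + 1)).filter Nat.Prime).filter (fun p => ¬ p * p ≤ N), 2 * LK K p := by
          apply Finset.sum_le_sum
          intro p hp
          simp only [Finset.mem_filter, not_le] at hp
          have h4 := aK_log_le K hp.1.2
          have h5 : Real.log N ≤ 2 * Real.log p := by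
            rw [← Real.log_rpow (by exact_mod_cast hp.1.2.pos)]
            apply Real.log_le_log (by linarith)
            rw [Real.rpow_two, sq]
            exact_mod_cast hp.2.le
          have := aK_nonneg K p
          nlinarith
      _ ≤ ∑ p ∈ Finset.Icc 0 N, 2 * LK K p := by
          apply Finset.sum_le_sum_of_subset_of_nonneg
          · intro p hp
            simp only [Finset.mem_filter, Finset.mem_range] at hp
            simp; omega
          · intro p _ _
            have := LK_nonneg K p
            linarith
      _ ≤ 6 * N := by
          rw [← Finset.mul_sum]
          unfold Sm at hL3
          rw [Nat.floor_natCast] at hL3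
          linarith
  have : 7 * (N:ℝ) / Real.log N = N / Real.log N + 6 * N / Real.log N := by ring
  rw [this]
  exact add_le_add hA hC
end PD
end

section
open NumberField Ideal
open scoped Pointwise

namespace PD
variable {L : Type*} [Field L] [NumberField L] [IsGalois ℚ L]

lemma under_int {p : ℕ} (hp : p.Prime) (P : Ideal (𝓞 L)) [hP : P.IsPrime] (hpP : (p : 𝓞 L) ∈ P) :
    P.under ℤ = Ideal.span {(p : ℤ)} := by
  have hmax : (Ideal.span {(p : ℤ)}).IsMaximal :=
    PrincipalIdealRing.isMaximal_of_irreducible (Nat.prime_iff_prime_int.1 hp).irreducible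
  symm
  apply hmax.eq_of_le
  · exact (Ideal.IsPrime.under ℤ P).ne_top
  · rw [Ideal.span_singleton_le_iff_mem, Ideal.mem_comap]
    simpa using hpP

lemma card_under {p : ℕ} (hp : p.Prime) (P : Ideal (𝓞 L)) [hP : P.IsPrime] (hpP : (p : 𝓞 L) ∈ P) :
    Nat.card (ℤ ⧸ P.under ℤ) = p := by
  rw [under_int hp P hpP, ← Submodule.cardQuot_apply, ← Ideal.absNorm_apply]
  simp

attribute [local instance] Ideal.Quotient.field in
lemma exists_frob {p : ℕ} (hp : p.Prime) (P : Ideal (𝓞 L)) [hP : P.IsPrime] (hpP : (p : 𝓞 L) ∈ P) :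
    ∃ φ : Gal(L/ℚ), (∀ x : 𝓞 L, φ • x - x ^ p ∈ P) ∧ φ • P = P ∧
      ∀ h : Gal(L/ℚ), h • P = P → ∃ n : ℕ, ∀ x : 𝓞 L, h • x - φ ^ n • x ∈ P := by
  have hP0 : P ≠ ⊥ := by
    rintro rfl
    rw [Ideal.mem_bot] at hpP
    exact hp.ne_zero (by exact_mod_cast hpP)
  have hmaxP : P.IsMaximal := hP.isMaximal hP0
  have hfin : Finite (𝓞 L ⧸ P) := Ideal.finiteQuotientOfFreeOfNeBot P hP0
  have hmax : (P.under ℤ).IsMaximal := by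
    rw [under_int hp P hpP]
    exact PrincipalIdealRing.isMaximal_of_irreducible (Nat.prime_iff_prime_int.1 hp).irreducible
  have hcard := card_under hp P hpP
  obtain ⟨φ, hφ⟩ := IsArithFrobAt.exists_of_isInvariant ℤ Gal(L/ℚ) P
  have h1 : ∀ x : 𝓞 L, φ • x - x ^ p ∈ P := by
    intro x
    have := hφ x
    rw [hcard] at this
    exact this
  refine ⟨φ, h1, hφ.mem_stabilizer, fun h hh => ?_⟩
  have hfin' : Finite (ℤ ⧸ P.under ℤ) := Nat.finite_of_card_ne_zero (by rw [hcard]; exact hp.ne_zero)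
  have : Fintype (ℤ ⧸ P.under ℤ) := Fintype.ofFinite _
  have hc2 : Fintype.card (ℤ ⧸ P.under ℤ) = p := by rw [← Nat.card_eq_fintype_card, hcard]
  obtain ⟨n, hn⟩ := (FiniteField.bijective_frobeniusAlgEquivOfAlgebraic_pow (ℤ ⧸ P.under ℤ) (𝓞 L ⧸ P)).2
    (Ideal.Quotient.stabilizerHom P (P.under ℤ) Gal(L/ℚ) ⟨h, hh⟩)
  refine ⟨n.1, fun x => ?_⟩
  have h2 : ∀ (m : ℕ) (x : 𝓞 L), φ ^ m • x - x ^ (p ^ m) ∈ P := by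
    intro m
    induction m with
    | zero => intro x; simp
    | succ m ih =>
      intro x
      have a := ih (φ • x)
      have b : (φ • x) ^ p ^ m - (x ^ p) ^ p ^ m ∈ P := by
        rw [← Ideal.Quotient.eq, map_pow, map_pow, (Ideal.Quotient.eq).2 (h1 x)]
      rw [pow_succ, mul_smul]
      have c := P.add_mem a b
      rw [sub_add_sub_cancel, ← pow_mul, mul_comm p, ← pow_succ] at c
      exact c
  have h3 := DFunLike.congr_fun hn (Ideal.Quotient.mk P x)
  have h4 : (FiniteField.frobeniusAlgEquivOfAlgebraic (ℤ ⧸ P.under ℤ) (𝓞 L ⧸ P) ^ n.1) (Ideal.Quotient.mk P x) = (Ideal.Quotient.mk P x) ^ p ^ n.1 := by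
    rw [AlgEquiv.coe_pow, FiniteField.coe_frobeniusAlgEquivOfAlgebraic_iterate, hc2]
  have h5 : h • x - x ^ p ^ n.1 ∈ P := by
    rw [← Ideal.Quotient.eq, map_pow, ← h4]
    exact h3.symm
  have := P.sub_mem h5 (h2 n.1 x)
  simpa using this

lemma card_eq_of_pow {A : Type*} [CommRing A] [IsDomain A] [Finite A] {p : ℕ} (hp : p.Prime)
    (h0 : (p : A) = 0) (hpow : ∀ x : A, x ^ p = x) : Nat.card A = p := by
  classical
  have : Fintype A := Fintype.ofFinite _
  have hle : Nat.card A ≤ p := by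
    rw [Nat.card_eq_fintype_card, ← Finset.card_univ]
    have hdeg : (Polynomial.X ^ p - Polynomial.X : Polynomial A).natDegree = p := by
      rw [Polynomial.natDegree_sub_eq_left_of_natDegree_lt, Polynomial.natDegree_X_pow]
      rw [Polynomial.natDegree_X_pow, Polynomial.natDegree_X]
      exact hp.one_lt
    have hne : (Polynomial.X ^ p - Polynomial.X : Polynomial A) ≠ 0 := by
      intro h
      rw [h, Polynomial.natDegree_zero] at hdeg
      exact hp.ne_zero hdeg.symm
    calc (Finset.univ : Finset A).card ≤ (Polynomial.X ^ p - Polynomial.X : Polynomial A).natDegree := by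
          apply Polynomial.card_le_degree_of_subset_roots
          intro x _
          rw [Polynomial.mem_roots hne]
          simp [Polynomial.IsRoot, hpow x]
      _ = p := hdeg
  have hdvd : p ∣ Nat.card A := by
    have h1 := addOrderOf_dvd_natCard (1 : A)
    have h2 : addOrderOf (1 : A) = p := by
      apply addOrderOf_eq_prime_iff (hp := ⟨hp⟩) |>.2
      exact ⟨by simpa using h0, one_ne_zero⟩
    rwa [h2] at h1
  exact le_antisymm hle (Nat.le_of_dvd Nat.card_pos hdvd)

/-- the fixed field of a cyclic subgroup -/
noncomputable abbrev KF (g : Gal(L/ℚ)) : IntermediateField ℚ L :=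
  FixedPoints.intermediateField (Subgroup.zpowers g)

instance galKF (g : Gal(L/ℚ)) : IsGaloisGroup (Subgroup.zpowers g) (KF g) L :=
  IsGaloisGroup.subgroup Gal(L/ℚ) ℚ L _

instance galKF' (g : Gal(L/ℚ)) : IsGaloisGroup (Subgroup.zpowers g) (𝓞 (KF g)) (𝓞 L) :=
  IsGaloisGroup.of_isFractionRing (Subgroup.zpowers g) (𝓞 (KF g)) (𝓞 L) (KF g) L

lemma norm_under {p : ℕ} (hp : p.Prime) (P : Ideal (𝓞 L)) [hP : P.IsPrime] (hpP : (p : 𝓞 L) ∈ P)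
    (φ g : Gal(L/ℚ)) (hφ : ∀ x : 𝓞 L, φ • x - x ^ p ∈ P) (hg : φ ∈ Subgroup.zpowers g) :
    absNorm (P.under (𝓞 (KF g))) = p := by
  set Q := P.under (𝓞 (KF g)) with hQ
  have hQp : Q.IsPrime := Ideal.IsPrime.under _ P
  have hpQ : (p : 𝓞 (KF g)) ∈ Q := by
    rw [hQ, Ideal.mem_comap]; simpa using hpP
  have hQ0 : Q ≠ ⊥ := by
    rintro h
    rw [h, Ideal.mem_bot] at hpQ
    exact hp.ne_zero (by exact_mod_cast hpQ)
  have hfin : Finite (𝓞 (KF g) ⧸ Q) := Ideal.finiteQuotientOfFreeOfNeBot Q hQ0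
  have hpow : ∀ x : 𝓞 (KF g) ⧸ Q, x ^ p = x := by
    intro x
    obtain ⟨x, rfl⟩ := Ideal.Quotient.mk_surjective x
    rw [← map_pow, Ideal.Quotient.eq, hQ, Ideal.mem_comap]
    have h1 := hφ (algebraMap _ _ x)
    have h2 : φ • (algebraMap (𝓞 (KF g)) (𝓞 L) x) = algebraMap _ _ x := 
      smul_algebraMap (⟨φ, hg⟩ : Subgroup.zpowers g) x
    rw [h2] at h1
    rw [map_sub, map_pow]
    have := P.neg_mem h1
    simpa using this
  rw [Ideal.absNorm_apply, Submodule.cardQuot_apply]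
  exact card_eq_of_pow hp (by simpa using (Ideal.Quotient.eq_zero_iff_mem (I := Q)).2 hpQ) hpow

lemma under_inj (g : Gal(L/ℚ)) (P P' : Ideal (𝓞 L)) [P.IsPrime] [P'.IsPrime]
    (h : P.under (𝓞 (KF g)) = P'.under (𝓞 (KF g))) (hg : g • P = P) : P = P' := by
  obtain ⟨h', hh'⟩ := Algebra.IsInvariant.exists_smul_of_under_eq (𝓞 (KF g)) (𝓞 L) (Subgroup.zpowers g) P P' h
  rw [hh']
  have : Subgroup.zpowers g ≤ MulAction.stabilizer Gal(L/ℚ) P := by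
    rw [Subgroup.zpowers_le]; exact hg
  exact (this h'.2).symm
end PD
end

section
open NumberField Ideal
open scoped Pointwise

namespace PD

lemma card_generators {G : Type*} [Group G] [Fintype G] [DecidableEq G] (h2 : IsPGroup 2 G) (φ : G) 
    [DecidablePred fun g : G => Subgroup.zpowers g = Subgroup.zpowers φ] :
    Nat.card (Subgroup.zpowers φ) ≤
      2 * (Finset.univ.filter (fun g : G => Subgroup.zpowers g = Subgroup.zpowers φ)).card := by
  classical
  obtain ⟨m, hm⟩ := IsPGroup.iff_card.1 (h2.to_subgroup (Subgroup.zpowers φ))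
  have h1 := IsCyclic.card_orderOf_eq_totient (α := Subgroup.zpowers φ) (d := 2 ^ m)
    (by rw [← Nat.card_eq_fintype_card, hm])
  have h3 : (Finset.univ.filter (fun a : Subgroup.zpowers φ => orderOf a = 2 ^ m)).card ≤
      (Finset.univ.filter (fun g : G => Subgroup.zpowers g = Subgroup.zpowers φ)).card := by
    apply Finset.card_le_card_of_injOn (fun a : Subgroup.zpowers φ => (a : G))
    · intro a ha
      simp only [Finset.coe_filter, Finset.mem_univ, true_and, Set.mem_ofPred_eq] at ha ⊢
      apply Subgroup.eq_of_le_of_card_ge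
      · rw [Subgroup.zpowers_le]; exact a.2
      · rw [hm, Nat.card_zpowers, Subgroup.orderOf_coe, ha]
    · intro a _ b _ h
      exact Subtype.ext h
  rw [h1] at h3
  rw [hm]
  have : 2 ^ m ≤ 2 * Nat.totient (2 ^ m) := by
    rcases m with _ | m
    · simp
    · rw [Nat.totient_prime_pow_succ Nat.prime_two, pow_succ]; simp; omega
  omega

variable {L : Type*} [Field L] [NumberField L] [IsGalois ℚ L]

lemma stab_eq {p : ℕ} (hp : p.Prime) (P : Ideal (𝓞 L)) [hP : P.IsPrime] (hpP : (p : 𝓞 L) ∈ P)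
    (F : Polynomial ℤ) (R : Finset (𝓞 L))
    (hF : F.map (algebraMap ℤ (𝓞 L)) = ∏ α ∈ R, (Polynomial.X - Polynomial.C α))
    (hRG : ∀ g : Gal(L/ℚ), ∀ α ∈ R, g • α ∈ R)
    (hfaith : ∀ g : Gal(L/ℚ), (∀ α ∈ R, g • α = α) → g = 1)
    (hdist : ∀ α ∈ R, ∀ β ∈ R, α - β ∈ P → α = β)
    (hroot : ∃ a : ℤ, (p : ℤ) ∣ F.eval a) :
    ∃ φ : Gal(L/ℚ), (∀ x : 𝓞 L, φ • x - x ^ p ∈ P) ∧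
      MulAction.stabilizer Gal(L/ℚ) P = Subgroup.zpowers φ ∧ ∃ α ∈ R, φ • α = α := by
  obtain ⟨φ, h1, h2, h3⟩ := exists_frob hp P hpP
  refine ⟨φ, h1, ?_, ?_⟩
  · apply le_antisymm
    · intro h hh
      obtain ⟨n, hn⟩ := h3 h hh
      have : (φ ^ n)⁻¹ * h = 1 := by
        apply hfaith
        intro α hα
        rw [mul_smul, inv_smul_eq_iff]
        exact hdist _ (hRG _ _ hα) _ (hRG _ _ hα) (hn α)
      rw [inv_mul_eq_one] at this
      rw [← this]
      exact Subgroup.pow_mem _ (Subgroup.mem_zpowers φ) n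
    · rw [Subgroup.zpowers_le]; exact h2
  · obtain ⟨a, ha⟩ := hroot
    have e1 : (algebraMap ℤ (𝓞 L) (F.eval a)) = ∏ α ∈ R, ((a : 𝓞 L) - α) := by
      have := congrArg (Polynomial.eval (algebraMap ℤ (𝓞 L) a)) hF
      rw [Polynomial.eval_map_algebraMap, Polynomial.aeval_algebraMap_apply, Polynomial.eval_prod] at this
      simpa using this
    have e2 : ∏ α ∈ R, ((a : 𝓞 L) - α) ∈ P := by
      rw [← e1]
      obtain ⟨c, hc⟩ := ha
      rw [hc]
      simp only [map_mul, map_natCast]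
      exact P.mul_mem_right _ hpP
    rw [hP.prod_mem_iff] at e2
    obtain ⟨α, hα, haα⟩ := e2
    refine ⟨α, hα, hdist _ (hRG _ _ hα) _ hα ?_⟩
    have i1 := h1 α
    have i2 := h1 (a : 𝓞 L)
    have i3 : φ • (a : 𝓞 L) = a := smul_algebraMap φ a
    rw [i3] at i2
    have i4 : (Ideal.Quotient.mk P (a : 𝓞 L)) = Ideal.Quotient.mk P α := Ideal.Quotient.eq.2 haα
    rw [← Ideal.Quotient.eq] at i1 i2 ⊢
    rw [i1, map_pow, ← i4, ← map_pow, i2]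

theorem frob_bound (h2 : IsPGroup 2 Gal(L/ℚ)) {p : ℕ} (hp : p.Prime) 
    (F : Polynomial ℤ) (R : Finset (𝓞 L))
    (hF : F.map (algebraMap ℤ (𝓞 L)) = ∏ α ∈ R, (Polynomial.X - Polynomial.C α))
    (hRG : ∀ g : Gal(L/ℚ), ∀ α ∈ R, g • α ∈ R)
    (hfaith : ∀ g : Gal(L/ℚ), (∀ α ∈ R, g • α = α) → g = 1)
    (hdist : ∀ P : Ideal (𝓞 L), P.IsPrime → (p : 𝓞 L) ∈ P → ∀ α ∈ R, ∀ β ∈ R, α - β ∈ P → α = β)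
    (hroot : ∃ a : ℤ, (p : ℤ) ∣ F.eval a) (S : Finset Gal(L/ℚ))
    (hS : ∀ g : Gal(L/ℚ), g ∈ S ↔ ∃ α ∈ R, g • α = α) :
    (Nat.card Gal(L/ℚ) : ℝ) ≤ 2 * ∑ g ∈ S, aK (KF g) p := by
  classical
  have hnt : Ideal.span {(p : 𝓞 L)} ≠ ⊤ := by
    intro h
    have := norm_span_nat L p
    rw [h, absNorm_top] at this
    have h1 := Nat.one_lt_pow (Module.finrank_pos (R := ℤ) (M := 𝓞 L)).ne' hp.one_lt
    omega
  obtain ⟨P0, hP0m, hP0⟩ := Ideal.exists_le_maximal _ hnt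
  have hP0p : P0.IsPrime := hP0m.isPrime
  rw [Ideal.span_singleton_le_iff_mem] at hP0
  set O : Finset (Ideal (𝓞 L)) := Finset.univ.image (fun g : Gal(L/ℚ) => g • P0) with hO
  have hOp : ∀ P ∈ O, P.IsPrime ∧ (p : 𝓞 L) ∈ P ∧ Nat.card (MulAction.stabilizer Gal(L/ℚ) P) = Nat.card (MulAction.stabilizer Gal(L/ℚ) P0) := by
    intro P hP
    simp only [hO, Finset.mem_image, Finset.mem_univ, true_and] at hP
    obtain ⟨g, rfl⟩ := hP
    refine ⟨hP0p.smul g, ?_, ?_⟩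
    · have : g • (p : 𝓞 L) = p := by 
        have := smul_algebraMap g (p : ℤ) (A := 𝓞 L)
        simpa using this
      rw [← this]
      exact Ideal.smul_mem_pointwise_smul _ _ _ hP0
    · rw [MulAction.stabilizer_smul_eq_stabilizer_map_conj]
      exact (Nat.card_congr (Subgroup.equivMapOfInjective _ _ (MulEquiv.injective _)).toEquiv).symm
  have hφ : ∀ P ∈ O, ∃ φ : Gal(L/ℚ), (∀ x : 𝓞 L, φ • x - x ^ p ∈ P) ∧
      MulAction.stabilizer Gal(L/ℚ) P = Subgroup.zpowers φ ∧ ∃ α ∈ R, φ • α = α := by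
    intro P hP
    have := (hOp P hP).1
    exact stab_eq hp P (hOp P hP).2.1 F R hF hRG hfaith (hdist P this (hOp P hP).2.1) hroot
  set gen : Ideal (𝓞 L) → Finset Gal(L/ℚ) := fun P => Finset.univ.filter (fun g => Subgroup.zpowers g = MulAction.stabilizer Gal(L/ℚ) P) with hgen
  have hcount : (O.sigma gen).card ≤ (S.sigma (fun g => idN (KF g) p)).card := by
    refine Finset.card_le_card_of_injOn (fun x => ⟨x.2, x.1.under (𝓞 (KF x.2))⟩) ?_ ?_
    · rintro ⟨P, g⟩ hx
      simp only [Finset.coe_sigma, Set.mem_sigma_iff, Finset.mem_coe, hgen, Finset.mem_filter, Finset.mem_univ, true_and] at hx ⊢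
      obtain ⟨φ, e1, e2, α, hα, e3⟩ := hφ P hx.1
      rw [e2] at hx
      have := (hOp P hx.1).1
      refine ⟨?_, ?_⟩
      · rw [hS]
        refine ⟨α, hα, ?_⟩
        have i1 : φ ∈ MulAction.stabilizer Gal(L/ℚ) α := e3
        rw [← Subgroup.zpowers_le, ← hx.2, Subgroup.zpowers_le] at i1
        exact i1
      · rw [mem_idN]
        refine ⟨hp.ne_zero, norm_under hp P (hOp P hx.1).2.1 φ g e1 ?_⟩
        rw [hx.2]; exact Subgroup.mem_zpowers φ
    · rintro ⟨P, g⟩ hx ⟨P', g'⟩ hx' h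
      simp only [Finset.coe_sigma, Set.mem_sigma_iff, Finset.mem_coe, hgen, Finset.mem_filter, Finset.mem_univ, true_and] at hx hx'
      simp only [Sigma.mk.injEq] at h
      obtain ⟨rfl, h⟩ := h
      rw [heq_eq_eq] at h
      have := (hOp P hx.1).1
      have := (hOp P' hx'.1).1
      have hs : g • P = P := by
        have : g ∈ MulAction.stabilizer Gal(L/ℚ) P := by rw [← hx.2]; exact Subgroup.mem_zpowers g
        exact this
      rw [under_inj g P P' h hs]
  rw [Finset.card_sigma, Finset.card_sigma] at hcount
  have hgenc : ∀ P ∈ O, Nat.card (MulAction.stabilizer Gal(L/ℚ) P0) ≤ 2 * (gen P).card := by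
    intro P hP
    obtain ⟨φ, e1, e2, -⟩ := hφ P hP
    rw [← (hOp P hP).2.2, hgen]
    simp only [e2]
    exact card_generators h2 φ
  have hOc : O.card * Nat.card (MulAction.stabilizer Gal(L/ℚ) P0) = Nat.card Gal(L/ℚ) := by
    have : Fintype (MulAction.orbit Gal(L/ℚ) P0) := (Set.finite_range (fun g : Gal(L/ℚ) => g • P0)).fintype
    have := MulAction.card_orbit_mul_card_stabilizer_eq_card_group Gal(L/ℚ) P0
    rw [Nat.card_eq_fintype_card, Nat.card_eq_fintype_card, ← this]
    congr 1
    rw [← Set.toFinset_card]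
    congr 1
    ext P
    simp [hO, MulAction.mem_orbit_iff]
  have hfin : Nat.card Gal(L/ℚ) ≤ 2 * ∑ g ∈ S, (idN (KF g) p).card := by
    rw [← hOc]
    calc _ = ∑ P ∈ O, Nat.card (MulAction.stabilizer Gal(L/ℚ) P0) := by rw [Finset.sum_const, smul_eq_mul]
      _ ≤ ∑ P ∈ O, 2 * (gen P).card := Finset.sum_le_sum hgenc
      _ ≤ _ := by rw [← Finset.mul_sum]; omega
  simp_rw [aK_apply]
  exact_mod_cast hfin
end PD
end

section
open NumberField Ideal
open scoped Pointwise

namespace PD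
variable {L : Type*} [Field L] [NumberField L] [IsGalois ℚ L]

lemma good_primes (R : Finset (𝓞 L)) : ∃ m : ℕ, ∀ p : ℕ, p.Prime → m < p →
    ∀ P : Ideal (𝓞 L), P.IsPrime → (p : 𝓞 L) ∈ P → ∀ α ∈ R, ∀ β ∈ R, α - β ∈ P → α = β := by
  classical
  set Δ : 𝓞 L := ∏ x ∈ R.offDiag, (x.1 - x.2) with hΔ
  have hΔ0 : Δ ≠ 0 := by
    rw [hΔ, Finset.prod_ne_zero_iff]
    rintro ⟨a, b⟩ hx
    rw [Finset.mem_offDiag] at hx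
    exact sub_ne_zero.2 hx.2.2
  refine ⟨absNorm (Ideal.span {Δ}), fun p hp hm P hP hpP α hα β hβ h => ?_⟩
  by_contra hne
  have h1 : Δ ∈ P := by
    rw [hΔ, hP.prod_mem_iff]
    exact ⟨(α, β), by simp [hα, hβ, hne], h⟩
  have h2 : ((absNorm (Ideal.span {Δ}) : ℕ) : 𝓞 L) ∈ P :=
    (Ideal.span_singleton_le_iff_mem P).2 h1 (Ideal.absNorm_mem _)
  have h3 : absNorm (Ideal.span {Δ}) ≠ 0 := by
    rw [Ne, absNorm_eq_zero_iff, Ideal.span_singleton_eq_bot]; exact hΔ0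
  have hc : Nat.Coprime p (absNorm (Ideal.span {Δ})) := by
    rw [Nat.Prime.coprime_iff_not_dvd hp]
    intro h
    have := Nat.le_of_dvd (Nat.pos_of_ne_zero h3) h
    omega
  have h4 : IsCoprime ((p : 𝓞 L)) ((absNorm (Ideal.span {Δ}) : ℕ) : 𝓞 L) := by
    have := (Nat.isCoprime_iff_coprime.2 hc).map (Int.castRingHom (𝓞 L))
    simpa using this
  obtain ⟨a, b, hab⟩ := h4
  apply hP.ne_top
  rw [Ideal.eq_top_iff_one, ← hab]
  exact P.add_mem (P.mul_mem_left _ hpP) (P.mul_mem_left _ h2)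

open scoped Classical in
theorem count_bound (h2 : IsPGroup 2 Gal(L/ℚ))
    (F : Polynomial ℤ) (R : Finset (𝓞 L))
    (hF : F.map (algebraMap ℤ (𝓞 L)) = ∏ α ∈ R, (Polynomial.X - Polynomial.C α))
    (hRG : ∀ g : Gal(L/ℚ), ∀ α ∈ R, g • α ∈ R)
    (hfaith : ∀ g : Gal(L/ℚ), (∀ α ∈ R, g • α = α) → g = 1)
    (S : Finset Gal(L/ℚ))
    (hS : ∀ g : Gal(L/ℚ), g ∈ S ↔ ∃ α ∈ R, g • α = α) :
    ∃ m N₀ : ℕ, ∀ N : ℕ, N₀ ≤ N →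
      (Nat.card Gal(L/ℚ) : ℝ) * ((Finset.range (N + 1)).filter
        (fun p : ℕ => p.Prime ∧ ∃ a : ℤ, (p : ℤ) ∣ F.eval a)).card ≤
      m + 14 * S.card * (N / Real.log N) := by
  obtain ⟨m, hm⟩ := good_primes R
  choose N₁ hN₁ using fun g : Gal(L/ℚ) => sum_aK_primes (KF g)
  refine ⟨Nat.card Gal(L/ℚ) * (m + 1), Finset.univ.sup N₁, fun N hN => ?_⟩
  set A := (Finset.range (N + 1)).filter (fun p : ℕ => p.Prime ∧ ∃ a : ℤ, (p : ℤ) ∣ F.eval a) with hA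
  have hA1 : A.card ≤ (m + 1) + (A.filter (fun p => m < p)).card := by
    rw [← Finset.card_filter_add_card_filter_not (s := A) (fun p => m < p), add_comm]
    gcongr
    calc _ ≤ (Finset.range (m + 1)).card := by
          apply Finset.card_le_card
          intro p hp
          simp at hp ⊢
          omega
      _ = _ := Finset.card_range _
  have hsum : (Nat.card Gal(L/ℚ) : ℝ) * (A.filter (fun p => m < p)).card ≤ 14 * S.card * (N / Real.log N) := by
    calc (Nat.card Gal(L/ℚ) : ℝ) * (A.filter (fun p => m < p)).card
        = ∑ p ∈ A.filter (fun p => m < p), (Nat.card Gal(L/ℚ) : ℝ) := by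
          rw [Finset.sum_const, nsmul_eq_mul, mul_comm]
      _ ≤ ∑ p ∈ A.filter (fun p => m < p), 2 * ∑ g ∈ S, aK (KF g) p := by
          apply Finset.sum_le_sum
          intro p hp
          simp only [hA, Finset.mem_filter] at hp
          exact frob_bound h2 hp.1.2.1 F R hF hRG hfaith (hm p hp.1.2.1 hp.2) hp.1.2.2 S hS
      _ ≤ ∑ p ∈ (Finset.range (N + 1)).filter Nat.Prime, 2 * ∑ g ∈ S, aK (KF g) p := by
          apply Finset.sum_le_sum_of_subset_of_nonneg
          · intro p hp
            simp only [hA, Finset.mem_filter] at hp ⊢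
            exact ⟨hp.1.1, hp.1.2.1⟩
          · intro p _ _
            have := Finset.sum_nonneg (fun g (_ : g ∈ S) => aK_nonneg (KF g) p)
            linarith
      _ = 2 * ∑ g ∈ S, ∑ p ∈ (Finset.range (N + 1)).filter Nat.Prime, aK (KF g) p := by
          rw [← Finset.mul_sum, Finset.sum_comm]
      _ ≤ 2 * ∑ g ∈ S, 7 * N / Real.log N := by
          gcongr with g hg
          exact hN₁ g N (le_trans (Finset.le_sup (Finset.mem_univ g)) hN)
      _ = _ := by
          rw [Finset.sum_const, nsmul_eq_mul]; ring
  have hA2 : (A.card : ℝ) ≤ (m + 1) + (A.filter (fun p => m < p)).card := by exact_mod_cast hA1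
  push_cast
  calc _ ≤ (Nat.card Gal(L/ℚ) : ℝ) * ((m + 1) + (A.filter (fun p => m < p)).card) := by gcongr
    _ ≤ _ := by rw [mul_add]; linarith
end PD
end

section
namespace PD
section ext
variable {G X : Type*} [Group G] [Fintype G] [DecidableEq G] [MulAction G X] [DecidableEq X]

lemma burnside_one (R : Finset X) (hst : ∀ g : G, ∀ x ∈ R, g • x ∈ R)
    (htr : ∀ x ∈ R, ∀ y ∈ R, ∃ g : G, g • x = y) (hne : R.Nonempty) :
    ∑ g : G, (R.filter (fun x => g • x = x)).card = Fintype.card G := by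
  obtain ⟨x0, hx0⟩ := hne
  simp_rw [Finset.card_filter]
  rw [Finset.sum_comm]
  have h1 : ∀ x ∈ R, (∑ g : G, if g • x = x then 1 else 0) = (Finset.univ.filter (fun g : G => g • x0 = x)).card := by
    intro x hx
    rw [← Finset.card_filter]
    obtain ⟨t, ht⟩ := htr x0 hx0 x hx
    apply Finset.card_bij (fun g _ => g * t)
    · intro g hg
      simp at hg ⊢
      rw [mul_smul, ht, hg]
    · intro a _ b _ h
      simpa using h
    · intro b hb
      simp at hb
      refine ⟨b * t⁻¹, ?_, by simp⟩
      simp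
      rw [mul_smul, ← ht, inv_smul_smul, hb, ht]
  rw [Finset.sum_congr rfl h1, ← Finset.card_univ]
  exact (Finset.card_eq_sum_card_fiberwise (f := fun g : G => g • x0) (s := Finset.univ) (t := R)
    (fun g _ => hst g x0 hx0)).symm

lemma ext_step (R R' : Finset X) (π ι : X → X)
    (hπ : ∀ (g : G) (x : X), π (g • x) = g • π x) (hπR : ∀ x ∈ R', π x ∈ R)
    (hι : ∀ x ∈ R', ∀ y ∈ R', π x = π y → y = x ∨ y = ι x) (hιne : ∀ x ∈ R', ι x ≠ x)
    (hmax : ∀ A : Finset X, ∃ h : G, (∀ x ∈ R, h • x = x) ∧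
      ∀ x ∈ R', h • x = if π x ∈ A then ι x else x) (T : ℕ) :
    (Finset.univ.filter (fun g : G => 0 < (R.filter (fun x => g • x = x)).card ∧
      (R.filter (fun x => g • x = x)).card ≤ T)).card ≤ 2 ^ T *
    (Finset.univ.filter (fun g : G => (∃ x ∈ R, g • x = x) ∧ ∀ x ∈ R', g • x ≠ x)).card := by
  choose h hh1 hh2 using hmax
  set A : G → Finset X := fun g => R.filter (fun v => g • v = v ∧ ∃ x ∈ R', π x = v ∧ g • x = x) with hA
  have hfix : ∀ g : G, ∀ x ∈ R, ∀ B, (g * h B) • x = g • x := by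
    intro g x hx B
    rw [mul_smul, hh1 B x hx]
  apply Finset.card_le_mul_card_image_of_maps_to (f := fun g => g * h (A g))
  · intro g hg
    simp only [Finset.mem_filter, Finset.mem_univ, true_and, Finset.card_pos] at hg ⊢
    obtain ⟨⟨x, hx⟩, -⟩ := hg
    rw [Finset.mem_filter] at hx
    refine ⟨⟨x, hx.1, by rw [hfix g x hx.1]; exact hx.2⟩, ?_⟩
    intro x hx hgx
    have hv : g • π x = π x := by
      rw [← hfix g _ (hπR x hx) (A g), ← hπ, hgx]
    rw [mul_smul, hh2 (A g) x hx] at hgx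
    split_ifs at hgx with hmem
    · simp only [hA, Finset.mem_filter] at hmem
      obtain ⟨_, _, y, hy, hyx, hgy⟩ := hmem
      rcases hι x hx y hy hyx.symm with rfl | rfl
      · have := hgx.trans hgy.symm
        exact hιne _ hx (MulAction.injective g this)
      · exact hιne x hx (hgy.symm.trans hgx)
    · apply hmem
      simp only [hA, Finset.mem_filter]
      exact ⟨hπR x hx, hv, x, hx, rfl, hgx⟩
  · intro g' _
    set Fg := R.filter (fun x => g' • x = x) with hFg
    by_cases hc : Fg.card ≤ T
    · calc _ ≤ Fg.powerset.card := by
            apply Finset.card_le_card_of_injOn A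
            · intro g hg
              simp only [Finset.coe_filter, Finset.mem_filter, Finset.mem_univ, true_and, Set.mem_ofPred_eq] at hg
              rw [Finset.mem_coe, Finset.mem_powerset]
              intro v hv
              simp only [hA, Finset.mem_filter] at hv
              rw [hFg, Finset.mem_filter, ← hg.2, hfix g v hv.1]
              exact ⟨hv.1, hv.2.1⟩
            · intro g hg g2 hg2 hgg
              simp only [Finset.coe_filter, Finset.mem_filter, Finset.mem_univ, true_and, Set.mem_ofPred_eq] at hg hg2
              have := hg.2.trans hg2.2.symm
              rw [hgg] at this
              exact mul_right_cancel this
        _ ≤ 2 ^ T := by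
            rw [Finset.card_powerset]
            exact Nat.pow_le_pow_right (by norm_num) hc
    · rw [Finset.card_eq_zero.2]
      · positivity
      · rw [Finset.filter_eq_empty_iff]
        intro g hg hgg
        simp only [Finset.mem_filter, Finset.mem_univ, true_and] at hg
        apply hc
        refine le_trans (le_of_eq ?_) hg.2
        congr 1
        apply Finset.filter_congr
        intro x hx
        rw [← hgg, hfix g x hx]

theorem ext_bound (R : ℕ → Finset X) (π ι : X → X) (M : ℕ)
    (hst : ∀ n ≤ M, ∀ g : G, ∀ x ∈ R n, g • x ∈ R n)
    (htr : ∀ n ≤ M, ∀ x ∈ R n, ∀ y ∈ R n, ∃ g : G, g • x = y) (hne : ∀ n ≤ M, (R n).Nonempty)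
    (hπ : ∀ (g : G) (x : X), π (g • x) = g • π x) (hπR : ∀ n < M, ∀ x ∈ R (n + 1), π x ∈ R n)
    (hι : ∀ n < M, ∀ x ∈ R (n + 1), ∀ y ∈ R (n + 1), π x = π y → y = x ∨ y = ι x)
    (hιne : ∀ n < M, ∀ x ∈ R (n + 1), ι x ≠ x)
    (lev : Finset ℕ) (hlev : ∀ n ∈ lev, n < M ∧ ∀ A : Finset X, ∃ h : G, (∀ x ∈ R n, h • x = x) ∧
      ∀ x ∈ R (n + 1), h • x = if π x ∈ A then ι x else x) (T : ℕ) :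
    lev.card * ((T + 1) * (Finset.univ.filter (fun g : G => ∃ x ∈ R M, g • x = x)).card) ≤
      (T + 1) * 2 ^ T * Fintype.card G + lev.card * Fintype.card G := by
  let E : ℕ → Finset G := fun n : ℕ => Finset.univ.filter
    (fun g : G => (∃ x ∈ R n, g • x = x) ∧ ∀ x ∈ R (Nat.succ n), g • x ≠ x)
  have hE : E = fun n : ℕ => Finset.univ.filter
    (fun g : G => (∃ x ∈ R n, g • x = x) ∧ ∀ x ∈ R (Nat.succ n), g • x ≠ x) := rfl
  have hdesc : ∀ (g : G) (m n : ℕ), m ≤ n → n ≤ M → (∃ x ∈ R n, g • x = x) → ∃ x ∈ R m, g • x = x := by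
    intro g m n hmn
    induction n, hmn using Nat.le_induction with
    | base => intro _ h; exact h
    | succ n hmn ih =>
      rintro hn ⟨x, hx, hgx⟩
      exact ih (by omega) ⟨π x, hπR n (by omega) x hx, by rw [← hπ, hgx]⟩
  have hdisj : ∑ n ∈ lev, (E n).card ≤ Fintype.card G := by
    rw [← Finset.card_biUnion]
    · exact Finset.card_le_univ _
    · have key : ∀ n ∈ lev, ∀ m ∈ lev, n < m → Disjoint (E n) (E m) := by
        intro n hn m hm hnm
        rw [Finset.disjoint_left]
        intro g hg hg'
        simp only [hE, Finset.mem_filter, Finset.mem_univ, true_and] at hg hg'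
        obtain ⟨x, hx, hgx⟩ := hdesc g (n + 1) m hnm (hlev m hm).1.le hg'.1
        exact hg.2 x hx hgx
      intro n hn m hm hnm
      rcases lt_or_gt_of_ne hnm with h | h
      · exact key n hn m hm h
      · exact (key m hm n hn h).symm
  have hone : ∀ n ∈ lev, (T + 1) * (Finset.univ.filter (fun g : G => ∃ x ∈ R M, g • x = x)).card ≤
      (T + 1) * (2 ^ T * (E n).card) + Fintype.card G := by
    intro n hn
    obtain ⟨hnM, hmax⟩ := hlev n hn
    have s1 := ext_step (R n) (R (n + 1)) π ι hπ (hπR n hnM) (hι n hnM) (hιne n hnM) hmax T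
    have s2 : (T + 1) * (Finset.univ.filter (fun g : G => T < ((R n).filter (fun x => g • x = x)).card)).card ≤ Fintype.card G := by
      rw [← burnside_one (R n) (hst n hnM.le) (htr n hnM.le) (hne n hnM.le)]
      calc _ = ∑ g ∈ (Finset.univ.filter (fun g : G => T < ((R n).filter (fun x => g • x = x)).card)), (T + 1) := by
            rw [Finset.sum_const, smul_eq_mul, mul_comm]
        _ ≤ ∑ g ∈ (Finset.univ.filter (fun g : G => T < ((R n).filter (fun x => g • x = x)).card)), ((R n).filter (fun x => g • x = x)).card := by
            apply Finset.sum_le_sum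
            intro g hg
            simp only [Finset.mem_filter, Finset.mem_univ, true_and] at hg
            exact hg
        _ ≤ _ := Finset.sum_le_sum_of_subset (Finset.subset_univ _)
    have s3 : (Finset.univ.filter (fun g : G => ∃ x ∈ R M, g • x = x)).card ≤
        (Finset.univ.filter (fun g : G => 0 < ((R n).filter (fun x => g • x = x)).card ∧
      ((R n).filter (fun x => g • x = x)).card ≤ T)).card + (Finset.univ.filter (fun g : G => T < ((R n).filter (fun x => g • x = x)).card)).card := by
      refine le_trans (Finset.card_le_card ?_) (Finset.card_union_le _ _)
      intro g hg
      simp only [Finset.mem_filter, Finset.mem_univ, true_and, Finset.mem_union] at hg ⊢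
      obtain ⟨x, hx, hgx⟩ := hdesc g n M hnM.le le_rfl hg
      have : 0 < ((R n).filter (fun x => g • x = x)).card :=
        Finset.card_pos.2 ⟨x, Finset.mem_filter.2 ⟨hx, hgx⟩⟩
      omega
    calc _ ≤ (T + 1) * (_ + _) := Nat.mul_le_mul_left _ s3
      _ ≤ _ := by
        rw [mul_add]
        exact add_le_add (Nat.mul_le_mul_left _ s1) s2
  calc _ = ∑ n ∈ lev, (T + 1) * (Finset.univ.filter (fun g : G => ∃ x ∈ R M, g • x = x)).card := by
        rw [Finset.sum_const, smul_eq_mul]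
    _ ≤ ∑ n ∈ lev, ((T + 1) * (2 ^ T * (E n).card) + Fintype.card G) := Finset.sum_le_sum hone
    _ = (T + 1) * 2 ^ T * (∑ n ∈ lev, (E n).card) + lev.card * Fintype.card G := by
        rw [Finset.sum_add_distrib, Finset.sum_const, smul_eq_mul, ← Finset.mul_sum, ← Finset.mul_sum, mul_assoc]
    _ ≤ _ := by gcongr
end ext
end PD
end

section
namespace PD

/-- `Bs k m = 2^(2^m) * f^m(-k/2)`. -/
def Bs (k : ℤ) : ℕ → ℤ
  | 0 => -k
  | n + 1 => (Bs k n) ^ 2 + 2 ^ (2 ^ n) * k * Bs k n - 2 ^ (2 ^ (n + 1))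

lemma two_pow_two_pow_succ (n : ℕ) : (2 : ℤ) ^ (2 ^ (n + 1)) = (2 ^ (2 ^ n)) ^ 2 := by
  rw [← pow_mul, pow_succ 2 n]

lemma Bs_succ (k : ℤ) (n : ℕ) :
    Bs k (n + 1) = (Bs k n) ^ 2 + 2 ^ (2 ^ n) * k * Bs k n - (2 ^ (2 ^ n)) ^ 2 := by
  rw [← two_pow_two_pow_succ]; rfl

/-- even case: `f^m(-l)` with `k = 2 l`. -/
def bE (l : ℤ) : ℕ → ℤ
  | 0 => -l
  | n + 1 => (bE l n) ^ 2 + 2 * l * bE l n - 1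

lemma Bs_even (l : ℤ) (n : ℕ) : Bs (2 * l) n = 2 ^ (2 ^ n) * bE l n := by
  induction n with
  | zero => simp [Bs, bE]
  | succ n ih => rw [Bs_succ, ih, two_pow_two_pow_succ, bE]; ring

lemma bE_one (l : ℤ) : bE l 1 = - l ^ 2 - 1 := by simp [bE]; ring
lemma bE_two (l : ℤ) : bE l 2 = (l ^ 2 + 1) * (l - 1) ^ 2 - 1 := by
  rw [bE, bE_one]; ring

lemma bE_lower_pos (l : ℤ) (hl : 2 ≤ l) (n : ℕ) : l ^ 2 ≤ bE l (n + 2) := by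
  induction n with
  | zero => rw [bE_two]; nlinarith [mul_nonneg (sub_nonneg.2 hl) (by linarith : 0 ≤ l), mul_nonneg (by nlinarith : 0 ≤ l^2+1) (by nlinarith : 0 ≤ (l-1)^2-1)]
  | succ n ih =>
    rw [show n + 1 + 2 = (n + 2) + 1 by ring, bE]
    nlinarith

lemma bE_lower_neg (a : ℤ) (ha : 1 ≤ a) (n : ℕ) : a ^ 2 + 2 * a + 3 ≤ bE (-a) (n + 2) := by
  induction n with
  | zero => 
    rw [bE_two]
    nlinarith [mul_nonneg (by linarith : 0 ≤ a - 1) (by linarith : 0 ≤ a), pow_pos (by linarith : 0 < a) 3, mul_nonneg (by linarith : 0 ≤ a - 1) (by positivity : 0 ≤ a^2), mul_nonneg (by linarith : 0 ≤ a - 1) (by positivity : 0 ≤ a^3)]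
  | succ n ih =>
    rw [show n + 1 + 2 = (n + 2) + 1 by ring, bE]
    nlinarith

lemma bE_pos (l : ℤ) (h0 : l ≠ 0) (h1 : l ≠ 1) (n : ℕ) : 0 < bE l (n + 2) := by
  rcases lt_or_gt_of_ne h0 with h | h
  · have := bE_lower_neg (-l) (by omega) n
    rw [neg_neg] at this; nlinarith
  · have := bE_lower_pos l (by omega) n
    nlinarith

lemma not_sq_aux (c e s : ℤ) (he : 0 < e) (h : e + 1 < 2 * |c|) (hs : c ^ 2 - e = s ^ 2) : False := by
  rw [← sq_abs c, ← sq_abs s] at hs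
  have h1 := abs_nonneg c
  have h2 := abs_nonneg s
  have h3 : |s| < |c| := by nlinarith
  nlinarith

lemma bE_nonsq (l : ℤ) (h0 : l ≠ 0) (h1 : l ≠ 1) (n : ℕ) (hn : l = 2 → n ≠ 0) :
    ¬ IsSquare (bE l (n + 2)) := by
  rintro ⟨s, hs⟩
  refine not_sq_aux (bE l (n + 1) + l) (l ^ 2 + 1) s (by positivity) ?_ ?_
  · rcases n with _ | n
    · rw [zero_add, bE_one]
      have hl2 : l ≠ 2 := fun h => hn h rfl
      have : (-(l ^ 2) - 1 + l) < 0 := by nlinarith [sq_nonneg (l - 1)]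
      rw [abs_of_neg this]
      rcases lt_or_gt_of_ne h0 with h | h
      · nlinarith
      · have : 3 ≤ l := by omega
        nlinarith
    · refine lt_of_lt_of_le ?_ (mul_le_mul_of_nonneg_left (le_abs_self _) (by norm_num))
      rcases lt_or_gt_of_ne h0 with h | h
      · have := bE_lower_neg (-l) (by omega) n
        rw [neg_neg] at this
        rw [show n + 1 + 1 = n + 2 by ring]; nlinarith
      · have := bE_lower_pos l (by omega) n
        rw [show n + 1 + 1 = n + 2 by ring]; nlinarith
  · rw [show n + 2 = (n + 1) + 1 by ring, bE] at hs
    nlinarith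

lemma isSquare_two_pow_mul {n : ℕ} {b : ℤ} (h : IsSquare ((2:ℤ) ^ (2 ^ (n + 1)) * b)) : IsSquare b := by
  rw [two_pow_two_pow_succ] at h
  obtain ⟨s, hs⟩ := h
  have h2 : (2:ℤ) ^ (2 ^ n) ∣ s := by
    rw [← Int.pow_dvd_pow_iff (n := 2) (by norm_num)]
    exact ⟨b, by linarith [sq s]⟩
  obtain ⟨t, rfl⟩ := h2
  refine ⟨t, ?_⟩
  have h3 : ((2:ℤ) ^ (2 ^ n))^2 ≠ 0 := by positivity
  apply mul_left_cancel₀ h3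
  linarith

lemma nonsq_sq_add_four (k : ℤ) (hk : k ≠ 0) : ¬ IsSquare (k ^ 2 + 4) := by
  rintro ⟨s, hs⟩
  wlog hk' : 0 < k generalizing k
  · exact this (-k) (by simpa using hk) (by linarith [neg_sq k]) (by omega)
  wlog hs' : 0 ≤ s generalizing s
  · exact this (-s) (by linarith) (by omega)
  have h1 : k < s := by nlinarith
  rcases eq_or_lt_of_le (show k + 1 ≤ s by omega) with h | h
  · subst h
    have : 2 * k = 3 := by nlinarith
    omega
  · have : k + 2 ≤ s := by omega
    nlinarith

/-- `2^(2^m - 1)` -/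
def Eh : ℕ → ℤ
  | 0 => 1
  | n + 1 => 2 * (Eh n) ^ 2

lemma Eh_eq (n : ℕ) : (2:ℤ) ^ (2 ^ n) = 2 * Eh n := by
  induction n with
  | zero => simp [Eh]
  | succ n ih => rw [two_pow_two_pow_succ, ih, Eh]; ring

lemma Eh_pos (n : ℕ) : 0 < Eh n := by
  induction n with
  | zero => simp [Eh]
  | succ n ih => rw [Eh]; positivity

def Cs (k : ℤ) (n : ℕ) : ℤ := Bs k n + Eh n * k

lemma Bs_succ_C (k : ℤ) (n : ℕ) : Bs k (n + 1) = (Cs k n) ^ 2 - (Eh n) ^ 2 * (k ^ 2 + 4) := by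
  rw [Bs_succ, Eh_eq, Cs]; ring

lemma Cs_succ (k : ℤ) (n : ℕ) :
    Cs k (n + 1) = (Cs k n) ^ 2 - (k ^ 2 - 2 * k + 4) * (Eh n) ^ 2 := by
  rw [Cs, Bs_succ_C, Eh]; ring

lemma Cs_one (k : ℤ) : Cs k 1 = - (k ^ 2 - 2 * k + 4) := by
  rw [Cs_succ]; simp [Cs, Bs, Eh]

lemma Cs_two (k : ℤ) : Cs k 2 = (k ^ 2 - 2 * k + 4) * (k ^ 2 - 2 * k) := by
  rw [Cs_succ, Cs_one]; simp [Eh]; ring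

lemma Cs_lower' (k K : ℤ) (hK : 17 ≤ K) (hμ : k ^ 2 - 2 * k + 4 ≤ 2 * K)
    (hb : 16 * K + 2 ≤ Cs k 2) (n : ℕ) :
    ∃ F : ℤ, Eh (n + 2) = 2 * F ∧ 4 ≤ F ∧ F ^ 2 * K + 2 ≤ Cs k (n + 2) := by
  induction n with
  | zero => exact ⟨4, by simp [Eh], le_rfl, by norm_num; linarith⟩
  | succ n ih =>
    obtain ⟨F, h1, h2, h3⟩ := ih
    refine ⟨4 * F ^ 2, ?_, by nlinarith, ?_⟩
    · rw [show n + 1 + 2 = (n + 2) + 1 by ring, Eh, h1]; ring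
    · rw [show n + 1 + 2 = (n + 2) + 1 by ring, Cs_succ, h1]
      have hF : 16 ≤ F ^ 2 := by nlinarith
      generalize hG : F ^ 2 = G at *
      have h4 : (G * K + 2) ^ 2 ≤ (Cs k (n + 2)) ^ 2 := by
        apply pow_le_pow_left₀ _ h3; positivity
      have h5 : (k ^ 2 - 2 * k + 4) * (2 * F) ^ 2 ≤ 8 * K * G := by
        rw [mul_pow, hG]; nlinarith
      have h6 : 17 * K ≤ K ^ 2 := by nlinarith
      have h7 : 17 * K * G ^ 2 ≤ K ^ 2 * G ^ 2 := by
        apply mul_le_mul_of_nonneg_right h6; positivity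
      have h8 : 16 * (K * G) ≤ G * (K * G) := by
        apply mul_le_mul_of_nonneg_right hF; positivity
      nlinarith

lemma sq_mod8 {k : ℤ} (hk : Odd k) : k ^ 2 % 8 = 1 := by
  have h : k % 8 = 1 ∨ k % 8 = 3 ∨ k % 8 = 5 ∨ k % 8 = 7 := by
    rw [Int.odd_iff] at hk; omega
  rcases h with h | h | h | h <;> simp [pow_two, Int.mul_emod, h]

lemma Bs_mod8_one (k : ℤ) (hk : Odd k) : Bs k 1 % 8 = 3 ∧ Bs k 2 % 8 = 5 := by
  have h1 : (k ^ 2) % 8 = 1 := sq_mod8 hk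
  have hB : Bs k 1 = - (k ^ 2 + 4) := by simp [Bs]; ring
  have h3 : Bs k 1 % 8 = 3 := by omega
  refine ⟨h3, ?_⟩
  rw [Bs_succ, show (2:ℤ) ^ (2 ^ 1) = 4 by norm_num]
  have h4 : (Bs k 1) ^ 2 % 8 = 1 := sq_mod8 (by rw [Int.odd_iff]; omega)
  have h5 : (k * Bs k 1) % 2 = 1 := by
    rw [← Int.odd_iff]; exact hk.mul (by rw [Int.odd_iff]; omega)
  have : 4 * k * Bs k 1 = 4 * (k * Bs k 1) := by ring
  omega

lemma two_pow_dvd8 (n : ℕ) : (8:ℤ) ∣ 2 ^ (2 ^ (n + 2)) := by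
  rw [show (8:ℤ) = 2 ^ 3 by norm_num]
  apply pow_dvd_pow
  calc 3 ≤ 2 ^ 2 := by norm_num
    _ ≤ 2 ^ (n + 2) := Nat.pow_le_pow_right (by norm_num) (by omega)

lemma Bs_mod8 (k : ℤ) (hk : Odd k) (n : ℕ) : Bs k (n + 3) % 8 = 1 := by
  induction n with
  | zero =>
    rw [Bs_succ]
    obtain ⟨t, ht⟩ := two_pow_dvd8 0
    simp only [zero_add] at ht ⊢
    rw [ht]
    have h4 : (Bs k 2) ^ 2 % 8 = 1 := sq_mod8 (by rw [Int.odd_iff]; have := (Bs_mod8_one k hk).2; omega)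
    have e : Bs k 2 ^ 2 + 8 * t * k * Bs k 2 - (8 * t) ^ 2 = Bs k 2 ^ 2 + 8 * (t * k * Bs k 2 - 8 * t ^ 2) := by ring
    rw [e]; omega
  | succ n ih =>
    rw [show n + 1 + 3 = (n + 3) + 1 by ring, Bs_succ]
    obtain ⟨t, ht⟩ := two_pow_dvd8 (n + 1)
    rw [show n + 1 + 2 = n + 3 by ring] at ht
    rw [ht]
    have h4 : (Bs k (n + 3)) ^ 2 % 8 = 1 := sq_mod8 (by rw [Int.odd_iff]; omega)
    have e : Bs k (n + 3) ^ 2 + 8 * t * k * Bs k (n + 3) - (8 * t) ^ 2 = Bs k (n + 3) ^ 2 + 8 * (t * k * Bs k (n + 3) - 8 * t ^ 2) := by ring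
    rw [e]; omega

lemma Cs_odd (k : ℤ) (hk : Odd k) (n : ℕ) : Odd (Cs k (n + 1)) := by
  have : Odd (Bs k (n + 1)) := by
    rw [Int.odd_iff]
    rcases n with _ | _ | n
    · have := (Bs_mod8_one k hk).1; simp only [zero_add]; omega
    · have := (Bs_mod8_one k hk).2; simp only [zero_add, Nat.reduceAdd]; omega
    · have := Bs_mod8 k hk n; rw [show n + 1 + 1 + 1 = n + 3 by ring]; omega
  rw [Cs, Eh]
  exact this.add_even ⟨Eh n ^ 2 * k, by ring⟩

lemma nonsq_big (c K F s : ℤ) (hc : Odd c) (h0 : 0 < c) (hF : 0 < F) (hK : 0 < K) (h : F ^ 2 * K + 2 ≤ c)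
    (hs : c ^ 2 - (2 * F) ^ 2 * K = s ^ 2) : False := by
  wlog hs0 : 0 ≤ s generalizing s
  · exact this (-s) (by rw [neg_sq]; exact hs) (by omega)
  have hP : 0 < F ^ 2 * K := by positivity
  have hsodd : Odd s := by
    have : Odd (s ^ 2) := by
      rw [← hs]; exact (hc.pow).sub_even ⟨2 * F ^ 2 * K, by ring⟩
    exact (Int.odd_pow' (by norm_num)).1 this
  obtain ⟨x, hx⟩ : Even (c - s) := hc.sub_odd hsodd
  obtain ⟨y, hy⟩ : Even (c + s) := hc.add_odd hsodd
  have hxy : x * y = F ^ 2 * K := by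
    have : (c - s) * (c + s) = 4 * (F ^ 2 * K) := by linarith
    rw [hx, hy] at this; nlinarith
  have hy0 : 0 < y := by omega
  have hx0 : 0 < x := by
    rw [← hxy] at hP; exact pos_of_mul_pos_left hP hy0.le
  have : c = x + y := by omega
  nlinarith [mul_nonneg (by omega : 0 ≤ x - 1) (by omega : 0 ≤ y - 1)]

lemma Bs_neg_aux (k : ℤ) (hk : k = 1 ∨ k = 3) (n : ℕ) :
    4 * (Cs k (n + 1)) ^ 2 ≤ (k ^ 2 - 2 * k + 4) ^ 2 * Eh (n + 1) ^ 2 := by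
  induction n with
  | zero => rw [zero_add, Cs_one]; simp [Eh]; nlinarith
  | succ n ih =>
    rw [Cs_succ, Eh.eq_2 (n + 1)]
    generalize Cs k (n + 1) = c at *
    generalize Eh (n + 1) = e at *
    have he : 0 ≤ e ^ 2 := sq_nonneg e
    have hc : 0 ≤ c ^ 2 := sq_nonneg c
    generalize e ^ 2 = E at *
    generalize c ^ 2 = C at *
    rcases hk with rfl | rfl
    · norm_num at *; nlinarith
    · norm_num at *; nlinarith

lemma five_aux (n : ℕ) : ((Bs 5 (n + 3) : ℤ) : ZMod 21) = 10 ∧ ((2 ^ (2 ^ (n + 3)) : ℤ) : ZMod 21) = 4 ∨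
    ((Bs 5 (n + 3) : ℤ) : ZMod 21) = 11 ∧ ((2 ^ (2 ^ (n + 3)) : ℤ) : ZMod 21) = 16 := by
  induction n with
  | zero => left; refine ⟨?_, ?_⟩ <;> norm_num [Bs] <;> decide
  | succ n ih =>
    rw [show n + 1 + 3 = (n + 3) + 1 by ring, Bs_succ, two_pow_two_pow_succ (n + 3)]
    generalize Bs 5 (n + 3) = b at *
    generalize (2 : ℤ) ^ (2 ^ (n + 3)) = d at *
    push_cast
    rcases ih with ⟨h1, h2⟩ | ⟨h1, h2⟩ <;> rw [h1, h2] <;> decide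

lemma Bs_odd_nonsq (k : ℤ) (hk : Odd k) (hk1 : k ≠ -1) (n : ℕ) : ¬ IsSquare (Bs k (n + 2)) := by
  rcases n with _ | n
  · rintro ⟨s, hs⟩
    have h := (Bs_mod8_one k hk).2
    rw [zero_add] at hs
    have hso : Odd s := by
      have : Odd (s * s) := by rw [← hs, Int.odd_iff]; omega
      exact (Int.odd_mul.1 this).1
    have := sq_mod8 hso
    rw [sq] at this; omega
  by_cases h13 : k = 1 ∨ k = 3
  · rintro ⟨s, hs⟩
    rw [Bs_succ_C] at hs
    have h1 := Bs_neg_aux k h13 (n + 1)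
    have h2 := Eh_pos (n + 1 + 1)
    have h3 : 0 < Eh (n + 1 + 1) ^ 2 := by positivity
    have h4 := mul_self_nonneg s
    rcases h13 with rfl | rfl <;> nlinarith
  by_cases h5 : k = 5
  · subst h5
    rintro ⟨s, hs⟩
    have h := five_aux n
    rw [show n + 1 + 2 = n + 3 by ring] at hs
    rw [hs] at h
    push_cast at h
    generalize (s : ZMod 21) = t at h
    have : t * t = 10 ∨ t * t = 11 := by tauto
    clear h; revert this; revert t; decide
  obtain ⟨K, hK, hKk, hμ, hb⟩ : ∃ K : ℤ, 17 ≤ K ∧ k ^ 2 + 4 ≤ K ∧ k ^ 2 - 2 * k + 4 ≤ 2 * K ∧ 16 * K + 2 ≤ Cs k 2 := by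
    rw [Cs_two]
    push Not at h13
    obtain ⟨r, hr⟩ := hk
    by_cases h3 : k = -3
    · subst h3; exact ⟨17, by norm_num, by norm_num, by norm_num, by norm_num⟩
    · have : k ≤ -5 ∨ 7 ≤ k := by omega
      refine ⟨k ^ 2 + 4, by rcases this with h | h <;> nlinarith, le_rfl, by nlinarith [sq_nonneg (k + 1)], ?_⟩
      rcases this with h | h
      · obtain ⟨a, rfl⟩ : ∃ a, k = - (a + 5) := ⟨-k - 5, by ring⟩
        have ha : 0 ≤ a := by omega
        have : 0 ≤ a ^ 2 := by positivity
        have : 0 ≤ a ^ 3 := by positivity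
        have : 0 ≤ a ^ 4 := by positivity
        nlinarith
      · obtain ⟨a, rfl⟩ : ∃ a, k = a + 7 := ⟨k - 7, by ring⟩
        have ha : 0 ≤ a := by omega
        have : 0 ≤ a ^ 2 := by positivity
        have : 0 ≤ a ^ 3 := by positivity
        have : 0 ≤ a ^ 4 := by positivity
        nlinarith
  obtain ⟨F, hF1, hF2, hF3⟩ := Cs_lower' k K hK hμ hb n
  rintro ⟨s, hs⟩
  rw [show n + 1 + 2 = (n + 2) + 1 by ring, Bs_succ_C, hF1, ← sq] at hs
  have h9 : F ^ 2 * (k ^ 2 + 4) ≤ F ^ 2 * K := by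
    apply mul_le_mul_of_nonneg_left hKk; positivity
  have h10 : 0 < F ^ 2 * K := by positivity
  exact nonsq_big _ (k ^ 2 + 4) F s (Cs_odd k hk (n + 1)) (by linarith) (by linarith) (by positivity) (by linarith) hs

/-- (I) -/
lemma Bs_nonsq (k : ℤ) (h0 : k ≠ 0) (h2 : k ≠ 2) (h1 : k ≠ -1) (n : ℕ) (hn : k = 4 → n ≠ 0) :
    ¬ IsSquare (Bs k (n + 2)) := by
  rcases Int.even_or_odd k with ⟨l, hl⟩ | ho
  · obtain rfl : k = 2 * l := by omega
    rw [Bs_even]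
    intro h
    exact bE_nonsq l (by omega) (by omega) n (fun h => hn (by omega)) (isSquare_two_pow_mul h)
  · exact Bs_odd_nonsq k ho h1 n
end PD
end

section
namespace PD

lemma exists_odd_val (m : ℤ) (hm : m ≠ 0) (h1 : ¬ IsSquare |m|) (h2 : ¬ IsSquare (2 * |m|)) :
    ∃ q : ℕ, q.Prime ∧ q ≠ 2 ∧ Odd (padicValInt q m) := by
  by_contra! hcon
  obtain ⟨a, b, hab, ha⟩ := Nat.sq_mul_squarefree m.natAbs
  have hn0 : m.natAbs ≠ 0 := by simpa using hm
  have hb0 : b ≠ 0 := by rintro rfl; simp at hab; omega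
  have ha0 : a ≠ 0 := by rintro rfl; simp at hab; omega
  have habs : |m| = (b:ℤ) ^ 2 * a := by
    rw [Int.abs_eq_natAbs, ← hab]; push_cast; ring
  have hprime : ∀ q : ℕ, q.Prime → q ∣ a → q = 2 := by
    intro q hq hqa
    by_contra hne
    have := hcon q hq hne
    apply this
    have := Fact.mk hq
    have hv : padicValNat q a = 1 := by
      have h := (Nat.squarefree_iff_factorization_le_one ha0).1 ha q
      rw [Nat.factorization_def a hq] at h
      have := one_le_padicValNat_of_dvd ha0 hqa
      omega
    rw [padicValInt, ← hab, padicValNat.mul (by positivity) ha0, padicValNat.pow, hv]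
    exact ⟨padicValNat q b, rfl⟩
  have : a ∣ 2 := by
    rw [← Nat.prod_primeFactors_of_squarefree ha]
    have hsub : a.primeFactors ⊆ {2} := by
      intro q hq
      have := Nat.mem_primeFactors.1 hq
      simpa using hprime q this.1 this.2.1
    rcases Finset.subset_singleton_iff.1 hsub with h | h <;> rw [h] <;> simp
  rcases (Nat.dvd_prime Nat.prime_two).1 this with rfl | rfl
  · exact h1 ⟨b, by rw [habs]; push_cast; ring⟩
  · exact h2 ⟨2 * b, by rw [habs]; push_cast; ring⟩

lemma Bs_mod_q_aux {q : ℕ} [Fact q.Prime] (k : ℤ) (j : ℕ) (hj : ((Bs k j : ℤ) : ZMod q) = 0) (i : ℕ) :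
    ((Bs k (j + 1 + i) : ℤ) : ZMod q) = - ((2:ZMod q) ^ (2 ^ (j + 1 + i))) ∨
    ((Bs k (j + 1 + i) : ℤ) : ZMod q) = - k * ((2:ZMod q) ^ (2 ^ (j + 1 + i))) := by
  have e2 : ∀ n : ℕ, (2 : ZMod q) ^ (2 ^ (n + 1)) = (2 ^ (2 ^ n)) ^ 2 := fun n => by
    rw [← pow_mul, pow_succ 2 n]
  induction i with
  | zero => left; rw [add_zero, Bs_succ, e2]; push_cast; rw [hj]; ring
  | succ i ih =>
    rw [show j + 1 + (i + 1) = (j + 1 + i) + 1 by ring, Bs_succ, e2]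
    push_cast
    rcases ih with h | h
    · right; rw [h]; ring
    · left; rw [h]; ring

lemma Bs_mod_q_zero {q : ℕ} (k : ℤ) (hk : (k : ZMod q) = 0) (i : ℕ) :
    ((Bs k (2 * i + 1) : ℤ) : ZMod q) = - ((2:ZMod q) ^ (2 ^ (2 * i + 1))) := by
  have e2 : ∀ n : ℕ, (2 : ZMod q) ^ (2 ^ (n + 1)) = (2 ^ (2 ^ n)) ^ 2 := fun n => by
    rw [← pow_mul, pow_succ 2 n]
  induction i with
  | zero => rw [Bs_succ, e2]; simp [Bs, hk]; norm_num
  | succ i ih =>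
    rw [show 2 * (i + 1) + 1 = ((2 * i + 1) + 1) + 1 by ring, Bs_succ, Bs_succ, e2, e2]
    push_cast
    rw [ih, hk]; ring

/-- primes dividing `B_n` with `n` odd do not divide earlier terms -/
lemma Bs_not_dvd (q : ℕ) (hq : q.Prime) (hq2 : q ≠ 2) (k : ℤ) (n : ℕ) (hn : Odd n) (h : (q:ℤ) ∣ Bs k n)
    (j : ℕ) (hj : j < n) : ¬ (q:ℤ) ∣ Bs k j := by
  intro hdj
  have := Fact.mk hq
  have h20 : (2 : ZMod q) ≠ 0 := by
    intro h0
    have : ((2:ℕ) : ZMod q) = 0 := by exact_mod_cast h0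
    rw [ZMod.natCast_eq_zero_iff] at this
    exact hq2 ((Nat.prime_dvd_prime_iff_eq hq Nat.prime_two).1 this)
  rw [← ZMod.intCast_zmod_eq_zero_iff_dvd] at h hdj
  have hp : ∀ n : ℕ, (2:ZMod q) ^ n ≠ 0 := fun n => pow_ne_zero _ h20
  obtain ⟨i, rfl⟩ : ∃ i, n = j + 1 + i := ⟨n - j - 1, by omega⟩
  have hk : (k : ZMod q) = 0 := by
    rcases Bs_mod_q_aux k j hdj i with h' | h'
    · rw [h] at h'; exact absurd (neg_eq_zero.1 h'.symm) (hp _)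
    · rw [h] at h'
      rcases mul_eq_zero.1 h'.symm with h'' | h''
      · simpa using h''
      · exact absurd h'' (hp _)
  obtain ⟨r, hr⟩ := hn
  rw [hr] at h
  have := Bs_mod_q_zero k hk r
  rw [h] at this
  exact absurd (neg_eq_zero.1 this.symm) (hp _)

lemma bE_mod4_even (l : ℤ) (hl : Even l) (i : ℕ) : bE l (2 * i + 1) % 4 = 3 := by
  obtain ⟨r, rfl⟩ := hl
  induction i with
  | zero => rw [mul_zero, zero_add, bE_one]; ring_nf; omega
  | succ i ih =>
    rw [show 2 * (i + 1) + 1 = ((2 * i + 1) + 1) + 1 by ring, bE, bE]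
    generalize bE (r + r) (2 * i + 1) = b at *
    obtain ⟨t, rfl⟩ : ∃ t, b = 4 * t + 3 := ⟨b / 4, by omega⟩
    ring_nf; omega

lemma bE_mod_odd (l : ℤ) (hl : Odd l) (i : ℕ) : bE l (2 * i + 2) % 8 = 7 ∧ bE l (2 * i + 3) % 4 = 2 := by
  have step1 : ∀ b : ℤ, b % 8 = 7 → (b ^ 2 + 2 * l * b - 1) % 4 = 2 := by
    intro b hb
    have h1 := sq_mod8 (k := b) (by rw [Int.odd_iff]; omega)
    have h2 : (l * b) % 2 = 1 := by
      rw [← Int.odd_iff]; exact hl.mul (by rw [Int.odd_iff]; omega)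
    have : 2 * l * b = 2 * (l * b) := by ring
    omega
  have step2 : ∀ b : ℤ, b % 4 = 2 → (b ^ 2 + 2 * l * b - 1) % 8 = 7 := by
    intro b hb
    obtain ⟨t, rfl⟩ : ∃ t, b = 2 * t := ⟨b / 2, by omega⟩
    have ht : Odd t := by rw [Int.odd_iff]; omega
    have h1 := sq_mod8 ht
    have h2 : (l * t) % 2 = 1 := by rw [← Int.odd_iff]; exact hl.mul ht
    have : (2 * t) ^ 2 + 2 * l * (2 * t) - 1 = 4 * t ^ 2 + 4 * (l * t) - 1 := by ring
    omega
  have key : ∀ n, bE l (n + 1) = (bE l n) ^ 2 + 2 * l * bE l n - 1 := fun n => rfl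
  induction i with
  | zero =>
    have h1 : bE l 1 % 4 = 2 := by rw [bE_one]; have := sq_mod8 hl; omega
    have h2 : bE l 2 % 8 = 7 := by rw [key]; exact step2 _ h1
    exact ⟨h2, by rw [mul_zero, zero_add, key]; exact step1 _ h2⟩
  | succ i ih =>
    have h2 : bE l (2 * (i + 1) + 2) % 8 = 7 := by
      rw [show 2 * (i + 1) + 2 = (2 * i + 3) + 1 by ring, key]; exact step2 _ ih.2
    exact ⟨h2, by rw [show 2 * (i + 1) + 3 = (2 * (i + 1) + 2) + 1 by ring, key]; exact step1 _ h2⟩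

lemma neg_two_nonres (N : ℤ) (hN : 0 < N) (h : N % 8 = 7) (t : ℤ) (ht : N ∣ t ^ 2 + 2) : False := by
  lift N to ℕ using hN.le
  have h8 : N % 8 = 7 := by omega
  have h1 : jacobiSym (-2) N = -1 := by
    rw [jacobiSym.at_neg_two (Nat.odd_iff.2 (by omega)), ZMod.χ₈'_nat_eq_if_mod_eight, h8]
    have : N % 2 ≠ 0 := by omega
    simp [this]
  have h2 : jacobiSym (-2) N = jacobiSym (t ^ 2) N := by
    rw [jacobiSym.mod_left (-2), jacobiSym.mod_left (t ^ 2)]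
    congr 1
    have : (t ^ 2) ≡ -2 [ZMOD N] := by
      apply Int.ModEq.symm
      rw [Int.modEq_iff_dvd]; simpa using ht
    exact this.symm
  rw [jacobiSym.pow_left, h1] at h2
  nlinarith [sq_nonneg (jacobiSym t N)]

lemma Bs_odd_val (k : ℤ) (h0 : k ≠ 0) (h2 : k ≠ 2) (h1 : k ≠ -1) (i : ℕ) :
    ∃ q : ℕ, q.Prime ∧ q ≠ 2 ∧ Odd (padicValInt q (Bs k (2 * i + 3))) := by
  have hns : ¬ IsSquare (Bs k (2 * i + 3)) := Bs_nonsq k h0 h2 h1 (2 * i + 1) (fun _ => by omega)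
  have hne : Bs k (2 * i + 3) ≠ 0 := fun h => hns (by rw [h]; exact ⟨0, rfl⟩)
  rcases Int.even_or_odd k with ⟨l, hl⟩ | ho
  · obtain rfl : k = 2 * l := by omega
    have hpos := bE_pos l (by omega) (by omega) (2 * i + 1)
    rw [show 2 * i + 1 + 2 = 2 * i + 3 by ring] at hpos
    have hBpos : 0 < Bs (2 * l) (2 * i + 3) := by rw [Bs_even]; positivity
    apply exists_odd_val _ hne
    · rwa [abs_of_pos hBpos]
    · rw [abs_of_pos hBpos, Bs_even]
      intro h
      have h' : IsSquare ((2:ℤ) ^ 2 ^ (2 * i + 2 + 1) * (2 * bE l (2 * i + 3))) := by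
        convert h using 1; ring
      obtain ⟨t, ht⟩ := isSquare_two_pow_mul h'
      rcases Int.even_or_odd l with he | ho
      · have h3 := bE_mod4_even l he (i + 1)
        rw [show 2 * (i + 1) + 1 = 2 * i + 3 by ring] at h3
        have hte : Even t := by
          have : Even (t * t) := ⟨bE l (2 * i + 3), by rw [← ht]; ring⟩
          rw [Int.even_mul] at this; tauto
        obtain ⟨u, rfl⟩ := hte
        have : bE l (2 * i + 3) = 2 * (u * u) := by nlinarith
        omega
      · obtain ⟨h3, h4⟩ := bE_mod_odd l ho i
        have h5 := bE_pos l (by omega) (by omega) (2 * i)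
        refine neg_two_nonres _ h5 h3 t ?_
        rw [sq, ← ht, show 2 * i + 3 = (2 * i + 2) + 1 by ring, bE.eq_2 l (2 * i + 2)]
        exact ⟨2 * bE l (2 * i + 2) + 4 * l, by ring⟩
  · have h8 := Bs_mod8 k ho (2 * i)
    apply exists_odd_val _ hne
    · rcases abs_choice (Bs k (2 * i + 3)) with h | h
      · rwa [h]
      · rw [h]; rintro ⟨s, hs⟩
        have hso : Odd s := by
          have : Odd (s * s) := by rw [← hs, Int.odd_iff]; omega
          exact (Int.odd_mul.1 this).1
        have := sq_mod8 hso
        rw [sq] at this; omega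
    · rintro ⟨t, ht⟩
      have hte : Even t := by
        have : Even (t * t) := ⟨|Bs k (2 * i + 3)|, by rw [← ht]; ring⟩
        rw [Int.even_mul] at this; tauto
      obtain ⟨u, rfl⟩ := hte
      have : |Bs k (2 * i + 3)| = 2 * (u * u) := by nlinarith
      rcases abs_choice (Bs k (2 * i + 3)) with h | h <;> omega

/-- the two quartic factors of `f^3` for `k = -1`, evaluated at `b_m`, cleared of denominators -/
def N1 (m : ℕ) : ℤ := (Bs (-1) m) ^ 4 - 3 * (Bs (-1) m) ^ 3 * 2 ^ (2 ^ m) + 4 * Bs (-1) m * (2 ^ (2 ^ m)) ^ 3 - (2 ^ (2 ^ m)) ^ 4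
def N2 (m : ℕ) : ℤ := (Bs (-1) m) ^ 4 - (Bs (-1) m) ^ 3 * 2 ^ (2 ^ m) - 3 * (Bs (-1) m) ^ 2 * (2 ^ (2 ^ m)) ^ 2 + Bs (-1) m * (2 ^ (2 ^ m)) ^ 3 + (2 ^ (2 ^ m)) ^ 4

lemma N1_mul_N2 (m : ℕ) : N1 m * N2 m = Bs (-1) (m + 3) := by
  rw [Bs_succ, Bs_succ, Bs_succ, two_pow_two_pow_succ, two_pow_two_pow_succ, N1, N2]
  ring

lemma Bs_neg_one_mod3 (m : ℕ) : ((Bs (-1) (2 * m + 1) : ℤ) : ZMod 3) = 1 ∧ ((2 ^ (2 ^ (2 * m + 1)) : ℤ) : ZMod 3) = 1 ∧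
    ((Bs (-1) (2 * m + 2) : ℤ) : ZMod 3) = 2 ∧ ((2 ^ (2 ^ (2 * m + 2)) : ℤ) : ZMod 3) = 1 := by
  have st : ∀ n, ((Bs (-1) n : ℤ) : ZMod 3) = 1 ∧ ((2 ^ (2 ^ n) : ℤ) : ZMod 3) = 1 →
      ((Bs (-1) (n+1) : ℤ) : ZMod 3) = 2 ∧ ((2 ^ (2 ^ (n+1)) : ℤ) : ZMod 3) = 1 := by
    intro n
    rw [Bs_succ, two_pow_two_pow_succ]
    generalize (2:ℤ) ^ (2 ^ n) = d
    rintro ⟨h1, h2⟩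
    push_cast; rw [h1, h2]; decide
  have st' : ∀ n, ((Bs (-1) n : ℤ) : ZMod 3) = 2 ∧ ((2 ^ (2 ^ n) : ℤ) : ZMod 3) = 1 →
      ((Bs (-1) (n+1) : ℤ) : ZMod 3) = 1 ∧ ((2 ^ (2 ^ (n+1)) : ℤ) : ZMod 3) = 1 := by
    intro n
    rw [Bs_succ, two_pow_two_pow_succ]
    generalize (2:ℤ) ^ (2 ^ n) = d
    rintro ⟨h1, h2⟩
    push_cast; rw [h1, h2]; decide
  induction m with
  | zero =>
    have h : ((Bs (-1) 1 : ℤ) : ZMod 3) = 1 ∧ ((2 ^ (2 ^ 1) : ℤ) : ZMod 3) = 1 := by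
      norm_num [Bs]; decide
    exact ⟨h.1, h.2, (st 1 h).1, (st 1 h).2⟩
  | succ m ih =>
    have h := st' _ ⟨ih.2.2.1, ih.2.2.2⟩
    have h' := st _ h
    exact ⟨h.1, h.2, h'.1, h'.2⟩

lemma N1_mod3 (m : ℕ) : ((N1 (2 * m + 2) : ℤ) : ZMod 3) = 2 := by
  obtain ⟨-, -, h1, h2⟩ := Bs_neg_one_mod3 m
  rw [N1]
  generalize (2:ℤ) ^ (2 ^ (2 * m + 2)) = d at *
  push_cast; rw [h1, h2]; decide

lemma N2_mod3 (m : ℕ) : ((N2 (m + 1) : ℤ) : ZMod 3) = 2 := by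
  rw [N2]
  rcases Nat.even_or_odd' m with ⟨c, rfl | rfl⟩
  · obtain ⟨h1, h2, -, -⟩ := Bs_neg_one_mod3 c
    generalize (2:ℤ) ^ (2 ^ (2 * c + 1)) = d at *
    push_cast; rw [h1, h2]; decide
  · obtain ⟨-, -, h1, h2⟩ := Bs_neg_one_mod3 c
    rw [show 2 * c + 1 + 1 = 2 * c + 2 by ring]
    generalize (2:ℤ) ^ (2 ^ (2 * c + 2)) = d at *
    push_cast; rw [h1, h2]; decide

lemma nonsq_mod3 (N : ℤ) (h : (N : ZMod 3) = 2) : ¬ IsSquare N := by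
  rintro ⟨s, rfl⟩
  push_cast at h
  generalize (s : ZMod 3) = t at h
  revert h; revert t; decide

lemma Bs_neg_one_mod31 (m : ℕ) :
    (((Bs (-1) (2 * m + 5) : ℤ) : ZMod 31) = 27 ∧ ((2 ^ (2 ^ (2 * m + 5)) : ℤ) : ZMod 31) = 4) ∨
    (((Bs (-1) (2 * m + 5) : ℤ) : ZMod 31) = 23 ∧ ((2 ^ (2 ^ (2 * m + 5)) : ℤ) : ZMod 31) = 8) := by
  have st : ∀ n, ∀ b d : ZMod 31, ((Bs (-1) n : ℤ) : ZMod 31) = b → ((2 ^ (2 ^ n) : ℤ) : ZMod 31) = d →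
      ((Bs (-1) (n+1) : ℤ) : ZMod 31) = b ^ 2 - d * b - d ^ 2 ∧ ((2 ^ (2 ^ (n+1)) : ℤ) : ZMod 31) = d ^ 2 := by
    intro n b d
    rw [Bs_succ, two_pow_two_pow_succ]
    generalize (2:ℤ) ^ (2 ^ n) = d
    intro h1 h2
    push_cast; rw [h1, h2]; constructor <;> ring
  induction m with
  | zero =>
    left
    obtain ⟨h1, h2⟩ := st 0 (1) 2 (by norm_num [Bs]) (by norm_num)
    obtain ⟨h1, h2⟩ := st _ _ _ h1 h2
    obtain ⟨h1, h2⟩ := st _ _ _ h1 h2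
    obtain ⟨h1, h2⟩ := st _ _ _ h1 h2
    obtain ⟨h1, h2⟩ := st _ _ _ h1 h2
    exact ⟨h1.trans (by decide), h2.trans (by decide)⟩
  | succ m ih =>
    rcases ih with ⟨h1, h2⟩ | ⟨h1, h2⟩
    · right
      obtain ⟨h1, h2⟩ := st _ _ _ h1 h2
      obtain ⟨h1, h2⟩ := st _ _ _ h1 h2
      exact ⟨h1.trans (by decide), h2.trans (by decide)⟩
    · left
      obtain ⟨h1, h2⟩ := st _ _ _ h1 h2
      obtain ⟨h1, h2⟩ := st _ _ _ h1 h2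
      exact ⟨h1.trans (by decide), h2.trans (by decide)⟩

lemma nonsq_mod31 (N : ℤ) (h : (N : ZMod 31) = 23 ∨ (N : ZMod 31) = 27 ∨ (N : ZMod 31) = 6) : ¬ IsSquare N := by
  rintro ⟨s, rfl⟩
  push_cast at h
  generalize (s : ZMod 31) = t at h
  revert h; revert t; decide

lemma N2_nonsq (m : ℕ) : ¬ IsSquare (N2 (m + 1)) := nonsq_mod3 _ (N2_mod3 m)

lemma N1_nonsq (m : ℕ) : ¬ IsSquare (N1 (m + 1)) := by
  rcases Nat.even_or_odd' m with ⟨c, rfl | rfl⟩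
  · rcases c with _ | _ | c
    · rintro ⟨s, hs⟩
      have : N1 1 = 589 := by simp [N1, Bs]
      rw [mul_zero, zero_add, this] at hs
      rcases lt_or_ge (|s|) 25 with h | h
      · have h1 : |s| ≤ 24 := by omega
        nlinarith [abs_mul_abs_self s, abs_nonneg s]
      · nlinarith [abs_mul_abs_self s, abs_nonneg s]
    · apply nonsq_mod31; right; right
      simp [N1, Bs]; decide
    · apply nonsq_mod31
      rw [show 2 * (c + 1 + 1) + 1 = 2 * c + 5 by ring, N1]
      have h := Bs_neg_one_mod31 c
      generalize (2:ℤ) ^ (2 ^ (2 * c + 5)) = d at *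
      rcases h with ⟨h1, h2⟩ | ⟨h1, h2⟩
      · left; push_cast; rw [h1, h2]; decide
      · right; left; push_cast; rw [h1, h2]; decide
  · exact nonsq_mod3 _ (N1_mod3 c)

lemma Bs_odd (k : ℤ) (hk : Odd k) (n : ℕ) : Odd (Bs k (n + 1)) := by
  rw [Int.odd_iff]
  rcases n with _ | _ | n
  · have := (Bs_mod8_one k hk).1; simp only [zero_add]; omega
  · have := (Bs_mod8_one k hk).2; simp only [zero_add, Nat.reduceAdd]; omega
  · have := Bs_mod8 k hk n; rw [show n + 1 + 1 + 1 = n + 3 by ring]; omega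

lemma N_mod8 (m : ℕ) : N1 (m + 2) % 8 = 1 ∧ N2 (m + 2) % 8 = 1 := by
  have h1 : (Bs (-1) (m + 2) ^ 4) % 8 = 1 := by
    have := sq_mod8 ((Bs_odd (-1) (by decide) (m + 1)).pow (n := 2))
    rw [← pow_mul] at this; exact this
  obtain ⟨t, ht⟩ := two_pow_dvd8 m
  rw [N1, N2, ht]
  generalize Bs (-1) (m + 2) = b at *
  constructor
  · have : b ^ 4 - 3 * b ^ 3 * (8 * t) + 4 * b * (8 * t) ^ 3 - (8 * t) ^ 4 =
      b ^ 4 + 8 * (- 3 * b ^ 3 * t + 4 * b * 64 * t ^ 3 - 512 * t ^ 4) := by ring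
    rw [this]; omega
  · have : b ^ 4 - b ^ 3 * (8 * t) - 3 * b ^ 2 * (8 * t) ^ 2 + b * (8 * t) ^ 3 + (8 * t) ^ 4 =
      b ^ 4 + 8 * (- b ^ 3 * t - 3 * b ^ 2 * 8 * t ^ 2 + b * 64 * t ^ 3 + 512 * t ^ 4) := by ring
    rw [this]; omega

lemma odd_val_of_mod8 (N : ℤ) (h8 : N % 8 = 1) (hns : ¬ IsSquare N) :
    ∃ q : ℕ, q.Prime ∧ q ≠ 2 ∧ Odd (padicValInt q N) := by
  apply exists_odd_val _ (by rintro rfl; simp at h8)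
  · rcases abs_choice N with h | h
    · rwa [h]
    · rw [h]; rintro ⟨s, hs⟩
      have hso : Odd s := by
        have : Odd (s * s) := by rw [← hs, Int.odd_iff]; omega
        exact (Int.odd_mul.1 this).1
      have := sq_mod8 hso
      rw [sq] at this; omega
  · rintro ⟨t, ht⟩
    have hte : Even t := by
      have : Even (t * t) := ⟨|N|, by rw [← ht]; ring⟩
      rw [Int.even_mul] at this; tauto
    obtain ⟨u, rfl⟩ := hte
    have : |N| = 2 * (u * u) := by nlinarith
    rcases abs_choice N with h | h <;> omega

lemma N1_val (m : ℕ) : ∃ q : ℕ, q.Prime ∧ q ≠ 2 ∧ Odd (padicValInt q (N1 (2 * m + 2))) :=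
  odd_val_of_mod8 _ (N_mod8 (2 * m)).1 (N1_nonsq (2 * m + 1))
lemma N2_val (m : ℕ) : ∃ q : ℕ, q.Prime ∧ q ≠ 2 ∧ Odd (padicValInt q (N2 (2 * m + 2))) :=
  odd_val_of_mod8 _ (N_mod8 (2 * m)).2 (N2_nonsq (2 * m + 1))
end PD
end

section
open Polynomial
namespace PD

noncomputable def fk (k : ℤ) : ℤ[X] := X ^ 2 + C k * X - 1

noncomputable def It (k : ℤ) (g : ℤ[X]) : ℕ → ℤ[X]
  | 0 => g
  | n + 1 => (It k g n).comp (fk k)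

lemma fk_monic (k : ℤ) : (fk k).Monic := by
  unfold fk; monicity!
lemma fk_natDegree (k : ℤ) : (fk k).natDegree = 2 := by
  unfold fk; compute_degree!

lemma It_monic (k : ℤ) {g : ℤ[X]} (hg : g.Monic) (n : ℕ) : (It k g n).Monic := by
  induction n with
  | zero => exact hg
  | succ n ih => exact ih.comp (fk_monic k) (by rw [fk_natDegree]; norm_num)

lemma It_natDegree (k : ℤ) (g : ℤ[X]) (n : ℕ) : (It k g n).natDegree = g.natDegree * 2 ^ n := by
  induction n with
  | zero => simp [It]
  | succ n ih => rw [It, natDegree_comp, ih, fk_natDegree]; ring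

lemma aeval_fk {A : Type*} [CommRing A] (k : ℤ) (x : A) : aeval x (fk k) = x ^ 2 + k * x - 1 := by
  simp [fk]

lemma aeval_It_succ {A : Type*} [CommRing A] (k : ℤ) (g : ℤ[X]) (n : ℕ) (x : A) :
    aeval x (It k g (n + 1)) = aeval (x ^ 2 + k * x - 1) (It k g n) := by
  rw [It, aeval_comp, aeval_fk]

lemma It_dvd (k : ℤ) {g : ℤ[X]} {j : ℕ} (h : g ∣ It k X j) (n : ℕ) : It k g n ∣ It k X (n + j) := by
  induction n with
  | zero => simpa [It] using h
  | succ n ih =>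
    rw [show n + 1 + j = (n + j) + 1 by ring, It, It]
    exact map_dvd (compRingHom (fk k)) ih

/-- the data on which the main argument runs -/
structure Good (k : ℤ) (g : ℤ[X]) (j : ℕ) (N : ℕ → ℤ) : Prop where
  monic : g.Monic
  irr : Irreducible (g.map (Int.castRingHom ℚ))
  dvd : g ∣ It k X j
  hN : ∀ n, (N n : ℚ) = (-4) ^ (It k g n).natDegree * aeval (-((k:ℚ) ^ 2 + 4) / 4) (It k g n)
  nsq : ∀ n, ¬ IsSquare (N n)
  lev : ∀ r : ℕ, ∃ n ≥ r, ∃ q : ℕ, q.Prime ∧ q ≠ 2 ∧ Odd (padicValInt q (N n)) ∧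
    ∀ i ≤ n + j, ¬ (q:ℤ) ∣ Bs k i

lemma norm_sub_gen {K S : Type*} [Field K] [CommRing S] [Algebra K S] (pb : PowerBasis K S) (t : K) :
    Algebra.norm K (algebraMap K S t - pb.gen) = (minpoly K pb.gen).eval t := by
  rw [Algebra.norm_eq_matrix_det pb.basis, ← charpoly_leftMulMatrix pb, Matrix.eval_charpoly, map_sub]
  congr 2
  rw [AlgHom.commutes, Matrix.algebraMap_eq_diagonal]
  rfl

lemma irr_step {K : Type} [Field K] [CharZero K] (c : K) (P : K[X]) (hPm : P.Monic) (ih : Irreducible P)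
    (hns : ¬ IsSquare ((-4) ^ P.natDegree * P.eval (-(c ^ 2 + 4) / 4))) :
    Irreducible (P.comp (X ^ 2 + C c * X - 1)) := by
  have hfm : (X ^ 2 + C c * X - 1 : K[X]).Monic := by monicity!
  apply irreducible_comp hPm hfm ih
  intro E _ _ x hx
  have hinteg : IsIntegral K x := by
    by_contra h
    rw [minpoly.eq_zero h] at hx
    exact ih.ne_zero hx.symm
  set v := IntermediateField.AdjoinSimple.gen K x with hv
  let F := IntermediateField.adjoin K {x}
  have hpoly : (X ^ 2 + C c * X - 1 : K[X]).map (algebraMap K F) - C v =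
      X ^ 2 + C (algebraMap K F c) * X + C (-1 - v) := by
    simp; ring
  rw [hpoly]
  have hdeg : (X ^ 2 + C (algebraMap K F c) * X + C (-1 - v)).natDegree = 2 := by
    compute_degree!
  apply irreducible_of_degree_le_three_of_not_isRoot (by rw [hdeg]; decide)
  intro r hr
  rw [IsRoot.def] at hr
  simp only [eval_add, eval_pow, eval_X, eval_mul, eval_C] at hr
  have h1 : (2 * r + algebraMap K F c) ^ 2 = algebraMap K F (-4) * (algebraMap K F (-(c ^ 2 + 4) / 4) - v) := by
    have : (algebraMap K F (-4)) * algebraMap K F (-(c ^ 2 + 4) / 4) = (algebraMap K F c) ^ 2 + 4 := by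
      rw [← map_mul]
      have : (-4 : K) * (-(c ^ 2 + 4) / 4) = c ^ 2 + 4 := by ring
      rw [this, map_add, map_pow]; congr 1; exact map_ofNat _ 4
    rw [mul_sub, this]
    simp only [map_neg, map_ofNat]
    linear_combination 4 * hr
  have h2 := congrArg (Algebra.norm K) h1
  have hfin : Module.finrank K F = P.natDegree := by
    rw [IntermediateField.adjoin.finrank hinteg, hx]
  have hpb := norm_sub_gen (IntermediateField.adjoin.powerBasis hinteg) (-(c ^ 2 + 4) / 4)
  rw [IntermediateField.adjoin.powerBasis_gen, IntermediateField.minpoly_gen, hx] at hpb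
  rw [map_mul, map_pow, Algebra.norm_algebraMap, hfin, hpb] at h2
  exact hns ⟨_, by rw [← h2, sq]⟩

lemma Good.irreducible {k : ℤ} {g : ℤ[X]} {j : ℕ} {N : ℕ → ℤ} (H : Good k g j N) (n : ℕ) :
    Irreducible ((It k g n).map (Int.castRingHom ℚ)) := by
  induction n with
  | zero => exact H.irr
  | succ n ih =>
    rw [It, Polynomial.map_comp]
    have hPm := (It_monic k H.monic n).map (Int.castRingHom ℚ)
    have := irr_step (k : ℚ) _ hPm ih ?_
    · convert this using 1
      simp [fk]
    · have h := H.nsq n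
      rw [← Rat.isSquare_intCast_iff, H.hN n] at h
      rw [(It_monic k H.monic n).natDegree_map, eval_map]
      exact h
end PD
end

section
open Polynomial
namespace PD

lemma quartic_coeffs {R : Type*} [CommRing R] {a b c d a' b' c' d' : R}
    (h : (X ^ 4 + C a * X ^ 3 + C b * X ^ 2 + C c * X + C d : R[X]) =
      X ^ 4 + C a' * X ^ 3 + C b' * X ^ 2 + C c' * X + C d') : a = a' ∧ b = b' ∧ c = c' ∧ d = d' := by
  have key : ∀ a b c d : R, ∀ i, (X ^ 4 + C a * X ^ 3 + C b * X ^ 2 + C c * X + C d : R[X]).coeff i =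
      (if i = 4 then 1 else 0) + (if i = 3 then a else 0) + (if i = 2 then b else 0) + (if i = 1 then c else 0) + if i = 0 then d else 0 := by
    intro a b c d i
    simp [coeff_X_pow, coeff_X, coeff_C, eq_comm]
  have h' := fun i => congrArg (fun p => coeff p i) h
  simp only [key] at h'
  refine ⟨?_, ?_, ?_, ?_⟩
  · simpa using h' 3
  · simpa using h' 2
  · simpa using h' 1
  · simpa using h' 0

lemma quartic_irr {R : Type*} [CommRing R] [IsDomain R] (a b c d : R)
    (hroot : ∀ r : R, r ^ 4 + a * r ^ 3 + b * r ^ 2 + c * r + d ≠ 0)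
    (hq : ∀ s t u v : R, ¬ (s + u = a ∧ t + v + s * u = b ∧ s * v + t * u = c ∧ t * v = d)) :
    Irreducible (X ^ 4 + C a * X ^ 3 + C b * X ^ 2 + C c * X + C d : R[X]) := by
  have hm : (X ^ 4 + C a * X ^ 3 + C b * X ^ 2 + C c * X + C d : R[X]).Monic := by monicity!
  have hd : (X ^ 4 + C a * X ^ 3 + C b * X ^ 2 + C c * X + C d : R[X]).natDegree = 4 := by compute_degree!
  rw [hm.irreducible_iff_natDegree']
  refine ⟨fun h => by rw [h] at hd; simp at hd, ?_⟩
  intro f g hf hg hfg hdeg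
  rw [hd, Finset.mem_Ioc] at hdeg
  have hsum : f.natDegree + g.natDegree = 4 := by rw [← hf.natDegree_mul hg, hfg, hd]
  have : g.natDegree = 1 ∨ g.natDegree = 2 := by omega
  rcases this with h1 | h2
  · have hg' := hg.as_sum
    rw [h1] at hg'
    simp at hg'
    apply hroot (-(g.coeff 0))
    have h3 : (f * g).eval (-(g.coeff 0)) = 0 := by
      rw [eval_mul]; 
      have : g.eval (-(g.coeff 0)) = 0 := by
        conv_lhs => rw [hg']
        simp
      rw [this, mul_zero]
    rw [hfg] at h3
    simpa using h3
  · have h2' : f.natDegree = 2 := by omega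
    have hg' := hg.as_sum
    have hf' := hf.as_sum
    rw [h2] at hg'
    rw [h2'] at hf'
    simp only [Finset.sum_range_succ, Finset.sum_range_zero, zero_add, pow_zero, mul_one, pow_one] at hf' hg'
    apply hq (f.coeff 1) (f.coeff 0) (g.coeff 1) (g.coeff 0)
    have : f * g = X ^ 4 + C (f.coeff 1 + g.coeff 1) * X ^ 3 + C (f.coeff 0 + g.coeff 0 + f.coeff 1 * g.coeff 1) * X ^ 2
        + C (f.coeff 1 * g.coeff 0 + f.coeff 0 * g.coeff 1) * X + C (f.coeff 0 * g.coeff 0) := by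
      conv_lhs => rw [hf', hg']
      simp only [C_add, C_mul]; ring
    rw [hfg] at this
    obtain ⟨h1, h2, h3, h4⟩ := quartic_coeffs this
    exact ⟨h1.symm, h2.symm, h3.symm, h4.symm⟩

lemma irr_Q_of_Z {p : ℤ[X]} (hp : p.Monic) (h : Irreducible p) : Irreducible (p.map (Int.castRingHom ℚ)) :=
  (hp.irreducible_iff_irreducible_map_fraction_map (K := ℚ)).1 h

noncomputable def g1 : ℤ[X] := X ^ 4 + C (-3) * X ^ 3 + C 0 * X ^ 2 + C 4 * X + C (-1)
noncomputable def g2 : ℤ[X] := X ^ 4 + C (-1) * X ^ 3 + C (-3) * X ^ 2 + C 1 * X + C 1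

lemma g1_monic : g1.Monic := by unfold g1; monicity!
lemma g2_monic : g2.Monic := by unfold g2; monicity!
lemma g1_natDegree : g1.natDegree = 4 := by unfold g1; compute_degree!
lemma g2_natDegree : g2.natDegree = 4 := by unfold g2; compute_degree!

lemma g1_irr : Irreducible g1 := by
  apply g1_monic.irreducible_of_irreducible_map (Int.castRingHom (ZMod 2))
  have := quartic_irr (-3 : ZMod 2) 0 4 (-1) (by decide) (by decide)
  convert this using 1
  simp only [g1, Polynomial.map_add, Polynomial.map_mul, Polynomial.map_pow, map_X, map_C]
  rfl
lemma g2_irr : Irreducible g2 := by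
  apply g2_monic.irreducible_of_irreducible_map (Int.castRingHom (ZMod 2))
  have := quartic_irr (-1 : ZMod 2) (-3) 1 1 (by decide) (by decide)
  convert this using 1
  simp only [g2, Polynomial.map_add, Polynomial.map_mul, Polynomial.map_pow, map_X, map_C]
  rfl

lemma g1_mul_g2 : g1 * g2 = It (-1) X 3 := by
  simp [g1, g2, It, fk]; ring

lemma It42 : It 4 X 2 = X ^ 4 + C 8 * X ^ 3 + C 18 * X ^ 2 + C 8 * X + C (-4) := by
  simp [It, fk]; ring

lemma int_dvd4 {t v : ℤ} (h : t * v = -4) : t = 1 ∧ v = -4 ∨ t = -1 ∧ v = 4 ∨ t = 2 ∧ v = -2 ∨ t = -2 ∧ v = 2 ∨ t = 4 ∧ v = -1 ∨ t = -4 ∧ v = 1 := by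
  have h1 : t ∣ 4 := ⟨-v, by linarith⟩
  have h2 : t ≤ 4 := Int.le_of_dvd (by norm_num) h1
  have h3 : -t ≤ 4 := Int.le_of_dvd (by norm_num) ((neg_dvd).2 h1)
  have h4 : -4 ≤ t := by linarith
  interval_cases t <;> omega

lemma It42_irr : Irreducible (It 4 X 2) := by
  rw [It42]
  apply quartic_irr
  · intro r hr
    have : r * (r ^ 3 + 8 * r ^ 2 + 18 * r + 8) = 4 := by linarith
    have h1 : r ∣ 4 := ⟨_, this.symm⟩
    have h2 : r ≤ 4 := Int.le_of_dvd (by norm_num) h1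
    have h3 : -r ≤ 4 := Int.le_of_dvd (by norm_num) ((neg_dvd).2 h1)
    have h4 : -4 ≤ r := by linarith
    clear hr h1
    interval_cases r <;> omega
  · rintro s t u v ⟨h1, h2, h3, h4⟩
    obtain rfl : u = 8 - s := by linarith
    have key : ∀ s c : ℤ, s * (8 - s) ≠ 20 ∧ s * (8 - s) ≠ 18 := by
      intro s _
      constructor <;> intro h
      · nlinarith [sq_nonneg (s - 4)]
      · nlinarith [sq_nonneg (s - 4)]
    rcases int_dvd4 h4 with ⟨rfl, rfl⟩ | ⟨rfl, rfl⟩ | ⟨rfl, rfl⟩ | ⟨rfl, rfl⟩ | ⟨rfl, rfl⟩ | ⟨rfl, rfl⟩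
    · obtain rfl : s = 0 := by omega
      norm_num at h2
    · omega
    · exact (key s 0).2 (by linarith)
    · exact (key s 0).2 (by linarith)
    · omega
    · obtain rfl : s = 8 := by omega
      norm_num at h2

/-- rational critical orbit -/
noncomputable def bq (k : ℤ) (m : ℕ) : ℚ := Bs k m / 2 ^ (2 ^ m)

lemma bq_succ (k : ℤ) (m : ℕ) : bq k (m + 1) = (bq k m) ^ 2 + k * bq k m - 1 := by
  have : (2 : ℚ) ^ (2 ^ m) ≠ 0 := by positivity
  have h2 : (2 : ℚ) ^ (2 ^ (m + 1)) = (2 ^ (2 ^ m)) ^ 2 := by rw [← pow_mul, pow_succ 2 m]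
  rw [bq, bq, Bs_succ, h2]
  push_cast
  field_simp

lemma bq_one (k : ℤ) : bq k 1 = -((k:ℚ) ^ 2 + 4) / 4 := by
  rw [bq_succ, bq]; simp [Bs]; ring

lemma aeval_bq (k : ℤ) (g : ℤ[X]) (n m : ℕ) : aeval (bq k m) (It k g n) = aeval (bq k (m + n)) g := by
  induction n generalizing m with
  | zero => rfl
  | succ n ih => rw [aeval_It_succ, ← bq_succ, ih]; congr 2; ring_nf

lemma dvd_of_odd_val {q : ℕ} {m : ℤ} (h : Odd (padicValInt q m)) : (q:ℤ) ∣ m := by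
  by_contra h'
  rw [padicValInt.eq_zero_of_not_dvd h'] at h
  simp at h

lemma good_generic (k : ℤ) (h0 : k ≠ 0) (h2 : k ≠ 2) (h1 : k ≠ -1) (h4 : k ≠ 4) :
    Good k X 0 (fun n => if n = 0 then k ^ 2 + 4 else Bs k (n + 1)) where
  monic := monic_X
  irr := by rw [map_X]; exact irreducible_X
  dvd := dvd_rfl
  hN n := by
    rw [← bq_one, aeval_bq, aeval_X, It_natDegree, natDegree_X, one_mul]
    rcases n with _ | n
    · simp only [add_zero, bq_one]; push_cast; simp; ring
    · have : (-4 : ℚ) ^ (2 ^ (n + 1)) = 2 ^ (2 ^ (1 + (n + 1))) := by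
        rw [show (-4:ℚ) ^ (2 ^ (n + 1)) = ((-4) ^ 2) ^ (2 ^ n) by rw [← pow_mul, pow_succ 2 n, mul_comm]]
        rw [show (2:ℚ) ^ (2 ^ (1 + (n + 1))) = (2 ^ 4) ^ (2 ^ n) by rw [← pow_mul]; congr 1; ring]
        norm_num
      rw [this, bq]
      field_simp
      simp; ring_nf
  nsq n := by
    rcases n with _ | n
    · simpa using nonsq_sq_add_four k h0
    · simpa using Bs_nonsq k h0 h2 h1 n (fun h => absurd h h4)
  lev r := by
    refine ⟨2 * r + 2, by omega, ?_⟩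
    obtain ⟨q, hq, hq2, hv⟩ := Bs_odd_val k h0 h2 h1 r
    refine ⟨q, hq, hq2, by simpa using hv, fun i hi => ?_⟩
    exact Bs_not_dvd q hq hq2 k (2 * r + 3) ⟨r + 1, by ring⟩ (dvd_of_odd_val hv) i (by omega)

lemma pow_aux (n : ℕ) : (-4 : ℚ) ^ (4 * 2 ^ n) = 2 ^ (2 ^ (n + 3)) := by
  rw [show (2:ℚ) ^ (2 ^ (n + 3)) = (2 ^ 8) ^ (2 ^ n) by rw [← pow_mul]; congr 1; ring, pow_mul]
  norm_num

lemma good_four : Good 4 (It 4 X 2) 2 (fun n => Bs 4 (n + 3)) where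
  monic := It_monic 4 monic_X 2
  irr := irr_Q_of_Z (It_monic 4 monic_X 2) It42_irr
  dvd := dvd_rfl
  hN n := by
    rw [← bq_one, aeval_bq, aeval_bq, aeval_X, It_natDegree, It_natDegree, natDegree_X, one_mul,
      show 2 ^ 2 * 2 ^ n = 4 * 2 ^ n by norm_num, pow_aux, show 1 + n + 2 = n + 3 by ring, bq]
    field_simp
  nsq n := Bs_nonsq 4 (by norm_num) (by norm_num) (by norm_num) (n + 1) (by omega)
  lev r := by
    refine ⟨2 * r, by omega, ?_⟩
    obtain ⟨q, hq, hq2, hv⟩ := Bs_odd_val 4 (by norm_num) (by norm_num) (by norm_num) r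
    refine ⟨q, hq, hq2, hv, fun i hi => ?_⟩
    exact Bs_not_dvd q hq hq2 4 (2 * r + 3) ⟨r + 1, by ring⟩ (dvd_of_odd_val hv) i (by omega)

lemma good_g1 : Good (-1) g1 3 (fun n => N1 (n + 1)) where
  monic := g1_monic
  irr := irr_Q_of_Z g1_monic g1_irr
  dvd := ⟨g2, g1_mul_g2.symm⟩
  hN n := by
    rw [← bq_one, aeval_bq, It_natDegree, g1_natDegree, pow_aux]
    have : (2 : ℚ) ^ (2 ^ (1 + n)) ≠ 0 := by positivity
    have h2 : (2 : ℚ) ^ (2 ^ (n + 3)) = (2 ^ (2 ^ (1 + n))) ^ 4 := by rw [← pow_mul]; congr 1; ring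
    rw [h2, N1, bq, add_comm n 1]
    simp only [g1, map_add, map_mul, map_pow, aeval_X, aeval_C]
    simp only [algebraMap_int_eq, eq_intCast]
    push_cast
    field_simp
    ring
  nsq n := N1_nonsq n
  lev r := by
    refine ⟨2 * r + 1, by omega, ?_⟩
    obtain ⟨q, hq, hq2, hv⟩ := N1_val r
    refine ⟨q, hq, hq2, hv, fun i hi => ?_⟩
    refine Bs_not_dvd q hq hq2 (-1) (2 * r + 2 + 3) ⟨r + 2, by ring⟩ ?_ i (by omega)
    rw [← N1_mul_N2]; exact Dvd.dvd.mul_right (dvd_of_odd_val hv) _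

lemma good_g2 : Good (-1) g2 3 (fun n => N2 (n + 1)) where
  monic := g2_monic
  irr := irr_Q_of_Z g2_monic g2_irr
  dvd := ⟨g1, by rw [mul_comm]; exact g1_mul_g2.symm⟩
  hN n := by
    rw [← bq_one, aeval_bq, It_natDegree, g2_natDegree, pow_aux]
    have : (2 : ℚ) ^ (2 ^ (1 + n)) ≠ 0 := by positivity
    have h2 : (2 : ℚ) ^ (2 ^ (n + 3)) = (2 ^ (2 ^ (1 + n))) ^ 4 := by rw [← pow_mul]; congr 1; ring
    rw [h2, N2, bq, add_comm n 1]
    simp only [g2, map_add, map_mul, map_pow, aeval_X, aeval_C]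
    simp only [algebraMap_int_eq, eq_intCast]
    push_cast
    field_simp
    ring
  nsq n := N2_nonsq n
  lev r := by
    refine ⟨2 * r + 1, by omega, ?_⟩
    obtain ⟨q, hq, hq2, hv⟩ := N2_val r
    refine ⟨q, hq, hq2, hv, fun i hi => ?_⟩
    refine Bs_not_dvd q hq hq2 (-1) (2 * r + 2 + 3) ⟨r + 2, by ring⟩ ?_ i (by omega)
    rw [← N1_mul_N2]; exact Dvd.dvd.mul_left (dvd_of_odd_val hv) _
end PD
end

section
open Polynomial NumberField
open scoped Pointwise
namespace PD

lemma Bs_mem {A : Type*} [CommRing A] (P : Ideal A) (k : ℤ) (n : ℕ) : ∀ (m : ℕ) (x : A),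
    aeval x (It k X n) = 0 → (2 : A) ^ (2 ^ m) * x - (Bs k m : A) ∈ P → (Bs k (m + n) : A) ∈ P := by
  induction n with
  | zero =>
    intro m x hx h
    simp only [It, aeval_X] at hx
    subst hx
    simpa using h
  | succ n ih =>
    intro m x hx h
    rw [aeval_It_succ] at hx
    have := ih (m + 1) _ hx ?_
    · rwa [show m + (n + 1) = m + 1 + n by ring]
    · rw [← Ideal.Quotient.eq] at h ⊢
      rw [Bs_succ, show (2:A) ^ 2 ^ (m+1) = (2 ^ 2 ^ m) ^ 2 by rw [← pow_mul, pow_succ]]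
      simp only [map_mul, map_add, map_sub, map_pow, Int.cast_sub, Int.cast_add, Int.cast_mul, Int.cast_pow, Int.cast_ofNat, map_one] at h ⊢
      rw [← h]; ring

lemma sep {A : Type*} [CommRing A] [IsDomain A] (P : Ideal A) [P.IsPrime] (q : ℕ)
    (hq : ∀ m : ℤ, (m : A) ∈ P → (q : ℤ) ∣ m) (k : ℤ) (n : ℕ) (hB : ∀ i ≤ n, ¬ (q:ℤ) ∣ Bs k i) :
    ∀ x y : A, aeval x (It k X n) = 0 → aeval y (It k X n) = 0 → x - y ∈ P → x = y := by
  induction n with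
  | zero =>
    intro x y hx hy _
    simp only [It, aeval_X] at hx hy
    rw [hx, hy]
  | succ n ih =>
    intro x y hx hy hxy
    have h1 := ih (fun i hi => hB i (by omega)) (x ^ 2 + k * x - 1) (y ^ 2 + k * y - 1)
      (by rw [← aeval_It_succ]; exact hx) (by rw [← aeval_It_succ]; exact hy)
      (by
        have := P.mul_mem_left (x + y + k) hxy
        convert this using 1; ring)
    have h2 : (x - y) * (x + y + k) = 0 := by linear_combination h1
    rcases mul_eq_zero.1 h2 with h | h
    · exact sub_eq_zero.1 h
    · exfalso
      have h3 : (2:A) ^ (2 ^ 0) * x - (Bs k 0 : A) ∈ P := by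
        convert hxy using 1
        simp [Bs]
        linear_combination h
      have := Bs_mem P k (n+1) 0 x hx h3
      rw [zero_add] at this
      exact hB (n+1) le_rfl (hq _ this)

variable {L : Type*} [Field L] [NumberField L] [IsGalois ℚ L]

lemma even_val (q : ℕ) (hqp : q.Prime) (k : ℤ) (n : ℕ) (hB : ∀ i ≤ n, ¬ (q:ℤ) ∣ Bs k i)
    (hfaith : ∀ g : Gal(L/ℚ), (∀ α : 𝓞 L, aeval α (It k X n) = 0 → g • α = α) → g = 1)
    (β : 𝓞 L) (m : ℤ) (hm : m ≠ 0) (hβ : β ^ 2 = m) : Even (padicValInt q m) := by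
  have : Fact q.Prime := ⟨hqp⟩
  have hqi : Prime (q : ℤ) := Nat.prime_iff_prime_int.1 hqp
  have hmax : (Ideal.span {(q : ℤ)}).IsMaximal :=
    PrincipalIdealRing.isMaximal_of_irreducible hqi.irreducible
  obtain ⟨P, hP, hPu⟩ := Ideal.exists_ideal_over_maximal_of_isIntegral (S := 𝓞 L) (Ideal.span {(q : ℤ)})
    (by
      rw [(RingHom.injective_iff_ker_eq_bot _).1 (FaithfulSMul.algebraMap_injective ℤ (𝓞 L))]
      exact bot_le)
  have : P.LiesOver (Ideal.span {(q:ℤ)}) := ⟨hPu.symm⟩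
  have hmem : ∀ m : ℤ, (m : 𝓞 L) ∈ P ↔ (q : ℤ) ∣ m := by
    intro m
    rw [← Ideal.mem_span_singleton, ← hPu, Ideal.mem_comap]
    simp
  have hin : P.inertia Gal(L/ℚ) = ⊥ := by
    rw [eq_bot_iff]
    intro g hg
    rw [Subgroup.mem_bot]
    apply hfaith
    intro α hα
    refine sep P q (fun m => (hmem m).1) k n hB _ _ ?_ hα (hg α)
    have := aeval_algHom_apply (MulSemiringAction.toRingHom Gal(L/ℚ) (𝓞 L) g).toIntAlgHom α (It k X n)
    rw [hα, map_zero] at this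
    exact this
  have hperf : PerfectField (Ideal.span {(q:ℤ)}).ResidueField := by
    have hf : Finite (ℤ ⧸ Ideal.span {(q:ℤ)}) := by
      apply Nat.finite_of_card_ne_zero
      rw [← Submodule.cardQuot_apply, ← Ideal.absNorm_apply]
      simp [hqp.ne_zero]
    have := Finite.of_surjective _ (Ideal.bijective_algebraMap_quotient_residueField (Ideal.span {(q:ℤ)})).2
    infer_instance
  have h1 := Ideal.card_inertia_eq_ramificationIdxIn (G := Gal(L/ℚ)) (Ideal.span {(q:ℤ)}) P
  rw [hin, Ideal.ramificationIdxIn_eq_ramificationIdx (Ideal.span {(q:ℤ)}) P Gal(L/ℚ)] at h1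
  have hmapz : (Ideal.span {(q:ℤ)}).map (algebraMap ℤ (𝓞 L)) = Ideal.span {(q : 𝓞 L)} := by
    rw [Ideal.map_span]; simp
  have hmap : (Ideal.span {(q:ℤ)}).map (algebraMap ℤ (𝓞 L)) ≠ ⊥ := by
    rw [hmapz, Ne, Ideal.span_singleton_eq_bot]
    exact_mod_cast hqp.ne_zero
  rw [Subgroup.card_bot, Ideal.IsDedekindDomain.ramificationIdx_eq_multiplicity (Ideal.span {(q:ℤ)}) P hmap, hmapz] at h1
  have hP0 : P ≠ ⊥ := by
    rintro rfl
    have := (hmem q).2 dvd_rfl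
    rw [Ideal.mem_bot] at this
    exact hqp.ne_zero (by exact_mod_cast this)
  have hPp : Prime P := Ideal.prime_of_isPrime hP0 hP.isPrime
  have hfin : ∀ x : 𝓞 L, x ≠ 0 → FiniteMultiplicity P (Ideal.span {x}) := by
    intro x hx
    apply FiniteMultiplicity.of_prime_left hPp
    rwa [Ne, Ideal.zero_eq_bot, Ideal.span_singleton_eq_bot]
  obtain ⟨u, hu⟩ := padicValInt_dvd (p := q) m
  have hqu : ¬ (q:ℤ) ∣ u := by
    intro h
    have h2 : (q:ℤ) ^ (padicValInt q m + 1) ∣ m := by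
      conv_rhs => rw [hu]
      rw [pow_succ]; exact mul_dvd_mul_left _ h
    rw [padicValInt_dvd_iff] at h2
    rcases h2 with h2 | h2
    · exact hm h2
    · omega
  have hβ0 : β ≠ 0 := by
    rintro rfl
    exact hm (by exact_mod_cast (show (m : 𝓞 L) = 0 by rw [← hβ]; simp))
  have e1 : multiplicity P (Ideal.span {(m : 𝓞 L)}) = padicValInt q m := by
    have hu0 : (u : 𝓞 L) ≠ 0 := by
      intro h
      apply hqu
      have : u = 0 := by exact_mod_cast h
      simp [this]
    have hq0 : ((q:𝓞 L)) ≠ 0 := by exact_mod_cast hqp.ne_zero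
    have e : (m : 𝓞 L) = (q : 𝓞 L) ^ padicValInt q m * u := by
      conv_lhs => rw [hu]
      push_cast; rfl
    rw [e, ← Ideal.span_singleton_mul_span_singleton, ← Ideal.span_singleton_pow,
      multiplicity_mul hPp, (hfin _ hq0).multiplicity_pow hPp, ← h1,
      multiplicity_eq_zero.2, mul_one, add_zero]
    · rw [Ideal.dvd_span_singleton]
      rwa [hmem]
    · rw [Ideal.span_singleton_pow, Ideal.span_singleton_mul_span_singleton]
      exact hfin _ (mul_ne_zero (pow_ne_zero _ hq0) hu0)
  rw [← e1, ← hβ, ← Ideal.span_singleton_pow, (hfin _ hβ0).multiplicity_pow hPp]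
  exact even_two_mul _
end PD
end

section
open scoped Pointwise
namespace PD

/-- a proper subgroup of sign patterns is killed by a nontrivial character -/
lemma exists_char {G L : Type*} [Group G] [Field L] [MulSemiringAction G L] [DecidableEq L]
    (V : Finset L) (δ : L → L)
    (hδ : ∀ g : G, ∀ v ∈ V, g • v = v → g • δ v = δ v ∨ g • δ v = - δ v)
    (A : Finset L)
    (hA : ¬ ∃ h : G, (∀ v ∈ V, h • v = v) ∧ ∀ v ∈ V, h • δ v = if v ∈ A then - δ v else δ v) :
    ∃ c ⊆ V, c.Nonempty ∧ ∀ h : G, (∀ v ∈ V, h • v = v) → h • ∏ v ∈ c, δ v = ∏ v ∈ c, δ v := by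
  classical
  let W : Submodule (ZMod 2) (V → ZMod 2) :=
    { carrier := {a | ∃ h : G, (∀ v ∈ V, h • v = v) ∧ ∀ v : V, h • δ v = if a v = 0 then δ v else - δ v}
      zero_mem' := ⟨1, by simp, by simp⟩
      add_mem' := by
        rintro a b ⟨h, h1, h2⟩ ⟨g, g1, g2⟩
        refine ⟨h * g, fun v hv => by rw [mul_smul, g1 v hv, h1 v hv], fun v => ?_⟩
        rw [mul_smul, g2 v]
        have key : ∀ s t : ZMod 2, s + t = 0 ↔ (s = 0 ↔ t = 0) := by decide
        simp only [Pi.add_apply, key]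
        by_cases hb : b v = 0 <;> by_cases ha : a v = 0 <;> simp [ha, hb, h2 v]
      smul_mem' := by
        rintro t a ⟨h, h1, h2⟩
        have key : ∀ s : ZMod 2, s = 0 ∨ s = 1 := by decide
        rcases key t with rfl | rfl
        · exact ⟨1, by simp, by simp⟩
        · exact ⟨h, h1, by simpa using h2⟩ }
  have hW : W ≠ ⊤ := by
    intro h
    have : (fun v : V => if (v:L) ∈ A then (1 : ZMod 2) else 0) ∈ W := by rw [h]; trivial
    obtain ⟨h, h1, h2⟩ := this
    refine hA ⟨h, h1, fun v hv => ?_⟩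
    rw [h2 ⟨v, hv⟩]
    by_cases hv : v ∈ A <;> simp [hv]
  obtain ⟨f, hf0, hf⟩ := Submodule.exists_le_ker_of_lt_top W hW.lt_top
  refine ⟨V.filter (fun v => ∃ hv : v ∈ V, f (Pi.single ⟨v, hv⟩ 1) ≠ 0), Finset.filter_subset _ _, ?_, ?_⟩
  · by_contra hne
    rw [Finset.not_nonempty_iff_eq_empty, Finset.filter_eq_empty_iff] at hne
    apply hf0
    refine LinearMap.pi_ext' fun v => LinearMap.ext_ring ?_
    have := hne v.2
    push Not at this
    simpa using this v.2
  · intro h hh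
    let a : V → ZMod 2 := fun v => if h • δ v = δ v then 0 else 1
    have haW : a ∈ W := by
      refine ⟨h, hh, fun v => ?_⟩
      by_cases hv : h • δ v = δ v
      · simp [a, hv]
      · simp only [a, hv, if_false, one_ne_zero]
        exact (hδ h v v.2 (hh v v.2)).resolve_left hv
    have hfa : f a = 0 := hf haW
    have key : ∀ s : ZMod 2, s ≠ 0 → s = 1 := by decide
    have e1 : f a = ((Finset.univ.filter (fun v : V => f (Pi.single v 1) ≠ 0 ∧ a v ≠ 0)).card : ZMod 2) := by
      rw [LinearMap.pi_apply_eq_sum_univ f a, Finset.card_filter, Nat.cast_sum]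
      apply Finset.sum_congr rfl
      intro v _
      have e2 : f (fun j => if v = j then 1 else 0) = f (Pi.single v 1) := by
        congr 1; ext j; simp [Pi.single_apply, eq_comm]
      rw [e2]
      by_cases h1 : f (Pi.single v 1) = 0
      · simp [h1]
      · by_cases h2 : a v = 0
        · simp [h2]
        · simp [key _ h1, key _ h2]
    rw [hfa] at e1
    have hev : Even (Finset.univ.filter (fun v : V => f (Pi.single v 1) ≠ 0 ∧ a v ≠ 0)).card :=
      (ZMod.natCast_eq_zero_iff_even).1 e1.symm
    have e3 : ∀ F : L → L, ∏ v ∈ V.filter (fun v => ∃ hv : v ∈ V, f (Pi.single ⟨v, hv⟩ 1) ≠ 0), F v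
        = ∏ v ∈ Finset.univ.filter (fun v : V => f (Pi.single v 1) ≠ 0), F v := by
      intro F
      rw [Finset.prod_filter, Finset.prod_filter, ← Finset.prod_attach]
      apply Finset.prod_congr rfl
      rintro ⟨v, hv⟩ _
      simp [hv]
    rw [e3, Finset.smul_prod']
    have e4 : ∀ v : V, h • δ v = (if a v ≠ 0 then -1 else 1) * δ v := by
      intro v
      by_cases hv : h • δ v = δ v
      · simp [a, hv]
      · simp only [a, hv, if_false, ne_eq, one_ne_zero, not_false_eq_true, if_true]
        rw [(hδ h v v.2 (hh v v.2)).resolve_left hv]; ring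
    simp_rw [e4]
    rw [Finset.prod_mul_distrib, Finset.prod_ite, Finset.filter_filter, Finset.prod_const, Finset.prod_const_one, hev.neg_one_pow]
    simp

lemma prod_fixed {G L : Type*} [Group G] [Finite G] [Field L] [MulSemiringAction G L] [DecidableEq L]
    (h2 : IsPGroup 2 G)
    (V : Finset L) (δ : L → L) (h0 : ∀ v ∈ V, δ v ≠ 0)
    (hst : ∀ g : G, ∀ v ∈ V, g • v ∈ V) (htr : ∀ v ∈ V, ∀ w ∈ V, ∃ g : G, g • v = w)
    (hδ : ∀ g : G, ∀ v ∈ V, g • δ v = δ (g • v) ∨ g • δ v = - δ (g • v))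
    (A : Finset L)
    (hA : ¬ ∃ h : G, (∀ v ∈ V, h • v = v) ∧ ∀ v ∈ V, h • δ v = if v ∈ A then - δ v else δ v) :
    ∀ h : G, (∀ v ∈ V, h • v = v) → h • ∏ v ∈ V, δ v = ∏ v ∈ V, δ v := by
  classical
  have hδ' : ∀ g : G, ∀ v ∈ V, g • v = v → g • δ v = δ v ∨ g • δ v = - δ v := by
    intro g v hv hg
    have := hδ g v hv
    rwa [hg] at this
  obtain ⟨c0, hc0, hc0ne, hc0f⟩ := exists_char V δ hδ' A hA
  let fx : Finset L → Prop := fun c => ∀ h : G, (∀ v ∈ V, h • v = v) → h • ∏ v ∈ c, δ v = ∏ v ∈ c, δ v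
  have hsgn : ∀ g : G, ∀ c ⊆ V, g • ∏ v ∈ c, δ v = ∏ v ∈ g • c, δ v ∨ g • ∏ v ∈ c, δ v = - ∏ v ∈ g • c, δ v := by
    intro g c
    induction c using Finset.induction_on with
    | empty => intro _; left; simp
    | insert a c hac ih =>
      intro hc
      rw [Finset.insert_subset_iff] at hc
      have hac' : g • a ∉ g • c := by rwa [Finset.smul_mem_smul_finset_iff]
      rw [Finset.smul_finset_insert, Finset.prod_insert hac, Finset.prod_insert hac', smul_mul']
      rcases hδ g a hc.1 with e | e <;> rcases ih hc.2 with e' | e' <;> rw [e, e'] <;> simp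
  have hGst : ∀ g : G, ∀ c ⊆ V, fx c → fx (g • c) := by
    intro g c hc hf h hh
    have hconj : (g⁻¹ * h * g) • ∏ v ∈ c, δ v = ∏ v ∈ c, δ v := by
      apply hf
      intro v hv
      rw [mul_smul, mul_smul, hh _ (hst g v hv), inv_smul_smul]
    have h3 : h • g • ∏ v ∈ c, δ v = g • ∏ v ∈ c, δ v := by
      conv_rhs => rw [← hconj]
      rw [← mul_smul, ← mul_smul]; congr 1; group
    rcases hsgn g c hc with e | e
    · rwa [e] at h3
    · rw [e, smul_neg, neg_inj] at h3; exact h3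
  have hsub : ∀ g : G, ∀ c ⊆ V, g • c ⊆ V := by
    intro g c hc x hx
    obtain ⟨y, hy, rfl⟩ := Finset.mem_smul_finset.1 hx
    exact hst g y (hc hy)
  have hsymm : ∀ c ⊆ V, ∀ d ⊆ V, fx c → fx d → fx (symmDiff c d) := by
    intro c hc d hd hfc hfd h hh
    have hne : ∏ v ∈ c ∩ d, δ v ≠ 0 :=
      Finset.prod_ne_zero_iff.2 fun v hv => h0 v (hc (Finset.mem_inter.1 hv).1)
    have e : (∏ v ∈ symmDiff c d, δ v) * (∏ v ∈ c ∩ d, δ v) ^ 2 = (∏ v ∈ c, δ v) * ∏ v ∈ d, δ v := by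
      have e1 : ∏ v ∈ symmDiff c d, δ v = (∏ v ∈ c \ d, δ v) * ∏ v ∈ d \ c, δ v := by
        rw [symmDiff_def, Finset.sup_eq_union, Finset.prod_union disjoint_sdiff_sdiff]
      have e2 := Finset.prod_inter_mul_prod_sdiff c d δ
      have e3 := Finset.prod_inter_mul_prod_sdiff d c δ
      rw [Finset.inter_comm d c] at e3
      rw [e1, ← e2, ← e3]; ring
    have e4 : h • (∏ v ∈ c ∩ d, δ v) ^ 2 = (∏ v ∈ c ∩ d, δ v) ^ 2 := by
      rw [smul_pow', Finset.smul_prod', ← Finset.prod_pow, ← Finset.prod_pow]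
      apply Finset.prod_congr rfl
      intro v hv
      have hv' := hc (Finset.mem_inter.1 hv).1
      rcases hδ' h v hv' (hh v hv') with e | e <;> rw [e]
      ring
    have e5 := congrArg (fun x => h • x) e
    simp only [smul_mul'] at e5
    rw [e4, hfc h hh, hfd h hh, ← e] at e5
    exact mul_right_cancel₀ (pow_ne_zero 2 hne) e5
  let C : SubMulAction G (Finset L) :=
    { carrier := {c | c ⊆ V ∧ fx c}
      smul_mem' := fun g c hc => ⟨hsub g c hc.1, hGst g c hc.1 hc.2⟩ }
  have hCfin : Finite C := by
    apply Set.Finite.to_subtype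
    apply (V.powerset.finite_toSet).subset
    intro c hc
    simpa using hc.1
  have hfe : fx ∅ := by intro h _; simp
  have hCe : Even (Nat.card C) := by
    have : Fintype C := Fintype.ofFinite _
    rw [Nat.card_eq_fintype_card, ← ZMod.natCast_eq_zero_iff_even, ← Finset.card_univ, ← nsmul_one, ← Finset.sum_const]
    refine Finset.sum_involution (fun (c : C) _ => (⟨symmDiff (c : Finset L) c0, ?_, ?_⟩ : C)) ?_ ?_ ?_ ?_
    · intro x hx
      rcases Finset.mem_symmDiff.1 hx with h | h
      · exact c.2.1 h.1
      · exact hc0 h.1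
    · exact hsymm _ c.2.1 _ hc0 c.2.2 hc0f
    · intro c _; decide
    · intro c _ _ h
      have := congrArg Subtype.val h
      simp only at this
      rw [symmDiff_eq_left] at this
      exact hc0ne.ne_empty this
    · intro c _; simp
    · intro c _
      apply Subtype.ext
      simp
  have hfp := h2.exists_fixed_point_of_prime_dvd_card_of_fixed_point C hCe.two_dvd
    (a := ⟨∅, by simp, hfe⟩) (by
      intro g
      apply Subtype.ext
      exact Finset.smul_finset_empty g)
  obtain ⟨⟨c, hcV, hcf⟩, hcfix, hcne⟩ := hfp
  have hcne' : c.Nonempty := by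
    rw [Finset.nonempty_iff_ne_empty]
    rintro rfl
    exact hcne rfl
  have hcV' : c = V := by
    apply hcV.antisymm
    obtain ⟨x, hx⟩ := hcne'
    intro y hy
    obtain ⟨g, rfl⟩ := htr x (hcV hx) y hy
    have := congrArg Subtype.val (hcfix g)
    change g • c = c at this
    rw [← this]
    exact Finset.smul_mem_smul_finset hx
  rw [← hcV']
  rw [hcV'] at hcf
  rw [hcV']
  exact hcf
end PD
end

section
open Polynomial
namespace PD

lemma exists_splitting (P : ℚ[X]) (hP : P.Separable) : ∃ (L : Type) (_ : Field L) (_ : NumberField L) (_ : IsGalois ℚ L),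
    IsSplittingField ℚ L P := by
  have : CharZero P.SplittingField := charZero_of_injective_algebraMap (algebraMap ℚ P.SplittingField).injective
  have key : ∀ inst : Algebra ℚ P.SplittingField, @IsSplittingField ℚ P.SplittingField _ _ inst P →
      @IsSplittingField ℚ P.SplittingField _ _ DivisionRing.toRatAlgebra P := by
    intro inst h
    rwa [Subsingleton.elim DivisionRing.toRatAlgebra inst]
  have hs : @IsSplittingField ℚ P.SplittingField _ _ DivisionRing.toRatAlgebra P :=
    key _ (IsSplittingField.splittingField P)
  have hg : @IsGalois ℚ _ P.SplittingField _ DivisionRing.toRatAlgebra := by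
    exact IsGalois.of_separable_splitting_field hP
  refine ⟨P.SplittingField, inferInstance, { to_charZero := inferInstance, to_finiteDimensional := ?_ }, hg, hs⟩
  exact IsSplittingField.finiteDimensional _ P

section
variable {L : Type} [Field L] [NumberField L] 

open Classical in
noncomputable def Rts (L : Type) [Field L] (k : ℤ) (g : ℤ[X]) (n : ℕ) : Finset L := ((It k g n).aroots L).toFinset

lemma mem_Rts {k : ℤ} {g : ℤ[X]} (hg : g.Monic) {n : ℕ} {x : L} :
    x ∈ Rts L k g n ↔ aeval x (It k g n) = 0 := by
  classical
  rw [Rts, Multiset.mem_toFinset, mem_aroots]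
  simp [(It_monic k hg n).ne_zero]

lemma aeval_smul_gal (σ : Gal(L/ℚ)) (P : ℤ[X]) (x : L) : aeval (σ • x) P = σ • aeval x P :=
  aeval_algHom_apply (MulSemiringAction.toRingHom Gal(L/ℚ) L σ).toIntAlgHom x P

lemma smul_mem_Rts {k : ℤ} {g : ℤ[X]} (hg : g.Monic) {n : ℕ} {x : L} (σ : Gal(L/ℚ)) (hx : x ∈ Rts L k g n) :
    σ • x ∈ Rts L k g n := by
  rw [mem_Rts hg] at hx ⊢
  rw [aeval_smul_gal, hx, smul_zero]

lemma aeval_map_rat (P : ℤ[X]) (x : L) : aeval x (P.map (Int.castRingHom ℚ)) = aeval x P := by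
  rw [← algebraMap_int_eq ℚ]
  exact aeval_map_algebraMap ℚ x P

lemma faithful_of_splitting (P : ℤ[X]) [IsSplittingField ℚ L (P.map (Int.castRingHom ℚ))] (σ : Gal(L/ℚ))
    (h : ∀ x : L, aeval x P = 0 → σ • x = x) : σ = 1 := by
  have h1 := IsSplittingField.adjoin_rootSet L (P.map (Int.castRingHom ℚ))
  have : (σ : L →ₐ[ℚ] L) = AlgHom.id ℚ L := by
    refine AlgHom.ext_of_adjoin_eq_top h1 ?_
    intro x hx
    have := (mem_rootSet.1 hx).2
    rw [aeval_map_rat] at this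
    exact h x this
  ext x
  exact DFunLike.congr_fun this x

variable {k : ℤ} {g : ℤ[X]} {j : ℕ} {N : ℕ → ℤ}

lemma Rts_pi (hg : g.Monic) {n : ℕ} {x : L} (hx : x ∈ Rts L k g (n + 1)) : x ^ 2 + k * x - 1 ∈ Rts L k g n := by
  rw [mem_Rts hg] at hx ⊢
  rwa [← aeval_It_succ]

lemma Rts_nonempty (H : Good k g j N) (M : ℕ) [hs : IsSplittingField ℚ L ((It k g M).map (Int.castRingHom ℚ))] :
    ∀ n ≤ M, (Rts L k g n).Nonempty := by
  have h0 : (Rts L k g M).Nonempty := by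
    have hsp := hs.splits'
    obtain ⟨x, hx⟩ := hsp.exists_eval_eq_zero (by
      rw [degree_map]
      exact (degree_pos_of_irreducible (H.irreducible M)).ne')
    refine ⟨x, (mem_Rts H.monic).2 ?_⟩
    rw [← aeval_map_rat, aeval_def, ← eval_map]; exact hx
  clear hs
  intro n hn
  induction M, hn using Nat.le_induction with
  | base => exact h0
  | succ m hm ih =>
    obtain ⟨x, hx⟩ := h0
    exact ih ⟨_, Rts_pi H.monic hx⟩

lemma minpoly_Rts (H : Good k g j N) {n : ℕ} {x : L} (hx : x ∈ Rts L k g n) :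
    minpoly ℚ x = (It k g n).map (Int.castRingHom ℚ) := by
  rw [mem_Rts H.monic, ← aeval_map_rat] at hx
  exact (minpoly.eq_of_irreducible_of_monic (H.irreducible n) hx ((It_monic k H.monic n).map _)).symm

lemma Rts_trans [IsGalois ℚ L] (H : Good k g j N) {n : ℕ} {x y : L} (hx : x ∈ Rts L k g n) (hy : y ∈ Rts L k g n) :
    ∃ σ : Gal(L/ℚ), σ • x = y := by
  obtain ⟨σ, hσ⟩ := minpoly.exists_algEquiv_of_root (K := ℚ) (x := x) (y := y) (Algebra.IsAlgebraic.isAlgebraic y) (by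
    rw [minpoly_Rts H hy, aeval_map_rat]; exact (mem_Rts H.monic).1 hx)
  exact ⟨σ, hσ⟩

lemma Rts_prod [IsGalois ℚ L] (H : Good k g j N) {n : ℕ} (hne : (Rts L k g n).Nonempty) :
    (It k g n).map (algebraMap ℤ L) = ∏ v ∈ Rts L k g n, (X - C v) := by
  classical
  obtain ⟨x, hx⟩ := hne
  have e : ((It k g n).map (Int.castRingHom ℚ)).map (algebraMap ℚ L) = (It k g n).map (algebraMap ℤ L) := by
    rw [Polynomial.map_map]; congr 1; exact RingHom.ext_int _ _
  have hsp : ((It k g n).map (algebraMap ℤ L)).Splits := by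
    rw [← e, ← minpoly_Rts H hx]
    exact Normal.splits inferInstance x
  have hsep : ((It k g n).map (algebraMap ℤ L)).Separable := by
    rw [← e]
    exact (H.irreducible n).separable.map
  have h1 := hsp.eq_prod_roots_of_monic ((It_monic k H.monic n).map _)
  conv_lhs => rw [h1]
  rw [Finset.prod, Rts, Multiset.toFinset_val, aroots, (nodup_roots hsep).dedup]

lemma N_ne_zero (H : Good k g j N) (n : ℕ) : N n ≠ 0 := by
  intro h
  apply H.nsq n
  rw [h]; exact ⟨0, by simp⟩

lemma N_cast [IsGalois ℚ L] (H : Good k g j N) {n : ℕ} (hne : (Rts L k g n).Nonempty) :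
    (N n : L) = ∏ v ∈ Rts L k g n, ((k:L) ^ 2 + 4 + 4 * v) := by
  have h1 := congrArg (algebraMap ℚ L) (H.hN n)
  have hp := Rts_prod H hne
  have hd : (It k g n).natDegree = (Rts L k g n).card := by
    rw [← (It_monic k H.monic n).natDegree_map (algebraMap ℤ L), hp, natDegree_prod_of_monic _ _ (fun v _ => monic_X_sub_C v)]
    simp
  have h2 : algebraMap ℚ L (aeval (-((k:ℚ) ^ 2 + 4) / 4) (It k g n)) = ∏ v ∈ Rts L k g n, (-((k:L) ^ 2 + 4) / 4 - v) := by
    rw [← aeval_algebraMap_apply, aeval_def, ← eval_map, hp, eval_prod]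
    simp
  rw [map_mul, h2, map_pow, hd, ← Finset.prod_const, ← Finset.prod_mul_distrib] at h1
  rw [show (N n : L) = algebraMap ℚ L (N n : ℚ) by simp, h1]
  apply Finset.prod_congr rfl
  intro v _
  simp only [map_neg, map_ofNat]
  field_simp
  ring

lemma disc_ne (H : Good k g j N) {n : ℕ} {x : L} (hx : x ∈ Rts L k g (n + 1)) : 2 * x + (k : L) ≠ 0 := by
  intro h
  have h1 := Rts_pi H.monic hx
  rw [mem_Rts H.monic] at h1
  have h2 : x ^ 2 + k * x - 1 = algebraMap ℚ L (-((k:ℚ) ^ 2 + 4) / 4) := by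
    simp
    field_simp
    linear_combination (2 * x + k) * h
  rw [h2, aeval_algebraMap_apply] at h1
  have h3 := H.hN n
  rw [(map_eq_zero _).1 h1, mul_zero] at h3
  exact N_ne_zero H n (by exact_mod_cast h3)

lemma pgroup (H : Good k g j N) (M : ℕ) [IsSplittingField ℚ L ((It k g M).map (Int.castRingHom ℚ))] :
    IsPGroup 2 Gal(L/ℚ) := by
  have key : ∀ n : ℕ, ∀ σ : Gal(L/ℚ), ∀ x : L, aeval x (It k X n) = 0 → σ ^ (2 ^ n) • x = x := by
    intro n
    induction n with
    | zero => intro σ x hx; simp only [It, aeval_X] at hx; simp [hx]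
    | succ n ih =>
      intro σ x hx
      rw [aeval_It_succ] at hx
      have h1 := ih σ _ hx
      set τ := σ ^ (2 ^ n) with hτ
      have h2 : σ ^ (2 ^ (n+1)) = τ * τ := by rw [hτ, ← sq, ← pow_mul, pow_succ]
      have h3 : (τ • x) ^ 2 + k * (τ • x) - 1 = x ^ 2 + k * x - 1 := by
        rw [← h1]
        simp [smul_sub, smul_add, smul_mul', smul_pow', AlgEquiv.smul_def]
      have h4 : (τ • x - x) * (τ • x + x + k) = 0 := by linear_combination h3
      rw [h2, mul_smul]
      rcases mul_eq_zero.1 h4 with h | h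
      · rw [sub_eq_zero] at h
        rw [h, h]
      · have h5 : τ • x = - k - x := by linear_combination h
        have h6 : τ • (τ • x) = - k - τ • x := by
          conv_lhs => rw [h5]
          simp [AlgEquiv.smul_def]
        rw [h6, h5]; ring
  intro σ
  refine ⟨M + j, ?_⟩
  apply faithful_of_splitting (It k g M)
  intro x hx
  apply key
  obtain ⟨r, hr⟩ := It_dvd k H.dvd M
  rw [hr, map_mul, hx, zero_mul]

lemma int_lift (x : L) (hx : IsIntegral ℤ x) : ∃ α : NumberField.RingOfIntegers L,
    algebraMap (NumberField.RingOfIntegers L) L α = x := ⟨⟨x, hx⟩, rfl⟩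

lemma maximal [IsGalois ℚ L] (H : Good k g j N) (M : ℕ) [IsSplittingField ℚ L ((It k g M).map (Int.castRingHom ℚ))]
    (n : ℕ) (hn : n < M) (q : ℕ) (hq : q.Prime) (hodd : Odd (padicValInt q (N n)))
    (hB : ∀ i ≤ n + j, ¬ (q:ℤ) ∣ Bs k i) [DecidableEq L] (A : Finset L) :
    ∃ h : Gal(L/ℚ), (∀ x ∈ Rts L k g n, h • x = x) ∧
      ∀ x ∈ Rts L k g (n + 1), h • x = if x ^ 2 + k * x - 1 ∈ A then - k - x else x := by
  have hne := Rts_nonempty (L := L) H M n hn.le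
  have hsur : ∀ v, ∃ x, v ∈ Rts L k g n → x ∈ Rts L k g (n+1) ∧ x ^ 2 + k * x - 1 = v := by
    intro v
    by_cases hv : v ∈ Rts L k g n
    · obtain ⟨y, hy⟩ := Rts_nonempty (L := L) H M (n+1) hn
      obtain ⟨σ, hσ⟩ := Rts_trans H (Rts_pi H.monic hy) hv
      refine ⟨σ • y, fun _ => ⟨smul_mem_Rts H.monic σ hy, ?_⟩⟩
      rw [← hσ]
      simp [smul_sub, smul_add, smul_mul', smul_pow', AlgEquiv.smul_def]
    · exact ⟨0, fun h => absurd h hv⟩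
  choose xs hxs using hsur
  let δ : L → L := fun v => 2 * xs v + k
  have hδ2 : ∀ v ∈ Rts L k g n, δ v ^ 2 = (k:L) ^ 2 + 4 + 4 * v := by
    intro v hv
    have := (hxs v hv).2
    simp only [δ]
    linear_combination 4 * this
  have hδ0 : ∀ v ∈ Rts L k g n, δ v ≠ 0 := fun v hv => disc_ne H (hxs v hv).1
  have hδg : ∀ σ : Gal(L/ℚ), ∀ v ∈ Rts L k g n, σ • δ v = δ (σ • v) ∨ σ • δ v = - δ (σ • v) := by
    intro σ v hv
    apply sq_eq_sq_iff_eq_or_eq_neg.1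
    rw [hδ2 _ (smul_mem_Rts H.monic σ hv), ← smul_pow', hδ2 v hv]
    have four : σ (4:L) = 4 := map_ofNat σ 4
    simp [AlgEquiv.smul_def, four]
  by_contra hcon
  have hfix := prod_fixed (pgroup H M) (Rts L k g n) δ hδ0 (fun σ v hv => smul_mem_Rts H.monic σ hv)
    (fun v hv w hw => Rts_trans H hv hw) hδg A (by
      rintro ⟨h, h1, h2⟩
      apply hcon
      refine ⟨h, h1, fun x hx => ?_⟩
      have hv := Rts_pi H.monic hx
      set v := x ^ 2 + k * x - 1 with hvdef
      have e1 : (2 * x + k) ^ 2 = δ v ^ 2 := by rw [hδ2 v hv, hvdef]; ring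
      have e2 : h • (2 * x + (k:L)) = 2 * (h • x) + k := by
        have two : h (2:L) = 2 := map_ofNat h 2
        simp [AlgEquiv.smul_def, two]
      have e3 := h2 v hv
      have e4 : h • (2 * x + (k:L)) = if v ∈ A then -(2 * x + (k:L)) else 2 * x + (k:L) := by
        rcases sq_eq_sq_iff_eq_or_eq_neg.1 e1 with e | e
        · rw [e]; exact e3
        · rw [e, smul_neg, e3]
          split_ifs <;> simp
      rw [e2] at e4
      have two : (2:L) ≠ 0 := two_ne_zero
      apply mul_left_cancel₀ two
      split_ifs at e4 ⊢ <;> linear_combination e4)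
  set β := ∏ v ∈ Rts L k g n, δ v with hβ
  have hβ2 : β ^ 2 = N n := by
    rw [N_cast H hne, hβ, ← Finset.prod_pow]
    exact Finset.prod_congr rfl hδ2
  obtain ⟨E, _, _, _, hE⟩ := exists_splitting ((It k g n).map (Int.castRingHom ℚ)) (H.irreducible n).separable
  obtain ⟨x0, hx0⟩ := hne
  have hsp : (((It k g n).map (Int.castRingHom ℚ)).map (algebraMap ℚ L)).Splits := by
    rw [← minpoly_Rts H hx0]
    exact Normal.splits inferInstance x0
  let σ : E →ₐ[ℚ] L := IsSplittingField.lift E _ hsp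
  have hrange : ∀ x ∈ Rts L k g n, x ∈ σ.fieldRange := by
    intro x hx
    have h1 := hE.splits'.image_rootSet σ
    have h2 : x ∈ ((It k g n).map (Int.castRingHom ℚ)).rootSet L := by
      rw [mem_rootSet]
      refine ⟨(H.irreducible n).ne_zero, ?_⟩
      rw [aeval_map_rat]; exact (mem_Rts H.monic).1 hx
    rw [← h1] at h2
    obtain ⟨e, _, he⟩ := h2
    exact ⟨e, he⟩
  have hβE : β ∈ σ.fieldRange := by
    rw [← IsGalois.fixedField_fixingSubgroup σ.fieldRange, IntermediateField.mem_fixedField_iff]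
    intro h hh
    apply hfix
    intro v hv
    exact (IntermediateField.mem_fixingSubgroup_iff _ _).1 hh v (hrange v hv)
  obtain ⟨e, he⟩ := hβE
  have he2 : e ^ 2 = (N n : E) := by
    apply σ.toRingHom.injective
    change σ (e ^ 2) = σ (N n : E)
    rw [map_pow, show σ e = β from he, hβ2, map_intCast]
  have heint : IsIntegral ℤ e := by
    refine ⟨X ^ 2 - C (N n), by monicity!, ?_⟩
    rw [eval₂_sub, eval₂_pow, eval₂_X, eval₂_C, he2]
    simp
  obtain ⟨b, hb⟩ := int_lift e heint
  have := even_val q hq k (n + j) hB (L := E) (by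
    intro τ hτ
    apply faithful_of_splitting (It k g n)
    intro x hx
    obtain ⟨α, hα⟩ := int_lift x ⟨It k g n, It_monic k H.monic n, hx⟩
    have h1 := hτ α (by
      apply FaithfulSMul.algebraMap_injective (NumberField.RingOfIntegers E) E
      rw [← aeval_algebraMap_apply, hα, map_zero]
      obtain ⟨r, hr⟩ := It_dvd k H.dvd n
      rw [hr, map_mul, hx, zero_mul])
    rw [← hα]
    exact congrArg (algebraMap (NumberField.RingOfIntegers E) E) h1) b (N n) (N_ne_zero H n) (by
      apply FaithfulSMul.algebraMap_injective (NumberField.RingOfIntegers E) E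
      rw [map_pow, hb, he2, map_intCast])
  exact (Nat.not_even_iff_odd.2 hodd) this

end
end PD
end

section
open Polynomial
namespace PD
variable {k : ℤ} {g : ℤ[X]} {j : ℕ} {N : ℕ → ℤ}

open scoped Classical in
noncomputable def cnt (F : ℤ[X]) (x : ℕ) : ℕ :=
  ((Finset.range (x + 1)).filter (fun p : ℕ => p.Prime ∧ ∃ a : ℤ, (p:ℤ) ∣ F.eval a)).card

lemma exists_levels (H : Good k g j N) (r : ℕ) : ∃ lev : Finset ℕ, lev.card = r ∧ ∀ n ∈ lev,
    ∃ q : ℕ, q.Prime ∧ Odd (padicValInt q (N n)) ∧ ∀ i ≤ n + j, ¬ (q:ℤ) ∣ Bs k i := by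
  have hinf : Set.Infinite {n : ℕ | ∃ q : ℕ, q.Prime ∧ Odd (padicValInt q (N n)) ∧ ∀ i ≤ n + j, ¬ (q:ℤ) ∣ Bs k i} := by
    apply Set.infinite_of_not_bddAbove
    rintro ⟨b, hb⟩
    obtain ⟨n, hn, q, h1, _, h2, h3⟩ := H.lev (b + 1)
    have := hb (show n ∈ _ from ⟨q, h1, h2, h3⟩)
    omega
  obtain ⟨lev, h1, h2⟩ := hinf.exists_subset_card_eq r
  exact ⟨lev, h2, fun n hn => h1 hn⟩

lemma good_raw (H : Good k g j N) (T r : ℕ) : ∃ (M G S m N₀ : ℕ), 0 < G ∧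
    r * ((T + 1) * S) ≤ (T + 1) * 2 ^ T * G + r * G ∧
    ∀ x ≥ N₀, (G : ℝ) * (cnt (It k g M) x) ≤ m + 14 * S * (x / Real.log x) := by
  classical
  obtain ⟨lev, hcard, hlev⟩ := exists_levels H r
  set M := lev.sup id + 1 with hM
  have hlt : ∀ n ∈ lev, n < M := fun n hn => Nat.lt_succ_of_le (Finset.le_sup (f := id) hn)
  obtain ⟨L, _, _, _, hL⟩ := exists_splitting ((It k g M).map (Int.castRingHom ℚ)) (H.irreducible M).separable
  have : Fintype Gal(L/ℚ) := Fintype.ofFinite _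
  let S : Finset Gal(L/ℚ) := Finset.univ.filter (fun σ => ∃ x ∈ Rts L k g M, σ • x = x)
  have hne := Rts_nonempty (L := L) H M
  have h1 := ext_bound (G := Gal(L/ℚ)) (X := L) (fun n => Rts L k g n) (fun x => x ^ 2 + k * x - 1) (fun x => - k - x) M
    (fun n _ σ x hx => smul_mem_Rts H.monic σ hx) (fun n _ x hx y hy => Rts_trans H hx hy) hne
    (fun σ x => by simp [AlgEquiv.smul_def]) (fun n _ x hx => Rts_pi H.monic hx)
    (fun n _ x hx y hy hxy => by
      have h : (y - x) * (y + x + k) = 0 := by linear_combination -hxy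
      rcases mul_eq_zero.1 h with h | h
      · left; exact sub_eq_zero.1 h
      · right; linear_combination h)
    (fun n _ x hx h => disc_ne H hx (by linear_combination -h))
    lev (fun n hn => by
      obtain ⟨q, hq, h2, h3⟩ := hlev n hn
      exact ⟨hlt n hn, fun A => maximal H M n (hlt n hn) q hq h2 h3 A⟩) T
  let R' : Finset (NumberField.RingOfIntegers L) := (Rts L k g M).preimage (algebraMap _ L)
    ((FaithfulSMul.algebraMap_injective (NumberField.RingOfIntegers L) L).injOn)
  have hinj := FaithfulSMul.algebraMap_injective (NumberField.RingOfIntegers L) L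
  have himg : R'.image (algebraMap _ L) = Rts L k g M := by
    rw [Finset.image_preimage, Finset.filter_true_of_mem]
    intro x hx
    obtain ⟨α, hα⟩ := int_lift x ⟨It k g M, It_monic k H.monic M, (mem_Rts H.monic).1 hx⟩
    exact ⟨α, hα⟩
  have hmem : ∀ α, α ∈ R' ↔ algebraMap _ L α ∈ Rts L k g M := fun α => Finset.mem_preimage
  have hsm : ∀ (σ : Gal(L/ℚ)) (α : NumberField.RingOfIntegers L), algebraMap _ L (σ • α) = σ • algebraMap _ L α := fun σ α => rfl
  obtain ⟨m, N₀, hmN⟩ := count_bound (pgroup (L := L) H M) (It k g M) R' (by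
      apply Polynomial.map_injective (algebraMap (NumberField.RingOfIntegers L) L) hinj
      rw [Polynomial.map_map, ← IsScalarTower.algebraMap_eq, Rts_prod H (hne M le_rfl), ← himg,
        Finset.prod_image hinj.injOn, Polynomial.map_prod]
      simp)
    (fun σ α hα => by
      rw [hmem] at hα ⊢
      rw [hsm]
      exact smul_mem_Rts H.monic σ hα)
    (fun σ h => by
      apply faithful_of_splitting (It k g M)
      intro x hx
      rw [← mem_Rts H.monic, ← himg, Finset.mem_image] at hx
      obtain ⟨α, hα, rfl⟩ := hx
      rw [← hsm, h α hα]) S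
    (fun σ => by
      simp only [S, Finset.mem_filter, Finset.mem_univ, true_and]
      constructor
      · rintro ⟨x, hx, hσ⟩
        rw [← himg, Finset.mem_image] at hx
        obtain ⟨α, hα, rfl⟩ := hx
        exact ⟨α, hα, hinj (by rw [hsm, hσ])⟩
      · rintro ⟨α, hα, hσ⟩
        exact ⟨algebraMap _ L α, (hmem α).1 hα, by rw [← hsm, hσ]⟩)
  refine ⟨M, Fintype.card Gal(L/ℚ), S.card, m, N₀, Fintype.card_pos, ?_, ?_⟩
  · rw [hcard] at h1
    convert h1 using 4
  · intro x hx
    have := hmN x hx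
    rw [Nat.card_eq_fintype_card] at this
    convert this using 3
    unfold cnt
    congr!

lemma cnt_mono (k : ℤ) (g : ℤ[X]) (M M' x : ℕ) (h : M ≤ M') : cnt (It k g M') x ≤ cnt (It k g M) x := by
  classical
  induction M', h using Nat.le_induction with
  | base => exact le_rfl
  | succ m _ ih =>
    refine le_trans ?_ ih
    unfold cnt
    apply Finset.card_le_card
    apply Finset.monotone_filter_right
    rintro p _ ⟨hp, a, ha⟩
    refine ⟨hp, (fk k).eval a, ?_⟩
    rwa [It, eval_comp] at ha

lemma good_bound (H : Good k g j N) (ε : ℝ) (hε : 0 < ε) : ∃ M : ℕ, ∀ M' ≥ M, ∃ (C : ℝ) (N₀ : ℕ), ∀ x ≥ N₀,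
    (cnt (It k g M') x : ℝ) ≤ C + ε * (x / Real.log x) := by
  obtain ⟨T, hT⟩ := exists_nat_gt (28 / ε)
  obtain ⟨r, hr⟩ := exists_nat_gt (28 * 2 ^ T / ε)
  obtain ⟨M, G, S, m, N₀, hG, hS, hb⟩ := good_raw H T r
  refine ⟨M, fun M' hM' => ⟨m / G, max N₀ 2, fun x hx => ?_⟩⟩
  have hG' : (0:ℝ) < G := by exact_mod_cast hG
  have h1 := hb x (le_trans (le_max_left _ _) hx)
  have h2 : (cnt (It k g M') x : ℝ) ≤ cnt (It k g M) x := by exact_mod_cast cnt_mono k g M M' x hM'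
  have hr0 : (0:ℝ) < r := lt_of_le_of_lt (by positivity) hr
  have hlog : 0 ≤ (x:ℝ) / Real.log x := div_nonneg (by positivity) (Real.log_natCast_nonneg x)
  have hS' : (r:ℝ) * ((T + 1) * S) ≤ (T + 1) * 2 ^ T * G + r * G := by exact_mod_cast hS
  have h3 : 14 * (S:ℝ) ≤ ε * G := by
    rw [div_lt_iff₀ hε] at hT hr
    have a1 : 28 * ((T:ℝ) + 1) * 2 ^ T * G ≤ (T + 1) * (r * ε) * G := by
      have : (28 * 2 ^ T : ℝ) * ((T + 1) * G) ≤ (r * ε) * ((T + 1) * G) := by gcongr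
      linarith
    have a2 : (28:ℝ) * (r * G) ≤ ((T + 1) * ε) * (r * G) := by
      apply mul_le_mul_of_nonneg_right _ (by positivity)
      nlinarith
    have a3 : (r:ℝ) * (T + 1) * (14 * S) ≤ r * (T + 1) * (ε * G) := by nlinarith
    exact le_of_mul_le_mul_left a3 (by positivity)
  rw [div_add' _ _ _ hG'.ne', le_div_iff₀ hG']
  have h4 := mul_le_mul_of_nonneg_right h3 hlog
  have h5 := mul_le_mul_of_nonneg_right h2 hG'.le
  nlinarith
end PD
end

namespace PD

lemma It_It (k : ℤ) (g : ℤ[X]) (j n : ℕ) : It k (It k g j) n = It k g (n + j) := by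
  induction n with
  | zero => simp [It]
  | succ n ih => rw [It, ih, show n + 1 + j = (n + j) + 1 by ring, It]

lemma It_mul (k : ℤ) (g h : ℤ[X]) (n : ℕ) : It k (g * h) n = It k g n * It k h n := by
  induction n with
  | zero => simp [It]
  | succ n ih => rw [It, ih, mul_comp, It, It]

lemma eval_It (k : ℤ) (m : ℕ) : ∀ a : ℤ, (It k X m).eval a = (fun x => Polynomial.eval x (fk k))^[m] a := by
  induction m with
  | zero => intro a; simp [It]
  | succ m ih => intro a; rw [It, eval_comp, ih, Function.iterate_succ_apply]

lemma cnt_mul (F G : ℤ[X]) (x : ℕ) : cnt (F * G) x ≤ cnt F x + cnt G x := by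
  classical
  unfold cnt
  refine le_trans (Finset.card_le_card ?_) (Finset.card_union_le _ _)
  intro p hp
  simp only [Finset.mem_filter, Finset.mem_union] at hp ⊢
  obtain ⟨h1, h2, a, ha⟩ := hp
  rw [eval_mul] at ha
  rcases (Nat.prime_iff_prime_int.1 h2).dvd_or_dvd ha with h | h
  · left; exact ⟨h1, h2, a, h⟩
  · right; exact ⟨h1, h2, a, h⟩

/-- for every admissible `k`, few primes have a root of a high iterate -/
lemma iter_bound (k : ℤ) (hk0 : k ≠ 0) (hk2 : k ≠ 2) (ε : ℝ) (hε : 0 < ε) :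
    ∃ (m : ℕ) (C : ℝ) (N₀ : ℕ), ∀ x ≥ N₀, (cnt (It k X m) x : ℝ) ≤ C + ε * (x / Real.log x) := by
  by_cases h1 : k = -1
  · subst h1
    obtain ⟨M1, hM1⟩ := good_bound good_g1 (ε / 2) (by positivity)
    obtain ⟨M2, hM2⟩ := good_bound good_g2 (ε / 2) (by positivity)
    obtain ⟨C1, N1, h1⟩ := hM1 (max M1 M2) (le_max_left _ _)
    obtain ⟨C2, N2, h2⟩ := hM2 (max M1 M2) (le_max_right _ _)
    refine ⟨max M1 M2 + 3, C1 + C2, max N1 N2, fun x hx => ?_⟩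
    rw [← It_It, ← g1_mul_g2, It_mul]
    have a1 := h1 x (le_trans (le_max_left _ _) hx)
    have a2 := h2 x (le_trans (le_max_right _ _) hx)
    have a3 : (cnt (It (-1) g1 (max M1 M2) * It (-1) g2 (max M1 M2)) x : ℝ) ≤
        cnt (It (-1) g1 (max M1 M2)) x + cnt (It (-1) g2 (max M1 M2)) x := by
      exact_mod_cast cnt_mul _ _ x
    linarith
  · by_cases h4 : k = 4
    · subst h4
      obtain ⟨M, hM⟩ := good_bound good_four ε hε
      obtain ⟨C, N₀, h⟩ := hM M le_rfl
      refine ⟨M + 2, C, N₀, fun x hx => ?_⟩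
      rw [← It_It]
      exact h x hx
    · obtain ⟨M, hM⟩ := good_bound (good_generic k hk0 hk2 h1 h4) ε hε
      obtain ⟨C, N₀, h⟩ := hM M le_rfl
      exact ⟨M, C, N₀, h⟩

lemma orbit_bound (k : ℤ) (a₀ : ℤ) (m : ℕ) : ∃ C : ℕ, ∀ x, primeCount (orbitPrimes (fk k) a₀) x ≤ C + cnt (It k X m) x := by
  classical
  let B : Finset ℕ := (Finset.range m).biUnion fun n => ((fun x => Polynomial.eval x (fk k))^[n] a₀).natAbs.primeFactors
  refine ⟨B.card, fun x => ?_⟩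
  unfold primeCount cnt
  refine le_trans (Finset.card_le_card ?_) (Finset.card_union_le _ _)
  intro p hp
  simp only [Finset.mem_filter, Finset.mem_union] at hp ⊢
  obtain ⟨h1, h2, n, h3, h4⟩ := hp
  by_cases hn : n < m
  · left
    simp only [B, Finset.mem_biUnion, Finset.mem_range]
    refine ⟨n, hn, ?_⟩
    rw [Nat.mem_primeFactors]
    exact ⟨h2, Int.natCast_dvd.1 h4, Int.natAbs_ne_zero.2 h3⟩
  · right
    refine ⟨h1, h2, (fun x => Polynomial.eval x (fk k))^[n - m] a₀, ?_⟩
    rwa [eval_It, ← Function.iterate_add_apply, show m + (n - m) = n by omega]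

lemma primeCount_prime (x : ℕ) : primeCount {p | p.Prime} x = Nat.primeCounting x := by
  classical
  rw [Nat.primeCounting, Nat.primeCounting', Nat.count_eq_card_filter_range, primeCount]
  congr 1
  ext p
  simp

lemma pi_lower : ∀ᶠ x : ℕ in atTop, (x : ℝ) / (2 * Real.log x) ≤ Nat.primeCounting x := by
  have h1 : ∀ᶠ x : ℕ in atTop, Real.log (x + 1) ≤ (1/8 : ℝ) * (x + 1) := by
    have := (Real.isLittleO_log_id_atTop.bound (show (0:ℝ) < 1/8 by norm_num))
    have h := (tendsto_natCast_atTop_atTop (R := ℝ)).comp (tendsto_add_atTop_nat 1)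
    filter_upwards [h.eventually this] with x hx
    simp only [Function.comp, id, Real.norm_eq_abs] at hx
    push_cast at hx
    rw [abs_of_nonneg (show (0:ℝ) ≤ (x:ℝ) + 1 by positivity)] at hx
    exact le_trans (le_abs_self _) hx
  filter_upwards [h1, eventually_ge_atTop 4] with x hx hx4
  refine le_trans ?_ (Chebyshev.pi_ge x)
  have hx4' : (4:ℝ) ≤ x := by exact_mod_cast hx4
  have hl : 0 < Real.log x := Real.log_pos (by linarith)
  rw [div_le_div_iff₀ (by positivity) hl]
  have h2 := Real.log_two_gt_d9
  have h3 : (x:ℝ) ≤ 2 * (x * Real.log 2 - Real.log (x + 1)) := by nlinarith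
  nlinarith

lemma density_zero_of_bound (S : Set ℕ)
    (h : ∀ ε > (0:ℝ), ∃ (C : ℝ) (N₀ : ℕ), ∀ x ≥ N₀, (primeCount S x : ℝ) ≤ C + ε * (x / Real.log x)) :
    HasPrimeDensityZero S := by
  unfold HasPrimeDensityZero
  rw [Metric.tendsto_atTop']
  intro ε hε
  obtain ⟨C, N₀, hC⟩ := h (ε / 8) (by positivity)
  have hlim : ∀ᶠ x : ℕ in atTop, Real.log x * |C| ≤ ε / 8 * x := by
    have := (Real.isLittleO_log_id_atTop.bound (show (0:ℝ) < ε / 8 / (|C| + 1) by positivity))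
    filter_upwards [(tendsto_natCast_atTop_atTop (R := ℝ)).eventually this] with x hx
    simp only [id, Real.norm_eq_abs] at hx
    rw [abs_of_nonneg (show (0:ℝ) ≤ (x:ℝ) by positivity), abs_of_nonneg (Real.log_natCast_nonneg x)] at hx
    have h1 := mul_le_mul_of_nonneg_right hx (show 0 ≤ |C| + 1 by positivity)
    have h2 : ε / 8 / (|C| + 1) * x * (|C| + 1) = ε / 8 * x := by field_simp
    rw [h2] at h1
    have := Real.log_natCast_nonneg x
    nlinarith
  obtain ⟨X0, hX0⟩ := eventually_atTop.1 (hlim.and (pi_lower.and (eventually_ge_atTop (max N₀ 4))))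
  refine ⟨X0, fun x hx => ?_⟩
  obtain ⟨a1, a2, a3⟩ := hX0 x (by omega)
  have hx4 : (4:ℝ) ≤ x := by exact_mod_cast le_trans (le_max_right _ _) a3
  have hl : 0 < Real.log x := Real.log_pos (by linarith)
  rw [primeCount_prime, Real.dist_eq, sub_zero, abs_of_nonneg (by positivity)]
  have hpi : 0 < (Nat.primeCounting x : ℝ) := lt_of_lt_of_le (by positivity) a2
  rw [div_lt_iff₀ hpi]
  have b1 := hC x (le_trans (le_max_left _ _) a3)
  have b2 : C ≤ ε / 8 * (x / Real.log x) := by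
    rw [mul_div_assoc', le_div_iff₀ hl]
    have := le_abs_self C
    nlinarith
  have b3 : (x:ℝ) / Real.log x ≤ 2 * Nat.primeCounting x := by
    have : (x:ℝ) / Real.log x = 2 * (x / (2 * Real.log x)) := by field_simp
    rw [this]; linarith
  nlinarith

lemma main_result (k : ℤ) (hk0 : k ≠ 0) (hk2 : k ≠ 2) (a₀ : ℤ) : HasPrimeDensityZero (orbitPrimes (fk k) a₀) := by
  apply density_zero_of_bound
  intro ε hε
  obtain ⟨m, C, N₀, h⟩ := iter_bound k hk0 hk2 ε hε
  obtain ⟨C', h'⟩ := orbit_bound k a₀ m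
  refine ⟨C' + C, N₀, fun x hx => ?_⟩
  have a1 := h x hx
  have a2 : (primeCount (orbitPrimes (fk k) a₀) x : ℝ) ≤ C' + cnt (It k X m) x := by exact_mod_cast h' x
  linarith
end PD

theorem density_zero_of_X_sq_add_kX_sub_one (k : ℤ) (hk0 : k ≠ 0) (hk2 : k ≠ 2) (a₀ : ℤ) :
    HasPrimeDensityZero (orbitPrimes (X ^ 2 + C k * X - 1) a₀) := by
  exact PD.main_result k hk0 hk2 a₀
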